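/- arXiv:1105.1239 — 2 statements merged into one kernel-verified Lean document; each statement's English description precedes it below -/
import Mathlib

section
/- Suppose k satisfies assumption (*), and let n ≥ 1. Then there exists a function Z(t,x) ≥ 0, defined for t > 0 and x ∈ ℝⁿ, x ≠ 0, which is locally integrable in t for each fixed x ≠ 0 and infinitely differentiable in x ≠ 0, such that ∫_{ℝⁿ} Z(t,x) dx = 1 for t > 0, and for every bounded globally Hölder continuous function w₀ (i.e., |w₀(ξ) − w₀(η)| ≤ C|ξ−η|^γ for some 0 < γ ≤ 1 and all ξ, η ∈ ℝⁿ), the function w(t,x) = ∫_{ℝⁿ} Z(t, x−ξ) w₀(ξ) dξ is an LT-solution of the Cauchy problem (D_(k) w)(t,x) = Δw(t,x), w(0,x) = w₀(x); that is: w is bounded, w is continuous in t on [0,∞) uniformly with respect to x ∈ ℝⁿ, w(0,x) = w₀(x), and for each p > 0 the Laplace transform w̃(p,x) = ∫₀^∞ e^{−pt} w(t,x) dt is twice continuously differentiable in x and satisfies p·K(p)·w̃(p,x) − K(p)·w₀(x) = Δ_x w̃(p,x) for all x ∈ ℝⁿ. -/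
open MeasureTheory Filter Set

/-- The Laplacian of `f : ℝⁿ → ℝ` at `x`: the sum of the pure second partial
derivatives in the coordinate directions. -/
noncomputable def lap {n : ℕ} (f : EuclideanSpace ℝ (Fin n) → ℝ)
    (x : EuclideanSpace ℝ (Fin n)) : ℝ :=
  ∑ i : Fin n,
    iteratedFDeriv ℝ 2 f x ![EuclideanSpace.single i 1, EuclideanSpace.single i 1]

section SubordinatedHeatEquation

open scoped Topology ENNReal

/-- The `j`-fold convolution power of a measure on the line. -/
noncomputable def convPow (m : Measure ℝ) : ℕ → Measure ℝ
  | 0 => Measure.dirac 0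
  | j + 1 => m.conv (convPow m j)

instance isFiniteMeasure_convPow (m : Measure ℝ) [IsFiniteMeasure m] (j : ℕ) :
    IsFiniteMeasure (convPow m j) := by
  induction j with
  | zero => unfold convPow; infer_instance
  | succ j ih => unfold convPow; infer_instance

/-- The compound Poisson law with finite jump measure `m`. -/
noncomputable def compoundPoisson (m : Measure ℝ) : Measure ℝ :=
  Measure.sum fun j : ℕ =>
    ENNReal.ofReal (Real.exp (-m.real univ) / j.factorial) • convPow m j

lemma lintegral_exp_convPow (m : Measure ℝ) [IsFiniteMeasure m] (p : ℝ) (j : ℕ) :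
    ∫⁻ x, ENNReal.ofReal (Real.exp (-p * x)) ∂(convPow m j) =
      (∫⁻ x, ENNReal.ofReal (Real.exp (-p * x)) ∂m) ^ j := by
  induction j with
  | zero => simp [convPow]
  | succ j ih =>
    rw [convPow, Measure.lintegral_conv (by fun_prop)]
    simp_rw [mul_add, Real.exp_add, ENNReal.ofReal_mul (Real.exp_nonneg _)]
    simp_rw [lintegral_const_mul' _ _ ENNReal.ofReal_ne_top]
    rw [lintegral_mul_const _ (by fun_prop), ih, pow_succ']

lemma lintegral_exp_compoundPoisson (m : Measure ℝ) [IsFiniteMeasure m] (p l : ℝ) (hl0 : 0 ≤ l)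
    (hl : ∫⁻ x, ENNReal.ofReal (Real.exp (-p * x)) ∂m = ENNReal.ofReal l) :
    ∫⁻ x, ENNReal.ofReal (Real.exp (-p * x)) ∂(compoundPoisson m) =
      ENNReal.ofReal (Real.exp (l - m.real univ)) := by
  rw [compoundPoisson, lintegral_sum_measure]
  simp_rw [lintegral_smul_measure, lintegral_exp_convPow, hl, smul_eq_mul,
    ← ENNReal.ofReal_pow hl0]
  have h : HasSum (fun j : ℕ => Real.exp (-m.real univ) / j.factorial * l ^ j)
      (Real.exp (l - m.real univ)) := by
    have := (NormedSpace.expSeries_div_hasSum_exp (𝔸 := ℝ) l).mul_left (Real.exp (-m.real univ))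
    rw [← Real.exp_eq_exp_ℝ, ← Real.exp_add] at this
    rw [neg_add_eq_sub] at this
    refine Eq.subst (motive := fun g => HasSum g _) (funext fun j => ?_) this
    ring
  rw [← h.tsum_eq, ENNReal.ofReal_tsum_of_nonneg (fun j => by positivity) h.summable]
  congr 1; ext j
  rw [ENNReal.ofReal_mul (by positivity)]

instance isProbabilityMeasure_compoundPoisson (m : Measure ℝ) [IsFiniteMeasure m] :
    IsProbabilityMeasure (compoundPoisson m) := by
  constructor
  have := lintegral_exp_compoundPoisson m 0 (m.real univ) measureReal_nonneg (by simp)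
  simpa using this

lemma charFun_convPow (m : Measure ℝ) [IsFiniteMeasure m] (j : ℕ) (t : ℝ) :
    charFun (convPow m j) t = charFun m t ^ j := by
  induction j with
  | zero => simp [convPow]
  | succ j ih => rw [convPow, charFun_conv, ih, pow_succ']

lemma integrable_exp_inner_mul_I (m : Measure ℝ) [IsFiniteMeasure m] (t : ℝ) :
    Integrable (fun x : ℝ => Complex.exp (inner ℝ x t * Complex.I)) m :=
  (integrable_const (1 : ℝ)).mono (by fun_prop)
    (by filter_upwards with x; rw [Complex.norm_exp_ofReal_mul_I]; simp)

lemma charFun_compoundPoisson (m : Measure ℝ) [IsFiniteMeasure m] (t : ℝ) :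
    charFun (compoundPoisson m) t = Complex.exp (charFun m t - m.real univ) := by
  have h_int := integrable_exp_inner_mul_I (compoundPoisson m) t
  rw [charFun_apply]
  unfold compoundPoisson at h_int ⊢
  rw [integral_sum_measure h_int]
  simp_rw [integral_smul_measure]
  have h : HasSum (fun j : ℕ => Complex.exp (-m.real univ) * (charFun m t ^ j / j.factorial))
      (Complex.exp (charFun m t - m.real univ)) := by
    have := (NormedSpace.expSeries_div_hasSum_exp (𝔸 := ℂ) (charFun m t)).mul_left
      (Complex.exp (-m.real univ))
    rwa [← Complex.exp_eq_exp_ℂ, ← Complex.exp_add, neg_add_eq_sub] at this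
  rw [← h.tsum_eq]
  congr 1; ext j
  rw [← charFun_apply, charFun_convPow, ENNReal.toReal_ofReal (by positivity), Complex.real_smul]
  push_cast
  ring

lemma compoundPoisson_add (m m' : Measure ℝ) [IsFiniteMeasure m] [IsFiniteMeasure m'] :
    compoundPoisson (m + m') = (compoundPoisson m).conv (compoundPoisson m') := by
  apply Measure.ext_of_charFun
  ext t
  rw [charFun_conv, charFun_compoundPoisson, charFun_compoundPoisson, charFun_compoundPoisson,
    ← Complex.exp_add]
  congr 1
  have h1 : charFun (m + m') t = charFun m t + charFun m' t := by
    simp_rw [charFun_apply]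
    rw [integral_add_measure] <;>
    exact integrable_exp_inner_mul_I _ t
  rw [h1, measureReal_add_apply]
  push_cast
  ring

lemma convPow_Iio_zero (m : Measure ℝ) [IsFiniteMeasure m] (hm : m (Iio 0) = 0) (j : ℕ) :
    convPow m j (Iio 0) = 0 := by
  induction j with
  | zero => simp [convPow]
  | succ j ih =>
    rw [convPow, ← lintegral_indicator_one measurableSet_Iio,
      Measure.lintegral_conv (by fun_prop (disch := exact measurableSet_Iio))]
    rw [lintegral_eq_zero_iff' (by
      apply Measurable.aemeasurable
      apply Measurable.lintegral_prod_right
      exact (measurable_one.indicator measurableSet_Iio).comp (measurable_fst.add measurable_snd))]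
    have h1 : ∀ᵐ x ∂m, 0 ≤ x := by
      rw [ae_iff]; simpa [Iio] using hm
    have h2 : ∀ᵐ x ∂(convPow m j), 0 ≤ x := by
      rw [ae_iff]; simpa [Iio] using ih
    filter_upwards [h1] with x hx
    simp only [Pi.zero_apply]
    rw [lintegral_eq_zero_iff' (by
      apply Measurable.aemeasurable
      exact (measurable_one.indicator measurableSet_Iio).comp (measurable_const.add measurable_id))]
    filter_upwards [h2] with y hy
    simp [add_nonneg hx hy]

lemma compoundPoisson_Iio_zero (m : Measure ℝ) [IsFiniteMeasure m] (hm : m (Iio 0) = 0) :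
    compoundPoisson m (Iio 0) = 0 := by
  rw [compoundPoisson, Measure.sum_apply _ measurableSet_Iio]
  simp [convPow_Iio_zero m hm]

lemma compoundPoisson_add_Iic_le (m m' : Measure ℝ) [IsFiniteMeasure m] [IsFiniteMeasure m']
    (hm' : m' (Iio 0) = 0) (t : ℝ) :
    compoundPoisson (m + m') (Iic t) ≤ compoundPoisson m (Iic t) := by
  rw [compoundPoisson_add, ← lintegral_indicator_one measurableSet_Iic,
    Measure.lintegral_conv (by fun_prop (disch := exact measurableSet_Iic))]
  have h2 : ∀ᵐ x ∂(compoundPoisson m'), 0 ≤ x := by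
    rw [ae_iff]; simpa [Iio] using compoundPoisson_Iio_zero m' hm'
  rw [← lintegral_indicator_one measurableSet_Iic]
  apply lintegral_mono
  intro x
  calc ∫⁻ y, (Iic t).indicator (1 : ℝ → ℝ≥0∞) (x + y) ∂(compoundPoisson m')
      ≤ ∫⁻ y, (Iic t).indicator (1 : ℝ → ℝ≥0∞) x ∂(compoundPoisson m') := by
        apply lintegral_mono_ae
        filter_upwards [h2] with y hy
        by_cases h : x + y ≤ t
        · have : x ≤ t := by linarith
          simp [h, this]
        · simp [h]
    _ = _ := by simp

lemma convPow_univ (m : Measure ℝ) [IsFiniteMeasure m] (j : ℕ) :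
    convPow m j univ = m univ ^ j := by
  simpa using lintegral_exp_convPow m 0 j

lemma convPow_succ_le (m : Measure ℝ) [IsFiniteMeasure m] (B : ℝ≥0∞)
    (hB : m ≤ B • volume) (j : ℕ) (s : Set ℝ) (hs : MeasurableSet s) :
    convPow m (j + 1) s ≤ B * volume s * m univ ^ j := by
  rw [convPow, Measure.conv_comm, ← lintegral_indicator_one hs,
    Measure.lintegral_conv (by fun_prop (disch := exact hs)), ← convPow_univ, ← lintegral_const]
  apply lintegral_mono
  intro x
  calc ∫⁻ y, s.indicator (1 : ℝ → ℝ≥0∞) (x + y) ∂m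
      ≤ ∫⁻ y, s.indicator (1 : ℝ → ℝ≥0∞) (x + y) ∂(B • volume) := lintegral_mono' hB le_rfl
    _ = B * ∫⁻ y, s.indicator (1 : ℝ → ℝ≥0∞) (x + y) := by
      rw [lintegral_smul_measure, smul_eq_mul]
    _ = B * volume s := by
      rw [lintegral_add_left_eq_self, lintegral_indicator_one hs]

lemma compoundPoisson_Ioc_le (m : Measure ℝ) [IsFiniteMeasure m] (B : ℝ) (hB0 : 0 ≤ B)
    (hB : m ≤ ENNReal.ofReal B • volume) (a b : ℝ) (hab : a ≤ b) :
    compoundPoisson m (Ioc a b) ≤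
      ENNReal.ofReal (Real.exp (-m.real univ) + B * (b - a)) := by
  have hba : 0 ≤ b - a := by linarith
  rw [compoundPoisson, Measure.sum_apply _ measurableSet_Ioc, tsum_eq_zero_add' ENNReal.summable]
  rw [ENNReal.ofReal_add (by positivity) (by positivity)]
  gcongr
  · simp only [Nat.factorial_zero, Nat.cast_one, div_one, Measure.smul_apply, smul_eq_mul]
    refine (mul_le_mul_right (a := ENNReal.ofReal (Real.exp (-m.real univ)))
      (show convPow m 0 (Ioc a b) ≤ 1 from ?_)).trans (by simp)
    rw [convPow]; exact prob_le_one
  · set c := m.real univ with hc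
    have hmc : m univ = ENNReal.ofReal c := by rw [hc, measureReal_def, ENNReal.ofReal_toReal]; simp
    have hc0 : 0 ≤ c := measureReal_nonneg
    have h : HasSum (fun j : ℕ => B * (b - a) * (Real.exp (-c) / j.factorial * c ^ j))
        (B * (b - a)) := by
      have := ((NormedSpace.expSeries_div_hasSum_exp (𝔸 := ℝ) c).mul_left (Real.exp (-c))).mul_left
        (B * (b - a))
      rw [← Real.exp_eq_exp_ℝ, ← Real.exp_add] at this
      rw [neg_add_cancel, Real.exp_zero, mul_one] at this
      refine Eq.subst (motive := fun g => HasSum g _) (funext fun j => ?_) this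
      ring
    rw [← h.tsum_eq, ENNReal.ofReal_tsum_of_nonneg (fun j => by positivity) h.summable]
    apply ENNReal.tsum_le_tsum
    intro j
    rw [Measure.smul_apply, smul_eq_mul]
    refine (mul_le_mul_right (convPow_succ_le m _ hB j _ measurableSet_Ioc) _).trans ?_
    rw [Real.volume_Ioc, hmc, ← ENNReal.ofReal_pow hc0, ← ENNReal.ofReal_mul hB0,
      ← ENNReal.ofReal_mul (by positivity), ← ENNReal.ofReal_mul (by positivity)]
    apply ENNReal.ofReal_le_ofReal
    have : Real.exp (-c) / ((j + 1).factorial : ℝ) ≤ Real.exp (-c) / (j.factorial : ℝ) := by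
      gcongr
      · exact_mod_cast Nat.le_succ j
    calc _ ≤ Real.exp (-c) / (j.factorial : ℝ) * (B * (b - a) * c ^ j) := by gcongr
      _ = _ := by ring

/-- The measure on `(0,∞)` with density `u ↦ ∫ t e^{-tu} σ(dt)`. -/
noncomputable def levyMeasure (σ : Measure ℝ) : Measure ℝ :=
  (volume.restrict (Ioi 0)).withDensity
    fun u => ∫⁻ t, ENNReal.ofReal (t * Real.exp (-t * u)) ∂σ

lemma measurable_levyDensity (σ : Measure ℝ) [SFinite σ] :
    Measurable fun u : ℝ => ∫⁻ t, ENNReal.ofReal (t * Real.exp (-t * u)) ∂σ := by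
  apply Measurable.lintegral_prod_right
  fun_prop

lemma levyMeasure_Iio_zero (σ : Measure ℝ) : levyMeasure σ (Iio 0) = 0 := by
  apply withDensity_absolutelyContinuous
  rw [Measure.restrict_apply measurableSet_Iio]
  convert measure_empty (μ := (volume : Measure ℝ)) using 2
  ext x; simp only [mem_inter_iff, mem_Iio, mem_Ioi, mem_empty_iff_false, iff_false]
  intro h; linarith [h.1, h.2]

lemma levyMeasure_add (σ₁ σ₂ : Measure ℝ) [SFinite σ₁] [SFinite σ₂] :
    levyMeasure (σ₁ + σ₂) = levyMeasure σ₁ + levyMeasure σ₂ := by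
  rw [levyMeasure, levyMeasure, levyMeasure, ← withDensity_add_left (measurable_levyDensity σ₁)]
  congr 1; ext u
  simp [lintegral_add_measure]

lemma lintegral_Ioi_exp (a q : ℝ) (hq : 0 < q) :
    ∫⁻ u in Ioi a, ENNReal.ofReal (Real.exp (-q * u)) =
      ENNReal.ofReal (Real.exp (-q * a) / q) := by
  rw [← ofReal_integral_eq_lintegral_ofReal (integrableOn_exp_mul_Ioi (by linarith) a)
    (ae_of_all _ fun u => (Real.exp_nonneg _)), integral_exp_mul_Ioi (by linarith) a]
  congr 1
  rw [neg_div_neg_eq]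

lemma lintegral_exp_levyMeasure (σ : Measure ℝ) [SFinite σ] (hσ : ∀ᵐ t ∂σ, 0 < t) (p : ℝ)
    (hp : 0 ≤ p) :
    ∫⁻ u, ENNReal.ofReal (Real.exp (-p * u)) ∂(levyMeasure σ) =
      ∫⁻ t, ENNReal.ofReal (t / (p + t)) ∂σ := by
  rw [levyMeasure, lintegral_withDensity_eq_lintegral_mul _ (measurable_levyDensity σ)
    (by fun_prop)]
  simp only [Pi.mul_apply]
  simp_rw [← lintegral_mul_const' _ _ ENNReal.ofReal_ne_top]
  rw [lintegral_lintegral_swap (by fun_prop)]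
  apply lintegral_congr_ae
  filter_upwards [hσ] with t ht
  have : ∀ u : ℝ, ENNReal.ofReal (t * Real.exp (-t * u)) * ENNReal.ofReal (Real.exp (-p * u)) =
      ENNReal.ofReal t * ENNReal.ofReal (Real.exp (-(p + t) * u)) := by
    intro u
    rw [← ENNReal.ofReal_mul (by positivity), ← ENNReal.ofReal_mul ht.le, mul_assoc,
      ← Real.exp_add]
    ring_nf
  simp_rw [this]
  rw [lintegral_const_mul' _ _ ENNReal.ofReal_ne_top, lintegral_Ioi_exp _ _ (by linarith),
    ← ENNReal.ofReal_mul ht.le]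
  congr 1
  simp [div_eq_mul_inv]

lemma levyMeasure_univ (σ : Measure ℝ) [SFinite σ] (hσ : ∀ᵐ t ∂σ, 0 < t) :
    levyMeasure σ univ = σ univ := by
  have := lintegral_exp_levyMeasure σ hσ 0 le_rfl
  simp only [neg_zero, zero_mul, Real.exp_zero, ENNReal.ofReal_one, lintegral_one, zero_add] at this
  rw [this, ← lintegral_one]
  apply lintegral_congr_ae
  filter_upwards [hσ] with t ht
  simp [div_self ht.ne']

lemma levyMeasure_le (σ : Measure ℝ) (R : ℝ) (hσ : ∀ᵐ t ∂σ, 0 < t ∧ t ≤ R) :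
    levyMeasure σ ≤ (ENNReal.ofReal R * σ univ) • volume := by
  rw [levyMeasure]
  refine (withDensity_mono (g := fun _ => ENNReal.ofReal R * σ univ) ?_).trans ?_
  · rw [EventuallyLE, ae_restrict_iff' measurableSet_Ioi]
    filter_upwards with u hu
    rw [← lintegral_const]
    apply lintegral_mono_ae
    filter_upwards [hσ] with t ht
    apply ENNReal.ofReal_le_ofReal
    have : Real.exp (-t * u) ≤ 1 := by
      rw [Real.exp_le_one_iff]; nlinarith [mul_pos ht.1 (mem_Ioi.mp hu)]
    nlinarith [ht.1, ht.2]
  · rw [withDensity_const]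
    exact Measure.le_iff.mpr fun s hs => by
      rw [Measure.smul_apply, Measure.smul_apply]
      exact mul_le_mul_right (Measure.restrict_apply_le _ _) _

lemma integral_exp_mul_measureReal_Iic (μ : Measure ℝ) [IsProbabilityMeasure μ]
    (hμ : μ (Iio 0) = 0) (p r : ℝ) (hp : 0 < p) (hr : 0 ≤ r)
    (h : ∫⁻ x, ENNReal.ofReal (Real.exp (-p * x)) ∂μ = ENNReal.ofReal r) :
    ∫ t in Ioi 0, Real.exp (-p * t) * μ.real (Iic t) = r / p := by
  have hmono : Monotone fun t => μ (Iic t) := fun a b hab => measure_mono (Iic_subset_Iic.mpr hab)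
  rw [integral_eq_lintegral_of_nonneg_ae (ae_of_all _ fun t => by positivity)
    (by
      apply Measurable.aestronglyMeasurable
      exact (by fun_prop : Measurable fun t => Real.exp (-p * t)).mul hmono.measurable.ennreal_toReal)]
  have h1 : ∀ t, ENNReal.ofReal (Real.exp (-p * t) * μ.real (Iic t)) =
      ∫⁻ x, ENNReal.ofReal (Real.exp (-p * t)) * {z : ℝ × ℝ | z.2 ≤ z.1}.indicator 1 (t, x) ∂μ := by
    intro t
    rw [lintegral_const_mul' _ _ ENNReal.ofReal_ne_top, ENNReal.ofReal_mul (by positivity),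
      ofReal_measureReal, ← lintegral_indicator_one measurableSet_Iic]
    congr 1
  have hmeas : MeasurableSet {z : ℝ × ℝ | z.2 ≤ z.1} :=
    measurableSet_le measurable_snd measurable_fst
  simp_rw [h1]
  rw [lintegral_lintegral_swap (by
    apply Measurable.aemeasurable
    exact (by fun_prop : Measurable fun z : ℝ × ℝ => ENNReal.ofReal (Real.exp (-p * z.1))).mul
      (measurable_one.indicator hmeas))]
  have h2 : ∀ᵐ x ∂μ, 0 ≤ x := by
    rw [ae_iff]; simpa [Iio] using hμ
  have h3 : ∫⁻ x, (∫⁻ t in Ioi 0, ENNReal.ofReal (Real.exp (-p * t)) *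
      {z : ℝ × ℝ | z.2 ≤ z.1}.indicator 1 (t, x)) ∂μ =
      ∫⁻ x, ENNReal.ofReal (Real.exp (-p * x)) * ENNReal.ofReal p⁻¹ ∂μ := by
    apply lintegral_congr_ae
    filter_upwards [h2] with x hx
    have : ∀ t : ℝ, ENNReal.ofReal (Real.exp (-p * t)) *
        {z : ℝ × ℝ | z.2 ≤ z.1}.indicator (1 : ℝ × ℝ → ℝ≥0∞) (t, x) =
        (Ici x).indicator (fun t => ENNReal.ofReal (Real.exp (-p * t))) t := by
      intro t
      by_cases hxt : x ≤ t <;> simp [hxt]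
    simp_rw [this]
    rw [setLIntegral_congr Ioi_ae_eq_Ici, lintegral_indicator measurableSet_Ici,
      Measure.restrict_restrict measurableSet_Ici, Ici_inter_Ici, sup_of_le_left hx,
      ← setLIntegral_congr Ioi_ae_eq_Ici, lintegral_Ioi_exp _ _ hp, ← ENNReal.ofReal_mul
      (by positivity), div_eq_mul_inv]
  rw [h3, lintegral_mul_const' _ _ ENNReal.ofReal_ne_top, h, ← ENNReal.ofReal_mul hr,
    ENNReal.toReal_ofReal (by positivity), div_eq_mul_inv]

lemma compoundPoisson_add_Ioc_le (m m' : Measure ℝ) [IsFiniteMeasure m] [IsFiniteMeasure m']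
    (K : ℝ≥0∞) (l : ℝ) (hK : ∀ a b, b - a = l → compoundPoisson m (Ioc a b) ≤ K)
    (a b : ℝ) (hab : b - a = l) :
    compoundPoisson (m + m') (Ioc a b) ≤ K := by
  rw [compoundPoisson_add, Measure.conv_comm, ← lintegral_indicator_one measurableSet_Ioc,
    Measure.lintegral_conv (by fun_prop (disch := exact measurableSet_Ioc))]
  calc _ ≤ ∫⁻ _, K ∂(compoundPoisson m') := by
        apply lintegral_mono
        intro x
        have : ∀ y, (Ioc a b).indicator (1 : ℝ → ℝ≥0∞) (x + y) =
            (Ioc (a - x) (b - x)).indicator 1 y := by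
          intro y
          simp only [indicator_apply, mem_Ioc, Pi.one_apply, sub_lt_iff_lt_add', le_sub_iff_add_le']
        simp_rw [this]
        rw [lintegral_indicator_one measurableSet_Ioc]
        exact hK _ _ (by linarith)
    _ = K := by simp

section Subordinator

variable (σ : Measure ℝ)

/-- The restriction of `σ` to `(0, N]`. -/
noncomputable def truncatedMeasure (N : ℕ) : Measure ℝ := σ.restrict (Ioc 0 (N : ℝ))

lemma isFiniteMeasure_restrict_Ioc (hσ : IntegrableOn (fun t => (1 + t)⁻¹) (Ioi 0) σ)
    (a b : ℝ) (ha : 0 ≤ a) : IsFiniteMeasure (σ.restrict (Ioc a b)) := by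
  constructor
  rw [Measure.restrict_apply_univ]
  rcases le_total b a with h | h
  · simp [Ioc_eq_empty (not_lt.mpr h)]
  have := hσ.measure_norm_ge_lt_top (ε := (1 + b)⁻¹) (by have := ha.trans h; positivity)
  refine lt_of_le_of_lt ?_ this
  rw [Measure.restrict_apply' measurableSet_Ioi]
  apply measure_mono
  intro t ht
  have h0 : 0 < t := ha.trans_lt ht.1
  refine ⟨?_, h0⟩
  rw [mem_ofPred_eq, Real.norm_of_nonneg (by positivity)]
  gcongr
  exact ht.2

lemma truncatedMeasure_add {N M : ℕ} (h : N ≤ M) :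
    truncatedMeasure σ M = truncatedMeasure σ N + σ.restrict (Ioc (N : ℝ) M) := by
  rw [truncatedMeasure, truncatedMeasure, ← Measure.restrict_union _ measurableSet_Ioc,
    Ioc_union_Ioc_eq_Ioc (by positivity) (by exact_mod_cast h)]
  exact Ioc_disjoint_Ioc_of_le le_rfl

lemma ae_truncatedMeasure (N : ℕ) : ∀ᵐ t ∂(truncatedMeasure σ N), 0 < t ∧ t ≤ (N : ℝ) := by
  rw [truncatedMeasure, ae_restrict_iff' measurableSet_Ioc]
  exact ae_of_all _ fun t ht => ht

/-- Distribution functions of the subordinators with truncated Lévy measure. -/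
noncomputable def truncatedCdf (N : ℕ) (s t : ℝ) : ℝ :=
  (compoundPoisson (ENNReal.ofReal s • levyMeasure (truncatedMeasure σ N))).real (Iic t)

variable {σ}

lemma isFiniteMeasure_truncatedMeasure (hσ : IntegrableOn (fun t => (1 + t)⁻¹) (Ioi 0) σ) (N : ℕ) :
    IsFiniteMeasure (truncatedMeasure σ N) := isFiniteMeasure_restrict_Ioc σ hσ _ _ le_rfl

lemma isFiniteMeasure_smul_levyMeasure (ρ : Measure ℝ) [IsFiniteMeasure ρ]
    (hρ : ∀ᵐ t ∂ρ, 0 < t) (s : ℝ) :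
    IsFiniteMeasure (ENNReal.ofReal s • levyMeasure ρ) := by
  constructor
  rw [Measure.smul_apply, levyMeasure_univ ρ hρ]
  exact ENNReal.mul_lt_top ENNReal.ofReal_lt_top (measure_lt_top _ _)

lemma exists_smul_levyMeasure_eq_add (hσ : IntegrableOn (fun t => (1 + t)⁻¹) (Ioi 0) σ)
    {N M : ℕ} (h : N ≤ M) {s s' : ℝ} (hs : 0 ≤ s) (hss : s ≤ s') :
    ∃ m' : Measure ℝ, IsFiniteMeasure m' ∧ m' (Iio 0) = 0 ∧
      ENNReal.ofReal s' • levyMeasure (truncatedMeasure σ M) =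
        ENNReal.ofReal s • levyMeasure (truncatedMeasure σ N) + m' := by
  have := isFiniteMeasure_truncatedMeasure hσ M
  have := isFiniteMeasure_truncatedMeasure hσ N
  have := isFiniteMeasure_restrict_Ioc σ hσ (N : ℝ) M (by positivity)
  have h1 := isFiniteMeasure_smul_levyMeasure (truncatedMeasure σ M)
    ((ae_truncatedMeasure σ M).mono fun t ht => ht.1) (s' - s)
  have h2 := isFiniteMeasure_smul_levyMeasure (σ.restrict (Ioc (N : ℝ) M)) (by
    rw [ae_restrict_iff' measurableSet_Ioc]
    exact ae_of_all _ fun t ht => lt_of_le_of_lt (by positivity) ht.1) s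
  refine ⟨ENNReal.ofReal s • levyMeasure (σ.restrict (Ioc (N : ℝ) M)) +
    ENNReal.ofReal (s' - s) • levyMeasure (truncatedMeasure σ M), inferInstance, ?_, ?_⟩
  · simp [levyMeasure_Iio_zero]
  · rw [← add_assoc, ← smul_add, ← levyMeasure_add, ← truncatedMeasure_add σ h, ← add_smul,
      ← ENNReal.ofReal_add hs (by linarith)]
    congr 2; ring

lemma isFiniteMeasure_smul_levyMeasure_truncatedMeasure
    (hσ : IntegrableOn (fun t => (1 + t)⁻¹) (Ioi 0) σ) (N : ℕ) (s : ℝ) :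
    IsFiniteMeasure (ENNReal.ofReal s • levyMeasure (truncatedMeasure σ N)) := by
  have := isFiniteMeasure_truncatedMeasure hσ N
  exact isFiniteMeasure_smul_levyMeasure _ ((ae_truncatedMeasure σ N).mono fun t ht => ht.1) s

lemma truncatedCdf_anti (hσ : IntegrableOn (fun t => (1 + t)⁻¹) (Ioi 0) σ)
    {N M : ℕ} (h : N ≤ M) {s s' : ℝ} (hs : 0 ≤ s) (hss : s ≤ s') (t : ℝ) :
    truncatedCdf σ M s' t ≤ truncatedCdf σ N s t := by
  have := isFiniteMeasure_smul_levyMeasure_truncatedMeasure hσ N s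
  obtain ⟨m', hm', hm0, heq⟩ := exists_smul_levyMeasure_eq_add hσ h hs hss
  rw [truncatedCdf, truncatedCdf, heq]
  exact ENNReal.toReal_mono (measure_ne_top _ _) (compoundPoisson_add_Iic_le _ _ hm0 t)

lemma truncatedCdf_sub_le (hσ : IntegrableOn (fun t => (1 + t)⁻¹) (Ioi 0) σ)
    {N M : ℕ} (h : N ≤ M) {s : ℝ} (hs : 0 ≤ s) {a b : ℝ} (hab : a ≤ b) :
    truncatedCdf σ M s b - truncatedCdf σ M s a ≤
      Real.exp (-s * σ.real (Ioc 0 (N : ℝ))) + s * (N * σ.real (Ioc 0 (N : ℝ))) * (b - a) := by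
  have := isFiniteMeasure_smul_levyMeasure_truncatedMeasure hσ N s
  have := isFiniteMeasure_smul_levyMeasure_truncatedMeasure hσ M s
  have hfin := isFiniteMeasure_truncatedMeasure hσ N
  obtain ⟨m', hm', hm0, heq⟩ := exists_smul_levyMeasure_eq_add hσ h hs le_rfl
  have huniv : truncatedMeasure σ N univ = ENNReal.ofReal (σ.real (Ioc 0 (N : ℝ))) := by
    have := measure_ne_top (truncatedMeasure σ N) univ
    rw [truncatedMeasure, Measure.restrict_apply_univ] at *
    rw [measureReal_def, ENNReal.ofReal_toReal this]
  have hle : ENNReal.ofReal s • levyMeasure (truncatedMeasure σ N) ≤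
      ENNReal.ofReal (s * (N * σ.real (Ioc 0 (N : ℝ)))) • volume := by
    rw [ENNReal.ofReal_mul hs, mul_smul, ENNReal.ofReal_mul (by positivity), ← huniv]
    refine Measure.le_iff.mpr fun A hA => ?_
    rw [Measure.smul_apply, Measure.smul_apply]
    exact mul_le_mul_right (levyMeasure_le _ _ (ae_truncatedMeasure σ N) A) _
  have hreal : (ENNReal.ofReal s • levyMeasure (truncatedMeasure σ N)).real univ =
      s * σ.real (Ioc 0 (N : ℝ)) := by
    rw [measureReal_def, Measure.smul_apply, levyMeasure_univ _
      ((ae_truncatedMeasure σ N).mono fun t ht => ht.1), huniv, smul_eq_mul, ← ENNReal.ofReal_mul hs,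
      ENNReal.toReal_ofReal (by positivity)]
  have key := compoundPoisson_add_Ioc_le _ m' _ (b - a) (fun a' b' hab' =>
    (compoundPoisson_Ioc_le _ _ (by positivity) hle a' b' (by linarith)).trans_eq
      (by rw [hab'])) a b rfl
  rw [← heq, hreal] at key
  have : truncatedCdf σ M s b - truncatedCdf σ M s a =
      (compoundPoisson (ENNReal.ofReal s • levyMeasure (truncatedMeasure σ M))).real (Ioc a b) := by
    rw [truncatedCdf, truncatedCdf, ← Iic_sdiff_Iic,
      measureReal_sdiff (Iic_subset_Iic.mpr hab) measurableSet_Iic]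
  rw [this, ← neg_mul] at *
  exact ENNReal.toReal_le_of_le_ofReal (by have : 0 ≤ b - a := by linarith
                                           positivity) key

lemma integral_exp_mul_truncatedCdf (hσ : IntegrableOn (fun t => (1 + t)⁻¹) (Ioi 0) σ)
    (N : ℕ) {s p : ℝ} (hs : 0 ≤ s) (hp : 0 < p) :
    ∫ t in Ioi 0, Real.exp (-p * t) * truncatedCdf σ N s t =
      Real.exp (-s * ∫ t in Ioc 0 (N : ℝ), p * (p + t)⁻¹ ∂σ) / p := by
  have := isFiniteMeasure_smul_levyMeasure_truncatedMeasure hσ N s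
  have hfin := isFiniteMeasure_truncatedMeasure hσ N
  have hae := (ae_truncatedMeasure σ N).mono fun t ht => ht.1
  have hi : ∀ g : ℝ → ℝ, Measurable g → (∀ t, 0 < t → 0 ≤ g t ∧ g t ≤ 1) →
      Integrable g (truncatedMeasure σ N) := by
    intro g hg hb
    refine (integrable_const (1 : ℝ)).mono hg.aestronglyMeasurable ?_
    filter_upwards [hae] with t ht
    rw [Real.norm_of_nonneg (hb t ht).1]; simpa using (hb t ht).2
  have hi1 : Integrable (fun t => t / (p + t)) (truncatedMeasure σ N) :=
    hi _ (by fun_prop) fun t ht => ⟨by positivity, by rw [div_le_one (by positivity)]; linarith⟩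
  have hi2 : Integrable (fun t => p * (p + t)⁻¹) (truncatedMeasure σ N) :=
    hi _ (by fun_prop) fun t ht => ⟨by positivity, by
      rw [← div_eq_mul_inv, div_le_one (by positivity)]; linarith⟩
  have hn : 0 ≤ ∫ t, t / (p + t) ∂(truncatedMeasure σ N) := integral_nonneg_of_ae (by
    filter_upwards [hae] with t ht
    simp only [Pi.zero_apply]
    positivity)
  have hL := lintegral_exp_compoundPoisson
    (ENNReal.ofReal s • levyMeasure (truncatedMeasure σ N)) p
    (s * ∫ t, t / (p + t) ∂(truncatedMeasure σ N)) (by positivity) (by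
      rw [lintegral_smul_measure, lintegral_exp_levyMeasure _ hae p hp.le, smul_eq_mul,
        ENNReal.ofReal_mul hs, ofReal_integral_eq_lintegral_ofReal hi1]
      filter_upwards [hae] with t ht
      simp only [Pi.zero_apply]
      positivity)
  have hreal : (ENNReal.ofReal s • levyMeasure (truncatedMeasure σ N)).real univ =
      s * ∫ t, (1 : ℝ) ∂(truncatedMeasure σ N) := by
    rw [measureReal_def, Measure.smul_apply, levyMeasure_univ _ hae, smul_eq_mul,
      ENNReal.toReal_mul, ENNReal.toReal_ofReal hs]
    simp [measureReal_def]
  have hexp : s * ∫ t, t / (p + t) ∂(truncatedMeasure σ N) -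
      (ENNReal.ofReal s • levyMeasure (truncatedMeasure σ N)).real univ =
      -s * ∫ t in Ioc 0 (N : ℝ), p * (p + t)⁻¹ ∂σ := by
    have : ∫ t, (1 : ℝ) ∂(truncatedMeasure σ N) = ∫ t, t / (p + t) ∂(truncatedMeasure σ N) +
        ∫ t, p * (p + t)⁻¹ ∂(truncatedMeasure σ N) := by
      rw [← integral_add hi1 hi2]
      apply integral_congr_ae
      filter_upwards [hae] with t ht
      have : p + t ≠ 0 := by positivity
      field_simp
      ring
    rw [hreal, this]
    simp only [truncatedMeasure]
    ring
  rw [hexp] at hL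
  exact integral_exp_mul_measureReal_Iic _ (compoundPoisson_Iio_zero _ (by
    simp [levyMeasure_Iio_zero])) p _ hp (Real.exp_nonneg _) hL

lemma truncatedCdf_nonneg (N : ℕ) (s t : ℝ) : 0 ≤ truncatedCdf σ N s t := measureReal_nonneg

lemma truncatedCdf_le_one (hσ : IntegrableOn (fun t => (1 + t)⁻¹) (Ioi 0) σ) (N : ℕ) (s t : ℝ) :
    truncatedCdf σ N s t ≤ 1 := by
  have := isFiniteMeasure_smul_levyMeasure_truncatedMeasure hσ N s
  exact measureReal_le_one

lemma truncatedCdf_mono (hσ : IntegrableOn (fun t => (1 + t)⁻¹) (Ioi 0) σ) (N : ℕ) (s : ℝ) :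
    Monotone (truncatedCdf σ N s) := by
  have := isFiniteMeasure_smul_levyMeasure_truncatedMeasure hσ N s
  exact fun a b hab => measureReal_mono (Iic_subset_Iic.mpr hab)

lemma truncatedCdf_of_neg (hσ : IntegrableOn (fun t => (1 + t)⁻¹) (Ioi 0) σ) (N : ℕ) (s t : ℝ)
    (ht : t < 0) : truncatedCdf σ N s t = 0 := by
  have := isFiniteMeasure_smul_levyMeasure_truncatedMeasure hσ N s
  have h0 := compoundPoisson_Iio_zero (ENNReal.ofReal s • levyMeasure (truncatedMeasure σ N))
    (by simp [levyMeasure_Iio_zero])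
  rw [truncatedCdf, measureReal_def, measure_mono_null (fun x hx => ?_) h0]
  · simp
  · exact lt_of_le_of_lt hx ht

/-- Existence of the distribution functions `H s t = P(D_s ≤ t)` of a subordinator whose Laplace
exponent is the complete Bernstein function `φ p = ∫ p / (p + t) σ(dt)`. -/
theorem exists_subordinator_cdf (hσ : IntegrableOn (fun t => (1 + t)⁻¹) (Ioi 0) σ)
    (hinf : σ (Ioi 0) = ⊤) :
    ∃ H : ℝ → ℝ → ℝ, (∀ s t, 0 ≤ H s t) ∧ (∀ s t, H s t ≤ 1) ∧ (∀ t, Antitone fun s => H s t) ∧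
      (∀ s, Monotone (H s)) ∧ (∀ s, Continuous (H s)) ∧ (∀ s, 0 < s → ∀ t ≤ 0, H s t = 0) ∧
      (∀ s ≤ 0, ∀ t, H s t = 1) ∧
      ∀ s, 0 < s → ∀ p, 0 < p → ∫ t in Ioi 0, Real.exp (-p * t) * H s t =
        Real.exp (-s * ∫ t in Ioi 0, p * (p + t)⁻¹ ∂σ) / p := by
  classical
  let G : ℝ → ℝ → ℝ := fun s t => ⨅ N, truncatedCdf σ N s t
  have hbdd : ∀ s t, BddBelow (range fun N => truncatedCdf σ N s t) := fun s t =>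
    ⟨0, by rintro _ ⟨N, rfl⟩; exact truncatedCdf_nonneg N s t⟩
  have hlim : ∀ s, 0 ≤ s → ∀ t, Tendsto (fun N => truncatedCdf σ N s t) atTop (𝓝 (G s t)) :=
    fun s hs t => tendsto_atTop_ciInf (fun N M h => truncatedCdf_anti hσ h hs le_rfl t) (hbdd s t)
  have hG0 : ∀ s t, 0 ≤ G s t := fun s t => Real.iInf_nonneg fun N => truncatedCdf_nonneg N s t
  have hG1 : ∀ s t, G s t ≤ 1 := fun s t =>
    (ciInf_le (hbdd s t) 0).trans (truncatedCdf_le_one hσ 0 s t)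
  have hGanti : ∀ s s' t, 0 ≤ s → s ≤ s' → G s' t ≤ G s t := fun s s' t hs hss =>
    ciInf_mono (hbdd s' t) fun N => truncatedCdf_anti hσ le_rfl hs hss t
  have hGmono : ∀ s, Monotone (G s) := fun s a b hab =>
    ciInf_mono (hbdd s a) fun N => truncatedCdf_mono hσ N s hab
  have hGsub : ∀ (N : ℕ) (s : ℝ), 0 ≤ s → ∀ a b, a ≤ b → G s b - G s a ≤
      Real.exp (-s * σ.real (Ioc 0 (N : ℝ))) + s * (N * σ.real (Ioc 0 (N : ℝ))) * (b - a) := by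
    intro N s hs a b hab
    refine le_of_tendsto ((hlim s hs b).sub (hlim s hs a)) ?_
    filter_upwards [eventually_ge_atTop N] with M hM
    exact truncatedCdf_sub_le hσ hM hs hab
  have hmass : Tendsto (fun N : ℕ => σ.real (Ioc 0 (N : ℝ))) atTop atTop := by
    have hU : (⋃ N : ℕ, Ioc (0 : ℝ) N) = Ioi 0 := by
      ext x
      simp only [mem_iUnion, mem_Ioc, mem_Ioi]
      exact ⟨fun ⟨N, h⟩ => h.1, fun h => (exists_nat_ge x).imp fun N hN => ⟨h, hN⟩⟩
    have h1 := tendsto_measure_iUnion_atTop (μ := σ) (s := fun N : ℕ => Ioc (0 : ℝ) N)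
      (fun N M h => Ioc_subset_Ioc_right (by exact_mod_cast h))
    rw [hU, hinf] at h1
    rw [← ENNReal.tendsto_ofReal_nhds_top]
    refine h1.congr fun N => ?_
    have := isFiniteMeasure_restrict_Ioc σ hσ 0 (N : ℝ) le_rfl
    have := measure_ne_top (σ.restrict (Ioc 0 (N : ℝ))) univ
    rw [Measure.restrict_apply_univ] at this
    rw [Function.comp_apply, measureReal_def, ENNReal.ofReal_toReal this]
  have hGcont : ∀ s, 0 < s → Continuous (G s) := by
    intro s hs
    have hexp : Tendsto (fun N : ℕ => Real.exp (-s * σ.real (Ioc 0 (N : ℝ)))) atTop (𝓝 0) :=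
      Real.tendsto_exp_atBot.comp (hmass.const_mul_atTop_of_neg (by linarith))
    rw [Metric.continuous_iff]
    intro b ε hε
    obtain ⟨N, hN⟩ := (hexp.eventually (gt_mem_nhds (half_pos hε))).exists
    set B := s * (N * σ.real (Ioc 0 (N : ℝ))) with hB
    have hB0 : 0 ≤ B := by positivity
    have key : ∀ a b, a ≤ b → b - a < ε / (2 * (B + 1)) → G s b - G s a < ε := by
      intro a b hab h
      have := hGsub N s hs.le a b hab
      rw [lt_div_iff₀ (by positivity)] at h
      nlinarith
    refine ⟨ε / (2 * (B + 1)), by positivity, fun a ha => ?_⟩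
    rw [Real.dist_eq] at *
    rcases le_total a b with h | h
    · rw [abs_of_nonpos (by linarith)] at ha
      rw [abs_of_nonpos (by linarith [hGmono s h])]
      linarith [key a b h (by linarith)]
    · rw [abs_of_nonneg (by linarith)] at ha
      rw [abs_of_nonneg (by linarith [hGmono s h])]
      linarith [key b a h (by linarith)]
  have hGneg : ∀ s, 0 < s → ∀ t ≤ 0, G s t = 0 := by
    intro s hs t ht
    have hz : ∀ t < 0, G s t = 0 := fun t ht => by
      simp [G, truncatedCdf_of_neg hσ _ s t ht]
    rcases ht.lt_or_eq with h | rfl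
    · exact hz t h
    · have h1 : Tendsto (G s) (𝓝[<] 0) (𝓝 (G s 0)) := (hGcont s hs).continuousWithinAt
      refine tendsto_nhds_unique h1 (tendsto_const_nhds.congr' ?_)
      filter_upwards [self_mem_nhdsWithin] with t ht using (hz t ht).symm
  refine ⟨fun s t => if s ≤ 0 then 1 else G s t, ?_, ?_, ?_, ?_, ?_, ?_, ?_, ?_⟩
  · intro s t; dsimp only; split_ifs
    · exact zero_le_one
    · exact hG0 s t
  · intro s t; dsimp only; split_ifs
    · exact le_rfl
    · exact hG1 s t
  · intro t s s' h
    dsimp only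
    split_ifs with h1 h2 h2
    · exact le_rfl
    · linarith
    · exact hG1 s' t
    · exact hGanti s s' t (by linarith) h
  · intro s a b hab
    dsimp only
    split_ifs
    · exact le_rfl
    · exact hGmono s hab
  · intro s
    dsimp only
    split_ifs with h
    · exact continuous_const
    · exact hGcont s (by linarith)
  · intro s hs t ht
    simp [not_le.mpr hs, hGneg s hs t ht]
  · intro s hs t
    simp [hs]
  · intro s hs p hp
    simp only [not_le.mpr hs, if_false]
    have h_int : IntegrableOn (fun t => p * (p + t)⁻¹) (Ioi 0) σ := by
      refine Integrable.mono (hσ.const_mul (p + 1)) (by fun_prop) ?_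
      rw [ae_restrict_iff' measurableSet_Ioi]
      refine ae_of_all _ fun t ht => ?_
      have ht : 0 < t := ht
      rw [Real.norm_of_nonneg (by positivity), Real.norm_of_nonneg (by positivity),
        ← div_eq_mul_inv, ← div_eq_mul_inv, div_le_div_iff₀ (by positivity) (by positivity)]
      nlinarith
    have hU : (⋃ N : ℕ, Ioc (0 : ℝ) N) = Ioi 0 := by
      ext x
      simp only [mem_iUnion, mem_Ioc, mem_Ioi]
      exact ⟨fun ⟨N, h⟩ => h.1, fun h => (exists_nat_ge x).imp fun N hN => ⟨h, hN⟩⟩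
    have h1 : Tendsto (fun N : ℕ => ∫ t in Ioc 0 (N : ℝ), p * (p + t)⁻¹ ∂σ) atTop
        (𝓝 (∫ t in Ioi 0, p * (p + t)⁻¹ ∂σ)) := by
      have := tendsto_setIntegral_of_monotone (μ := σ) (s := fun N : ℕ => Ioc (0 : ℝ) N)
        (f := fun t => p * (p + t)⁻¹) (fun N => measurableSet_Ioc)
        (fun N M h => Ioc_subset_Ioc_right (by exact_mod_cast h)) (by rw [hU]; exact h_int)
      rwa [hU] at this
    have h2 : Tendsto (fun N : ℕ => ∫ t in Ioi 0, Real.exp (-p * t) * truncatedCdf σ N s t) atTop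
        (𝓝 (∫ t in Ioi 0, Real.exp (-p * t) * G s t)) := by
      refine tendsto_integral_of_dominated_convergence (fun t => Real.exp (-p * t)) ?_
        (integrableOn_exp_mul_Ioi (by linarith) 0) ?_ ?_
      · intro N
        exact ((by fun_prop : Measurable fun t => Real.exp (-p * t)).mul
          (truncatedCdf_mono hσ N s).measurable).aestronglyMeasurable
      · intro N
        refine ae_of_all _ fun t => ?_
        rw [Real.norm_of_nonneg (mul_nonneg (Real.exp_nonneg _) (truncatedCdf_nonneg N s t))]
        exact mul_le_of_le_one_right (Real.exp_nonneg _) (truncatedCdf_le_one hσ N s t)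
      · exact ae_of_all _ fun t => (hlim s hs.le t).const_mul _
    refine tendsto_nhds_unique h2 ?_
    simp_rw [integral_exp_mul_truncatedCdf hσ _ hs.le hp]
    exact ((Real.continuous_exp.tendsto _).comp (h1.const_mul (-s))).div_const p

end Subordinator

/-- `H s t` is the probability that the subordinator with Laplace exponent `φ` is at most `t`
at time `s`, as a function with the regularity of the case of a continuous law. -/
structure IsSubordinatorCdf (H : ℝ → ℝ → ℝ) (φ : ℝ → ℝ) : Prop where
  nonneg : ∀ s t, 0 ≤ H s t
  le_one : ∀ s t, H s t ≤ 1
  antitone : ∀ t, Antitone fun s => H s t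
  monotone : ∀ s, Monotone (H s)
  continuous : ∀ s, Continuous (H s)
  eq_zero : ∀ s, 0 < s → ∀ t ≤ 0, H s t = 0
  eq_one : ∀ s ≤ 0, ∀ t, H s t = 1
  exponent_pos : ∀ p, 0 < p → 0 < φ p
  laplace : ∀ s, 0 < s → ∀ p, 0 < p →
    ∫ t in Ioi 0, Real.exp (-p * t) * H s t = Real.exp (-s * φ p) / p

namespace IsSubordinatorCdf

variable {H : ℝ → ℝ → ℝ} {φ : ℝ → ℝ} (h : IsSubordinatorCdf H φ)
include h

lemma integrableOn_exp_mul (s : ℝ) {p : ℝ} (hp : 0 < p) :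
    IntegrableOn (fun t => Real.exp (-p * t) * H s t) (Ioi 0) := by
  refine Integrable.mono (integrableOn_exp_mul_Ioi (neg_neg_of_pos hp) 0) ?_ ?_
  · have := h.continuous s
    exact (by fun_prop : Continuous fun t => Real.exp (-p * t) * H s t).aestronglyMeasurable
  · refine ae_of_all _ fun t => ?_
    rw [Real.norm_of_nonneg (mul_nonneg (Real.exp_nonneg _) (h.nonneg s t)),
      Real.norm_of_nonneg (Real.exp_nonneg _)]
    exact mul_le_of_le_one_right (Real.exp_nonneg _) (h.le_one s t)

lemma le_exp {s p : ℝ} (hs : 0 < s) (hp : 0 < p) (t : ℝ) :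
    H s t ≤ Real.exp (p * t) * Real.exp (-s * φ p) := by
  rcases le_or_gt t 0 with ht | ht
  · rw [h.eq_zero s hs t ht]; positivity
  have h1 : H s t * (Real.exp (-p * t) / p) ≤ Real.exp (-s * φ p) / p := by
    have e : ∫ x in Ioi t, Real.exp (-p * x) = Real.exp (-p * t) / p := by
      rw [integral_exp_mul_Ioi (neg_neg_of_pos hp)]; field_simp
    rw [← h.laplace s hs p hp, ← e, ← integral_const_mul]
    calc _ ≤ ∫ x in Ioi t, Real.exp (-p * x) * H s x := by
          refine setIntegral_mono_on ((integrableOn_exp_mul_Ioi (neg_neg_of_pos hp) t).const_mul _)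
            ((h.integrableOn_exp_mul s hp).mono_set (Ioi_subset_Ioi ht.le)) measurableSet_Ioi ?_
          intro x hx
          rw [mul_comm]
          exact mul_le_mul_of_nonneg_left (h.monotone s (le_of_lt hx)) (Real.exp_nonneg _)
      _ ≤ _ := setIntegral_mono_set (h.integrableOn_exp_mul s hp)
          (ae_of_all _ fun x => mul_nonneg (Real.exp_nonneg _) (h.nonneg s x))
          (Ioi_subset_Ioi ht.le).eventuallyLE
  rw [← mul_div_assoc, div_le_div_iff_of_pos_right hp, neg_mul, Real.exp_neg] at h1
  have := Real.exp_pos (p * t)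
  rw [mul_inv_le_iff₀ this] at h1
  linarith

lemma exp_le {s t : ℝ} (hs : 0 < s) (ht : 0 < t) :
    Real.exp (-s * φ 1) ≤ H s t * (1 - Real.exp (-t)) + Real.exp (-t) := by
  have h0 : IntegrableOn (fun x => Real.exp (-1 * x)) (Ioi 0) :=
    integrableOn_exp_mul_Ioi (by norm_num) 0
  have h1 := h.laplace s hs 1 one_pos
  rw [div_one] at h1
  rw [← h1]
  have h2 : ∫ x in Ioi 0, (H s t * Real.exp (-1 * x) +
      (Ioi t).indicator (fun x => (1 - H s t) * Real.exp (-1 * x)) x) =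
      H s t * (1 - Real.exp (-t)) + Real.exp (-t) := by
    rw [integral_add (h0.const_mul _) ((h0.const_mul _).indicator measurableSet_Ioi),
      setIntegral_indicator measurableSet_Ioi, Ioi_inter_Ioi, sup_eq_right.mpr ht.le,
      integral_const_mul, integral_const_mul, integral_exp_mul_Ioi (by norm_num),
      integral_exp_mul_Ioi (by norm_num)]
    simp
    ring
  rw [← h2]
  refine setIntegral_mono_on (h.integrableOn_exp_mul s one_pos)
    ((h0.const_mul _).add ((h0.const_mul _).indicator measurableSet_Ioi)) measurableSet_Ioi ?_
  intro x _
  have := Real.exp_pos (-1 * x)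
  by_cases hx : t < x
  · simp only [indicator_apply, mem_Ioi, hx, if_true]
    nlinarith [h.le_one s x]
  · simp only [indicator_apply, mem_Ioi, hx, if_false]
    nlinarith [h.monotone s (not_lt.mp hx)]

lemma tendsto_one {t : ℝ} (ht : 0 < t) : Tendsto (fun s => H s t) (𝓝[>] 0) (𝓝 1) := by
  have hpos : 0 < 1 - Real.exp (-t) := by
    have : Real.exp (-t) < 1 := Real.exp_lt_one_iff.mpr (by linarith)
    linarith
  have h1 : Tendsto (fun s => (Real.exp (-s * φ 1) - Real.exp (-t)) / (1 - Real.exp (-t)))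
      (𝓝[>] 0) (𝓝 1) := by
    have : Tendsto (fun s => (Real.exp (-s * φ 1) - Real.exp (-t)) / (1 - Real.exp (-t)))
        (𝓝 0) (𝓝 ((Real.exp (-0 * φ 1) - Real.exp (-t)) / (1 - Real.exp (-t)))) :=
      (by fun_prop : Continuous fun s =>
        (Real.exp (-s * φ 1) - Real.exp (-t)) / (1 - Real.exp (-t))).tendsto 0
    rw [neg_zero, zero_mul, Real.exp_zero, div_self hpos.ne'] at this
    exact this.mono_left nhdsWithin_le_nhds
  refine tendsto_of_tendsto_of_tendsto_of_le_of_le' h1 tendsto_const_nhds ?_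
    (Eventually.of_forall fun s => h.le_one s t)
  filter_upwards [self_mem_nhdsWithin] with s hs
  rw [div_le_iff₀ hpos]
  linarith [h.exp_le hs ht]

lemma tendsto_zero (t : ℝ) : Tendsto (fun s => H s t) atTop (𝓝 0) := by
  have h1 : Tendsto (fun s => Real.exp (1 * t) * Real.exp (-s * φ 1)) atTop (𝓝 0) := by
    rw [show (0 : ℝ) = Real.exp (1 * t) * 0 by simp]
    refine Tendsto.const_mul _ (Real.tendsto_exp_atBot.comp ?_)
    exact (tendsto_neg_atTop_atBot).atBot_mul_const (h.exponent_pos 1 one_pos)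
  refine tendsto_of_tendsto_of_tendsto_of_le_of_le' tendsto_const_nhds h1
    (Eventually.of_forall fun s => h.nonneg s t) ?_
  filter_upwards [eventually_gt_atTop 0] with s hs using h.le_exp hs one_pos t

lemma measurable_uncurry : Measurable fun z : ℝ × ℝ => H z.1 z.2 := by
  have := measurable_uncurry_of_continuous_of_measurable (u := fun t s => H s t) (fun s => h.continuous s)
    (fun t => (h.antitone t).measurable)
  exact this.comp measurable_swap

/-- The law at time `t` of the first passage time of the subordinator. -/
lemma exists_law : ∃ ν : ℝ → Measure ℝ, Measurable ν ∧ (∀ t, IsProbabilityMeasure (ν t)) ∧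
    (∀ t, 0 < t → ν t (Iic 0) = 0) ∧
    ∀ t, 0 < t → ∀ᵐ s ∂volume.restrict (Ioi (0 : ℝ)), (ν t).real (Ioi s) = H s t := by
  have hmono : ∀ t, Monotone fun s => 1 - H s t := fun t a b hab => by
    have := h.antitone t hab
    dsimp only at this ⊢
    linarith
  set F : ℝ → StieltjesFunction ℝ := fun t => (hmono t).stieltjesFunction with hF
  have hFv : ∀ t x, Tendsto (fun s => 1 - H s t) (𝓝[>] x) (𝓝 (F t x)) := fun t x =>
    (hmono t).tendsto_rightLim x
  have hle : ∀ t x, 1 - H x t ≤ F t x := fun t x => (hmono t).le_rightLim le_rfl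
  have hF1 : ∀ t x, F t x ≤ 1 := fun t x =>
    le_of_tendsto (hFv t x) (Eventually.of_forall fun s => by linarith [h.nonneg s t])
  have hbot : ∀ t, Tendsto (F t) atBot (𝓝 0) := by
    intro t
    refine tendsto_const_nhds.congr' ?_
    filter_upwards [eventually_lt_atBot 0] with x hx
    refine tendsto_nhds_unique ?_ (hFv t x)
    refine tendsto_const_nhds.congr' ?_
    filter_upwards [nhdsWithin_le_nhds (Iio_mem_nhds hx)] with s hs
    rw [h.eq_one s (le_of_lt hs), sub_self]
  have htop : ∀ t, Tendsto (F t) atTop (𝓝 1) := by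
    intro t
    have : Tendsto (fun s => 1 - H s t) atTop (𝓝 1) := by
      simpa using (h.tendsto_zero t).const_sub 1
    exact tendsto_of_tendsto_of_tendsto_of_le_of_le this tendsto_const_nhds (hle t) (hF1 t)
  have hprob : ∀ t, IsProbabilityMeasure (F t).measure := fun t =>
    (F t).isProbabilityMeasure (hbot t) (htop t)
  have hIic : ∀ t x, (F t).measure (Iic x) = ENNReal.ofReal (F t x) := fun t x => by
    rw [(F t).measure_Iic (hbot t), sub_zero]
  set ν : ℝ → Measure ℝ := fun t => if 0 < t then (F t).measure else Measure.dirac 0 with hν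
  have hνp : ∀ t, IsProbabilityMeasure (ν t) := by
    intro t
    by_cases ht : 0 < t
    · simpa [hν, ht] using hprob t
    · simp only [hν, ht, if_false]; infer_instance
  refine ⟨ν, ?_, hνp, ?_, ?_⟩
  · have hm : Measurable fun t => (F t).measure := by
      refine Measurable.measure_of_isPiSystem_of_isProbabilityMeasure
        (borel_eq_generateFrom_Iic ℝ ▸ BorelSpace.measurable_eq) isPiSystem_Iic ?_
      rintro _ ⟨x, rfl⟩
      simp_rw [hIic]
      refine ENNReal.measurable_ofReal.comp ?_
      refine measurable_of_tendsto_metrizable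
        (f := fun (n : ℕ) t => 1 - H (x + 1 / ((n : ℝ) + 1)) t) ?_ ?_
      · intro n
        exact measurable_const.sub (h.monotone _).measurable
      · rw [tendsto_pi_nhds]
        intro t
        refine (hFv t x).comp ?_
        refine tendsto_nhdsWithin_iff.mpr ⟨?_, Eventually.of_forall fun n => ?_⟩
        · simpa using (tendsto_one_div_add_atTop_nhds_zero_nat (𝕜 := ℝ)).const_add x
        · have : 0 < 1 / ((n : ℝ) + 1) := by positivity
          simp only [mem_Ioi]; linarith
    exact Measurable.ite measurableSet_Ioi hm measurable_const
  · intro t ht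
    simp only [hν, ht, if_true]
    rw [hIic]
    have : F t 0 = 0 := tendsto_nhds_unique (hFv t 0) (by simpa using (h.tendsto_one ht).const_sub 1)
    simp [this]
  · intro t ht
    have hc := (hmono t).countable_not_continuousAt
    refine ae_restrict_of_ae ?_
    filter_upwards [hc.ae_notMem volume] with s hs
    have hs : ContinuousAt (fun s => 1 - H s t) s := by simpa using hs
    have hFs : F t s = 1 - H s t :=
      tendsto_nhds_unique (hFv t s) (hs.tendsto.mono_left nhdsWithin_le_nhds)
    simp only [hν, ht, if_true]
    have := hprob t
    rw [← compl_Iic, probReal_compl_eq_one_sub measurableSet_Iic, measureReal_def, hIic, hFs,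
      ENNReal.toReal_ofReal (by linarith [h.le_one s t])]
    ring

end IsSubordinatorCdf

/-- The layer cake formula for a function with integrable weighted derivative. -/
lemma integral_eq_add_integral_mul_measureReal_Ioi {ν : Measure ℝ} [IsProbabilityMeasure ν]
    (hν : ν (Iic 0) = 0) {f g T : ℝ → ℝ} {c : ℝ} (hg : Measurable g)
    (hT : ∀ᵐ s ∂volume.restrict (Ioi (0 : ℝ)), ν.real (Ioi s) = T s)
    (hgi : IntegrableOn (fun s => g s * T s) (Ioi 0))
    (hf : ∀ s, 0 < s → f s = c + ∫ r in Ioc 0 s, g r) :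
    ∫ s, f s ∂ν = c + ∫ s in Ioi 0, g s * T s := by
  have hpos : ∀ᵐ s ∂ν, 0 < s := by
    rw [ae_iff]; simp only [not_lt]; exact hν
  set F : ℝ → ℝ → ℝ := fun s r => (Iio s).indicator g r with hF
  have hFm : Measurable (Function.uncurry F) := by
    have : Function.uncurry F = {z : ℝ × ℝ | z.2 < z.1}.indicator (fun z => g z.2) := by
      ext z
      simp [hF, indicator_apply, Function.uncurry]
    rw [this]
    exact (hg.comp measurable_snd).indicator (measurableSet_lt measurable_snd measurable_fst)
  have hsw : ∀ r, ∀ s, F s r = (Ioi r).indicator (fun _ => g r) s := fun r s => by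
    simp [hF, indicator_apply]
  have hFi : Integrable (Function.uncurry F) (ν.prod (volume.restrict (Ioi 0))) := by
    rw [integrable_prod_iff' hFm.aestronglyMeasurable]
    constructor
    · refine ae_of_all _ fun r => ?_
      simp only [Function.uncurry, hsw]
      exact (integrable_const _).indicator measurableSet_Ioi
    · refine hgi.norm.congr ?_
      filter_upwards [hT] with r hr
      simp only [Function.uncurry, hsw, norm_indicator_eq_indicator_norm]
      rw [integral_indicator_const _ measurableSet_Ioi, hr, norm_mul, ← hr,
        Real.norm_of_nonneg measureReal_nonneg, smul_eq_mul, mul_comm]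
  have h1 : ∀ s, 0 < s → ∫ r in Ioc 0 s, g r = ∫ r in Ioi 0, F s r := by
    intro s hs
    rw [setIntegral_indicator measurableSet_Iio, integral_Ioc_eq_integral_Ioo]
    rfl
  calc ∫ s, f s ∂ν = ∫ s, (c + (∫ r in Ioi 0, F s r)) ∂ν := by
        refine integral_congr_ae ?_
        filter_upwards [hpos] with s hs
        rw [hf s hs, h1 s hs]
    _ = c + ∫ s, (∫ r in Ioi 0, F s r) ∂ν := by
        rw [integral_add (f := fun _ => c) (g := fun s => ∫ r in Ioi 0, F s r) (integrable_const _)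
          hFi.integral_prod_left]
        simp
    _ = c + ∫ r in Ioi 0, (∫ s, F s r ∂ν) := by
        rw [integral_integral_swap hFi]
    _ = _ := by
        congr 1
        refine integral_congr_ae ?_
        filter_upwards [hT] with r hr
        simp only [hsw]
        rw [integral_indicator_const _ measurableSet_Ioi, hr, smul_eq_mul, mul_comm]

section Gaussian

variable {E : Type*} [NormedAddCommGroup E] [InnerProductSpace ℝ E] [FiniteDimensional ℝ E]
  [MeasurableSpace E] [BorelSpace E]
  {F : Type*} [NormedAddCommGroup F] [NormedSpace ℝ F]

lemma integrable_exp_neg_mul_sq_norm {b : ℝ} (hb : 0 < b) :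
    Integrable fun z : E => Real.exp (-b * ‖z‖ ^ 2) := by
  refine not_imp_comm.1 integral_undef ?_
  rw [GaussianFourier.integral_rexp_neg_mul_sq_norm hb]
  positivity

lemma integrable_smul_of_norm_le_exp {a : E → F} {f : E → ℝ} {b C M : ℝ} (hb : 0 < b)
    (ha : Continuous a) (haC : ∀ z, ‖a z‖ ≤ C * Real.exp (-b * ‖z‖ ^ 2))
    (hf : Continuous f) (hM : ∀ x, |f x| ≤ M) (x : E) :
    Integrable fun z => f (x - z) • a z := by
  refine Integrable.mono' ((integrable_exp_neg_mul_sq_norm (E := E) hb).const_mul (M * C)) 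
    (by fun_prop : Continuous fun z => f (x - z) • a z).aestronglyMeasurable ?_
  refine ae_of_all _ fun z => ?_
  rw [norm_smul, mul_assoc]
  exact mul_le_mul (hM _) (haC z) (norm_nonneg _) ((abs_nonneg _).trans (hM 0))

lemma integral_sub_smul (f : E → ℝ) (a : E → F) (y : E) :
    ∫ z, f (y - z) • a z = ∫ ξ, f ξ • a (y - ξ) := by
  rw [← integral_sub_left_eq_self _ volume y]
  simp

/-- Differentiation under the integral sign of a convolution with a kernel that has Gaussian
decay together with its derivative. -/
lemma hasFDerivAt_integral_smul_of_norm_le_exp {a : E → F} {a' : E → E →L[ℝ] F} {f : E → ℝ}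
    {b C M : ℝ} (hb : 0 < b) (ha : ∀ z, HasFDerivAt a (a' z) z) (ha' : Continuous a')
    (haC : ∀ z, ‖a z‖ ≤ C * Real.exp (-b * ‖z‖ ^ 2))
    (haC' : ∀ z, ‖a' z‖ ≤ C * Real.exp (-b * ‖z‖ ^ 2))
    (hf : Continuous f) (hM : ∀ x, |f x| ≤ M) (x : E) :
    HasFDerivAt (fun y => ∫ z, f (y - z) • a z) (∫ z, f (x - z) • a' z) x := by
  have hac : Continuous a := continuous_iff_continuousAt.mpr fun z => (ha z).continuousAt
  simp_rw [integral_sub_smul f a]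
  rw [integral_sub_smul f a']
  have hM0 : 0 ≤ M := (abs_nonneg _).trans (hM 0)
  have hC0 : 0 ≤ C := by
    have := (norm_nonneg _).trans (haC 0)
    simpa using this
  refine hasFDerivAt_integral_of_dominated_of_fderiv_le (F' := fun y ξ => f ξ • a' (y - ξ))
    (bound := fun ξ => M * (C * Real.exp b) * Real.exp (-(b / 2) * ‖x - ξ‖ ^ 2))
    (Metric.ball_mem_nhds x one_pos) ?_ ?_ ?_ ?_ ?_ ?_
  · exact Eventually.of_forall fun y =>
      (by fun_prop : Continuous fun ξ => f ξ • a (y - ξ)).aestronglyMeasurable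
  · have := (integrable_smul_of_norm_le_exp hb hac haC hf hM x).comp_sub_left x
    simpa using this
  · exact (by fun_prop : Continuous fun ξ => f ξ • a' (x - ξ)).aestronglyMeasurable
  · refine ae_of_all _ fun ξ y hy => ?_
    rw [norm_smul, mul_assoc]
    refine mul_le_mul (hM _) ((haC' _).trans ?_) (norm_nonneg _) hM0
    rw [mul_assoc, ← Real.exp_add]
    refine mul_le_mul_of_nonneg_left (Real.exp_le_exp.mpr ?_) hC0
    rw [Metric.mem_ball, dist_comm, dist_eq_norm] at hy
    have h1 : ‖x - ξ‖ ≤ ‖x - y‖ + ‖y - ξ‖ := by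
      simpa using norm_add_le (x - y) (y - ξ)
    have h2 : ‖x - ξ‖ ^ 2 ≤ 2 * ‖y - ξ‖ ^ 2 + 2 := by
      have := norm_nonneg (x - ξ)
      have := norm_nonneg (x - y)
      nlinarith [sq_nonneg (1 - ‖y - ξ‖)]
    nlinarith
  · exact ((integrable_exp_neg_mul_sq_norm (E := E) (half_pos hb)).comp_sub_left x).const_mul _
  · refine ae_of_all _ fun ξ y _ => ?_
    exact ((hasFDerivAt_comp_sub ξ).mpr (ha (y - ξ))).const_smul (f ξ)

end Gaussian

section HeatKernel

variable {E : Type*} [NormedAddCommGroup E] [InnerProductSpace ℝ E]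

/-- The normalizing factor of the heat kernel on `E`. -/
noncomputable def heatFactor (E : Type*) [NormedAddCommGroup E] [InnerProductSpace ℝ E]
    (s : ℝ) : ℝ :=
  (4 * Real.pi * s) ^ (-(Module.finrank ℝ E / 2 : ℝ))

/-- The heat kernel on a Euclidean space. -/
noncomputable def heatKernel (s : ℝ) (z : E) : ℝ :=
  heatFactor E s * Real.exp (-(4 * s)⁻¹ * ‖z‖ ^ 2)

/-- The inner product as a bilinear continuous map. -/
noncomputable def innerCLM (E : Type*) [NormedAddCommGroup E] [InnerProductSpace ℝ E] :
    E →L[ℝ] E →L[ℝ] ℝ :=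
  LinearMap.mkContinuous₂ (innerₗ E) 1 fun x y => by
    simpa using abs_real_inner_le_norm x y

/-- The spatial derivative of the heat kernel. -/
noncomputable def heatKernelDeriv (s : ℝ) (z : E) : E →L[ℝ] ℝ :=
  (-(2 * s)⁻¹ * heatKernel s z) • innerCLM E z

/-- The second spatial derivative of the heat kernel. -/
noncomputable def heatKernelDeriv₂ (s : ℝ) (z : E) : E →L[ℝ] E →L[ℝ] ℝ :=
  (-(2 * s)⁻¹ * heatKernel s z) • innerCLM E +
    (-(2 * s)⁻¹ • heatKernelDeriv s z).smulRight (innerCLM E z)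

@[simp] lemma innerCLM_apply (x y : E) : innerCLM E x y = inner ℝ x y := rfl

lemma norm_innerCLM_le : ‖innerCLM E‖ ≤ 1 :=
  LinearMap.mkContinuous₂_norm_le _ zero_le_one _

lemma norm_innerCLM_apply_le (z : E) : ‖innerCLM E z‖ ≤ ‖z‖ := by
  simpa using (innerCLM E).le_of_opNorm_le norm_innerCLM_le z

lemma heatFactor_pos {s : ℝ} (hs : 0 < s) : 0 < heatFactor E s :=
  Real.rpow_pos_of_pos (by positivity) _

lemma heatFactor_antitoneOn : AntitoneOn (heatFactor E) (Ioi 0) := by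
  intro s hs t ht hst
  have hs : 0 < s := hs
  refine Real.rpow_le_rpow_of_nonpos (by positivity) (by gcongr) ?_
  simp only [neg_nonpos]; positivity

lemma heatKernel_pos {s : ℝ} (hs : 0 < s) (z : E) : 0 < heatKernel s z :=
  mul_pos (heatFactor_pos hs) (Real.exp_pos _)

lemma sq_one_add_mul_exp_le {u : ℝ} (hu : 0 ≤ u) :
    Real.exp (-u / 4) * (1 + u) ^ 2 ≤ 256 * Real.exp (-u / 8) := by
  have h1 : 1 + u ≤ 16 * Real.exp (u / 16) := by
    linarith [Real.add_one_le_exp (u / 16)]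
  have h2 : (1 + u) ^ 2 ≤ 256 * Real.exp (u / 8) := by
    calc (1 + u) ^ 2 ≤ (16 * Real.exp (u / 16)) ^ 2 := by gcongr
      _ = 256 * Real.exp (u / 8) := by
        rw [mul_pow, ← Real.exp_nat_mul]; norm_num; ring_nf
  calc _ ≤ Real.exp (-u / 4) * (256 * Real.exp (u / 8)) := by gcongr
    _ = 256 * Real.exp (-u / 8) := by
      rw [mul_left_comm, ← Real.exp_add]; ring_nf

lemma heatKernel_mul_le {s : ℝ} (hs : 0 < s) (z : E) :
    heatKernel s z * (1 + ‖z‖ ^ 2 / s) ^ 2 ≤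
      256 * heatFactor E s * Real.exp (-(8 * s)⁻¹ * ‖z‖ ^ 2) := by
  have h := sq_one_add_mul_exp_le (u := ‖z‖ ^ 2 / s) (by positivity)
  have e1 : -(‖z‖ ^ 2 / s) / 4 = -(4 * s)⁻¹ * ‖z‖ ^ 2 := by field_simp
  have e2 : -(‖z‖ ^ 2 / s) / 8 = -(8 * s)⁻¹ * ‖z‖ ^ 2 := by field_simp
  rw [e1, e2] at h
  have := mul_le_mul_of_nonneg_left h (heatFactor_pos (E := E) hs).le
  rw [heatKernel]
  linarith

lemma heatKernel_le {s : ℝ} (hs : 0 < s) (z : E) :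
    heatKernel s z ≤ 256 * heatFactor E s * Real.exp (-(8 * s)⁻¹ * ‖z‖ ^ 2) := by
  refine le_trans ?_ (heatKernel_mul_le hs z)
  have : 0 ≤ ‖z‖ ^ 2 / s := by positivity
  exact le_mul_of_one_le_right (heatKernel_pos hs z).le (by nlinarith)

lemma continuous_heatKernel (s : ℝ) : Continuous (heatKernel s : E → ℝ) := by
  unfold heatKernel; fun_prop

lemma continuous_heatKernelDeriv (s : ℝ) : Continuous (heatKernelDeriv s : E → E →L[ℝ] ℝ) := by
  have := continuous_heatKernel (E := E) s
  unfold heatKernelDeriv; fun_prop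

set_option maxSynthPendingDepth 3 in
lemma continuous_heatKernelDeriv₂ (s : ℝ) :
    Continuous (heatKernelDeriv₂ s : E → E →L[ℝ] E →L[ℝ] ℝ) := by
  have := continuous_heatKernel (E := E) s
  have := continuous_heatKernelDeriv (E := E) s
  have h : Continuous fun z : E => ((-(2 * s)⁻¹ • heatKernelDeriv s z).smulRight (innerCLM E z)) := by
    have : ∀ z : E, (-(2 * s)⁻¹ • heatKernelDeriv s z).smulRight (innerCLM E z) =
      ContinuousLinearMap.smulRightL ℝ E (E →L[ℝ] ℝ) (-(2 * s)⁻¹ • heatKernelDeriv s z)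
        (innerCLM E z) := fun z => rfl
    simp_rw [this]
    fun_prop
  exact (by fun_prop : Continuous fun z : E => (-(2 * s)⁻¹ * heatKernel s z) • innerCLM E).add h

lemma hasFDerivAt_heatKernel (s : ℝ) (z : E) :
    HasFDerivAt (heatKernel s) (heatKernelDeriv s z) z := by
  have h := ((hasStrictFDerivAt_norm_sq z).hasFDerivAt.const_mul (-(4 * s)⁻¹)).exp.const_mul
    (heatFactor E s)
  refine h.congr_fderiv ?_
  ext w
  simp [heatKernelDeriv, heatKernel]
  ring

lemma hasFDerivAt_heatKernelDeriv (s : ℝ) (z : E) :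
    HasFDerivAt (heatKernelDeriv s) (heatKernelDeriv₂ s z) z :=
  ((hasFDerivAt_heatKernel s z).const_mul (-(2 * s)⁻¹)).smul (innerCLM E).hasFDerivAt

lemma norm_heatKernelDeriv_le {s : ℝ} (hs : 0 < s) (z : E) :
    ‖heatKernelDeriv s z‖ ≤ (2 * s)⁻¹ * ‖z‖ * heatKernel s z := by
  have h := heatKernel_pos hs z
  rw [heatKernelDeriv, norm_smul, norm_mul, norm_neg, Real.norm_of_nonneg h.le,
    Real.norm_of_nonneg (by positivity)]
  have := norm_innerCLM_apply_le z
  calc _ ≤ (2 * s)⁻¹ * heatKernel s z * ‖z‖ := by gcongr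
    _ = _ := by ring

lemma norm_heatKernelDeriv_le_exp {s : ℝ} (hs : 0 < s) (z : E) :
    ‖heatKernelDeriv s z‖ ≤
      (Real.sqrt s)⁻¹ * (256 * heatFactor E s) * Real.exp (-(8 * s)⁻¹ * ‖z‖ ^ 2) := by
  have hK := heatKernel_pos hs z
  have hq : 0 < Real.sqrt s := Real.sqrt_pos.mpr hs
  rw [mul_assoc]
  refine (norm_heatKernelDeriv_le hs z).trans ?_
  refine le_trans ?_ (mul_le_mul_of_nonneg_left (heatKernel_mul_le hs z) (inv_nonneg.mpr hq.le))
  have e : (2 * s)⁻¹ * ‖z‖ = (Real.sqrt s)⁻¹ * ((‖z‖ / Real.sqrt s) / 2) := by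
    nth_rewrite 1 [← Real.mul_self_sqrt hs.le]
    field_simp
  have e2 : ‖z‖ ^ 2 / s = (‖z‖ / Real.sqrt s) ^ 2 := by rw [div_pow, Real.sq_sqrt hs.le]
  rw [e, e2, mul_assoc]
  refine mul_le_mul_of_nonneg_left ?_ (inv_nonneg.mpr hq.le)
  rw [mul_comm]
  refine mul_le_mul_of_nonneg_left ?_ hK.le
  have : 0 ≤ ‖z‖ / Real.sqrt s := by positivity
  nlinarith [sq_nonneg (‖z‖ / Real.sqrt s - 1), sq_nonneg ((‖z‖ / Real.sqrt s) ^ 2)]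

set_option maxSynthPendingDepth 3 in
lemma norm_heatKernelDeriv₂_le {s : ℝ} (hs : 0 < s) (z : E) :
    ‖heatKernelDeriv₂ s z‖ ≤ s⁻¹ * (heatKernel s z * (1 + ‖z‖ ^ 2 / s)) := by
  have hK := heatKernel_pos hs z
  have h1 : ‖(-(2 * s)⁻¹ * heatKernel s z) • innerCLM E‖ ≤ (2 * s)⁻¹ * heatKernel s z := by
    rw [norm_smul, norm_mul, norm_neg, Real.norm_of_nonneg hK.le,
      Real.norm_of_nonneg (by positivity)]
    exact mul_le_of_le_one_right (by positivity) norm_innerCLM_le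
  have h2 : ‖(-(2 * s)⁻¹ • heatKernelDeriv s z).smulRight (innerCLM E z)‖ ≤
      (2 * s)⁻¹ * ((2 * s)⁻¹ * ‖z‖ * heatKernel s z) * ‖z‖ := by
    rw [ContinuousLinearMap.norm_smulRight_apply, norm_smul, norm_neg,
      Real.norm_of_nonneg (by positivity)]
    gcongr
    · exact norm_heatKernelDeriv_le hs z
    · exact norm_innerCLM_apply_le z
  refine (norm_add_le _ _).trans ((add_le_add h1 h2).trans ?_)
  have : (2 * s)⁻¹ * heatKernel s z + (2 * s)⁻¹ * ((2 * s)⁻¹ * ‖z‖ * heatKernel s z) * ‖z‖ =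
      s⁻¹ * (heatKernel s z * (1 / 2 + (‖z‖ ^ 2 / s) / 4)) := by field_simp; ring
  rw [this]
  have : 0 ≤ ‖z‖ ^ 2 / s := by positivity
  refine mul_le_mul_of_nonneg_left (mul_le_mul_of_nonneg_left ?_ hK.le) (inv_nonneg.mpr hs.le)
  linarith

lemma norm_heatKernelDeriv₂_le_exp {s : ℝ} (hs : 0 < s) (z : E) :
    ‖heatKernelDeriv₂ s z‖ ≤
      s⁻¹ * (256 * heatFactor E s) * Real.exp (-(8 * s)⁻¹ * ‖z‖ ^ 2) := by
  have hK := heatKernel_pos hs z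
  rw [mul_assoc]
  refine (norm_heatKernelDeriv₂_le hs z).trans ?_
  refine mul_le_mul_of_nonneg_left (le_trans ?_ (heatKernel_mul_le hs z)) (inv_nonneg.mpr hs.le)
  have : 0 ≤ ‖z‖ ^ 2 / s := by positivity
  gcongr
  nlinarith

omit [InnerProductSpace ℝ E] in
lemma norm_rpow_le {s γ : ℝ} (hs : 0 < s) (hγ : 0 < γ) (hγ1 : γ ≤ 1) (z : E) :
    ‖z‖ ^ γ ≤ s ^ (γ / 2) * (1 + ‖z‖ ^ 2 / s) := by
  have h0 : 0 ≤ ‖z‖ ^ 2 / s := by positivity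
  have e : ‖z‖ ^ γ = s ^ (γ / 2) * (‖z‖ ^ 2 / s) ^ (γ / 2) := by
    rw [← Real.mul_rpow hs.le h0, mul_div_cancel₀ _ hs.ne', ← Real.rpow_natCast,
      ← Real.rpow_mul (norm_nonneg _)]
    congr 1; push_cast; ring
  rw [e]
  gcongr
  calc (‖z‖ ^ 2 / s) ^ (γ / 2) ≤ (1 + ‖z‖ ^ 2 / s) ^ (γ / 2) := by gcongr; linarith
    _ ≤ (1 + ‖z‖ ^ 2 / s) ^ (1 : ℝ) := Real.rpow_le_rpow_of_exponent_le (by linarith) (by linarith)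
    _ = _ := Real.rpow_one _

/-- The time derivative of the heat kernel. -/
noncomputable def heatKernelTimeDeriv (s : ℝ) (z : E) : ℝ :=
  heatKernel s z * (‖z‖ ^ 2 / (4 * s ^ 2) - Module.finrank ℝ E / (2 * s))

lemma hasDerivAt_heatKernel {s : ℝ} (hs : 0 < s) (z : E) :
    HasDerivAt (fun s => heatKernel s z) (heatKernelTimeDeriv s z) s := by
  have h1 : HasDerivAt (fun s => heatFactor E s)
      (heatFactor E s * (-(Module.finrank ℝ E / (2 * s)))) s := by
    have := ((hasDerivAt_id s).const_mul (4 * Real.pi)).rpow_const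
      (p := -(Module.finrank ℝ E / 2 : ℝ)) (Or.inl (by simp [hs.ne', Real.pi_ne_zero]))
    refine this.congr_deriv ?_
    simp only [id]
    rw [heatFactor, Real.rpow_sub_one (by positivity)]
    field_simp
  have h2 : HasDerivAt (fun s => Real.exp (-(4 * s)⁻¹ * ‖z‖ ^ 2))
      (Real.exp (-(4 * s)⁻¹ * ‖z‖ ^ 2) * (‖z‖ ^ 2 / (4 * s ^ 2))) s := by
    have := ((((hasDerivAt_id s).const_mul 4).inv (by simp [hs.ne'])).neg.mul_const (‖z‖ ^ 2)).exp
    refine this.congr_deriv ?_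
    simp only [id, Pi.neg_apply, Pi.inv_apply]
    field_simp
    try ring
  refine (h1.mul h2).congr_deriv ?_
  simp only [heatKernelTimeDeriv, heatKernel]
  ring

lemma sum_heatKernelDeriv₂ {ι : Type*} [Fintype ι] (b : OrthonormalBasis ι ℝ E) {s : ℝ}
    (hs : 0 < s) (z : E) :
    ∑ i, heatKernelDeriv₂ s z (b i) (b i) = heatKernelTimeDeriv s z := by
  have h1 : ∑ i, inner ℝ z (b i) * inner ℝ z (b i) = ‖z‖ ^ 2 := by
    have := b.sum_inner_mul_inner z z
    rw [real_inner_self_eq_norm_sq] at this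
    rw [← this]
    simp_rw [real_inner_comm z]
  have h2 : (Module.finrank ℝ E : ℝ) = Fintype.card ι := by
    rw [Module.finrank_eq_card_basis b.toBasis]
  have h3 : ∀ i, heatKernelDeriv₂ s z (b i) (b i) = -(2 * s)⁻¹ * heatKernel s z +
      (2 * s)⁻¹ * (2 * s)⁻¹ * heatKernel s z * (inner ℝ z (b i) * inner ℝ z (b i)) := by
    intro i
    simp [heatKernelDeriv₂, heatKernelDeriv]
    ring
  simp_rw [h3]
  rw [Finset.sum_add_distrib, ← Finset.mul_sum, ← Finset.mul_sum, h1, heatKernelTimeDeriv, h2]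
  simp only [Finset.sum_const, Finset.card_univ, nsmul_eq_mul]
  field_simp
  ring

variable [FiniteDimensional ℝ E] [MeasurableSpace E] [BorelSpace E]

lemma integrable_heatKernel {s : ℝ} (hs : 0 < s) : Integrable (heatKernel s : E → ℝ) :=
  (integrable_exp_neg_mul_sq_norm (by positivity)).const_mul _

lemma integral_heatKernel {s : ℝ} (hs : 0 < s) : ∫ z : E, heatKernel s z = 1 := by
  simp only [heatKernel]
  rw [integral_const_mul, GaussianFourier.integral_rexp_neg_mul_sq_norm (by positivity), heatFactor,
    div_inv_eq_mul, Real.rpow_neg (by positivity), show Real.pi * (4 * s) = 4 * Real.pi * s by ring,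
    inv_mul_cancel₀]
  positivity

lemma integral_heatFactor_mul_exp {s : ℝ} (hs : 0 < s) :
    ∫ z : E, heatFactor E s * Real.exp (-(8 * s)⁻¹ * ‖z‖ ^ 2) =
      2 ^ (Module.finrank ℝ E / 2 : ℝ) := by
  rw [integral_const_mul, GaussianFourier.integral_rexp_neg_mul_sq_norm (by positivity), heatFactor,
    div_inv_eq_mul, Real.rpow_neg (by positivity),
    show Real.pi * (8 * s) = (4 * Real.pi * s) * 2 by ring, Real.mul_rpow (by positivity) two_pos.le,
    inv_mul_cancel_left₀]
  positivity

end HeatKernel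

section HeatSemigroup

set_option maxSynthPendingDepth 3

variable {E : Type*} [NormedAddCommGroup E] [InnerProductSpace ℝ E] [FiniteDimensional ℝ E]
  [MeasurableSpace E] [BorelSpace E]

/-- The action of the heat semigroup on a function. -/
noncomputable def heatOp (f : E → ℝ) (s : ℝ) (x : E) : ℝ :=
  ∫ z, f (x - z) • heatKernel s z

/-- The spatial derivative of `heatOp f s`. -/
noncomputable def heatOpDeriv (f : E → ℝ) (s : ℝ) (x : E) : E →L[ℝ] ℝ :=
  ∫ z, f (x - z) • heatKernelDeriv s z

/-- The second spatial derivative of `heatOp f s`. -/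
noncomputable def heatOpDeriv₂ (f : E → ℝ) (s : ℝ) (x : E) : E →L[ℝ] E →L[ℝ] ℝ :=
  ∫ z, f (x - z) • heatKernelDeriv₂ s z

/-- The time derivative of `heatOp f s`. -/
noncomputable def heatOpTimeDeriv (f : E → ℝ) (s : ℝ) (x : E) : ℝ :=
  ∫ z, f (x - z) • heatKernelTimeDeriv s z

/-- A constant depending on the dimension only. -/
noncomputable def heatConst (E : Type*) [NormedAddCommGroup E] [InnerProductSpace ℝ E] : ℝ :=
  256 * 2 ^ (Module.finrank ℝ E / 2 : ℝ)

lemma norm_integral_le_heatConst {F : Type*} [NormedAddCommGroup F] [NormedSpace ℝ F]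
    {G : E → F} {s c : ℝ} (hs : 0 < s)
    (hG : ∀ z, ‖G z‖ ≤ c * ((256 * heatFactor E s) * Real.exp (-(8 * s)⁻¹ * ‖z‖ ^ 2))) :
    ‖∫ z, G z‖ ≤ c * heatConst E := by
  have h1 := norm_integral_le_of_norm_le (f := G)
    (((integrable_exp_neg_mul_sq_norm (E := E) (b := (8 * s)⁻¹) (by positivity)).const_mul
      (256 * heatFactor E s)).const_mul c) (ae_of_all _ hG)
  refine h1.trans (le_of_eq ?_)
  simp only [mul_assoc (256 : ℝ)]
  rw [integral_const_mul, integral_const_mul, integral_heatFactor_mul_exp hs, heatConst]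

variable {f : E → ℝ} {M s : ℝ}

lemma integrable_smul_heatKernel (hf : Continuous f) (hM : ∀ x, |f x| ≤ M) (hs : 0 < s) (x : E) :
    Integrable fun z => f (x - z) • heatKernel s z :=
  integrable_smul_of_norm_le_exp (b := (8 * s)⁻¹) (by positivity) (continuous_heatKernel s)
    (fun z => by rw [Real.norm_of_nonneg (heatKernel_pos hs z).le]; exact heatKernel_le hs z) hf hM x

lemma integrable_smul_heatKernelDeriv₂ (hf : Continuous f) (hM : ∀ x, |f x| ≤ M) (hs : 0 < s)
    (x : E) : Integrable fun z => f (x - z) • heatKernelDeriv₂ s z :=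
  integrable_smul_of_norm_le_exp (b := (8 * s)⁻¹) (by positivity) (continuous_heatKernelDeriv₂ s)
    (norm_heatKernelDeriv₂_le_exp hs) hf hM x

lemma hasFDerivAt_heatOp (hf : Continuous f) (hM : ∀ x, |f x| ≤ M) (hs : 0 < s) (x : E) :
    HasFDerivAt (heatOp f s) (heatOpDeriv f s x) x := by
  have hfac := (heatFactor_pos (E := E) hs).le
  refine hasFDerivAt_integral_smul_of_norm_le_exp (b := (8 * s)⁻¹)
    (C := max (256 * heatFactor E s) ((Real.sqrt s)⁻¹ * (256 * heatFactor E s)))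
    (by positivity) (hasFDerivAt_heatKernel s) (continuous_heatKernelDeriv s) ?_ ?_ hf hM x
  · intro z
    rw [Real.norm_of_nonneg (heatKernel_pos hs z).le]
    exact (heatKernel_le hs z).trans
      (mul_le_mul_of_nonneg_right (le_max_left _ _) (Real.exp_nonneg _))
  · intro z
    exact (norm_heatKernelDeriv_le_exp hs z).trans
      (mul_le_mul_of_nonneg_right (le_max_right _ _) (Real.exp_nonneg _))

lemma hasFDerivAt_heatOpDeriv (hf : Continuous f) (hM : ∀ x, |f x| ≤ M) (hs : 0 < s) (x : E) :
    HasFDerivAt (heatOpDeriv f s) (heatOpDeriv₂ f s x) x := by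
  refine hasFDerivAt_integral_smul_of_norm_le_exp (b := (8 * s)⁻¹)
    (C := max ((Real.sqrt s)⁻¹ * (256 * heatFactor E s)) (s⁻¹ * (256 * heatFactor E s)))
    (by positivity) (hasFDerivAt_heatKernelDeriv s) (continuous_heatKernelDeriv₂ s) ?_ ?_ hf hM x
  · intro z
    exact (norm_heatKernelDeriv_le_exp hs z).trans
      (mul_le_mul_of_nonneg_right (le_max_left _ _) (Real.exp_nonneg _))
  · intro z
    exact (norm_heatKernelDeriv₂_le_exp hs z).trans
      (mul_le_mul_of_nonneg_right (le_max_right _ _) (Real.exp_nonneg _))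

lemma integral_heatKernelDeriv₂ (hs : 0 < s) : ∫ z : E, heatKernelDeriv₂ s z = 0 := by
  have h := hasFDerivAt_heatOpDeriv (E := E) (f := fun _ => 1) (M := 1) continuous_const
    (by simp) hs 0
  have hc : heatOpDeriv (fun _ : E => (1 : ℝ)) s = fun _ => ∫ z, (1 : ℝ) • heatKernelDeriv s z := rfl
  rw [hc] at h
  have := h.unique (hasFDerivAt_const _ _)
  simpa [heatOpDeriv₂] using this

lemma abs_heatOp_le (hM : ∀ x, |f x| ≤ M) (hs : 0 < s) (x : E) : |heatOp f s x| ≤ M := by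
  have h1 := norm_integral_le_of_norm_le (f := fun z => f (x - z) • heatKernel s z)
    ((integrable_heatKernel (E := E) hs).const_mul M) (ae_of_all _ fun z => by
      rw [norm_smul, Real.norm_of_nonneg (heatKernel_pos hs z).le]
      exact mul_le_mul_of_nonneg_right (hM _) (heatKernel_pos hs z).le)
  rwa [integral_const_mul, integral_heatKernel hs, mul_one] at h1

lemma norm_heatOpDeriv_le (hM : ∀ x, |f x| ≤ M) (hs : 0 < s) (x : E) :
    ‖heatOpDeriv f s x‖ ≤ M * (Real.sqrt s)⁻¹ * heatConst E := by
  refine norm_integral_le_heatConst hs fun z => ?_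
  rw [norm_smul, mul_assoc, ← mul_assoc (Real.sqrt s)⁻¹]
  exact mul_le_mul (hM _) (norm_heatKernelDeriv_le_exp hs z) (norm_nonneg _)
    ((abs_nonneg _).trans (hM 0))

variable {C γ : ℝ}

omit [FiniteDimensional ℝ E] [MeasurableSpace E] [BorelSpace E] in
lemma rpow_mul_heat_le (hs : 0 < s) (hγ : 0 < γ) (hγ1 : γ ≤ 1) (z : E) :
    ‖z‖ ^ γ * (heatKernel s z * (1 + ‖z‖ ^ 2 / s)) ≤
      s ^ (γ / 2) * ((256 * heatFactor E s) * Real.exp (-(8 * s)⁻¹ * ‖z‖ ^ 2)) := by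
  have hK := heatKernel_pos hs z
  have h0 : 0 ≤ ‖z‖ ^ 2 / s := by positivity
  calc _ ≤ (s ^ (γ / 2) * (1 + ‖z‖ ^ 2 / s)) * (heatKernel s z * (1 + ‖z‖ ^ 2 / s)) := by
        gcongr; exact norm_rpow_le hs hγ hγ1 z
    _ = s ^ (γ / 2) * (heatKernel s z * (1 + ‖z‖ ^ 2 / s) ^ 2) := by ring
    _ ≤ _ := by
        exact mul_le_mul_of_nonneg_left (heatKernel_mul_le hs z) (by positivity)

lemma abs_heatOp_sub_le (hf : Continuous f) (hM : ∀ x, |f x| ≤ M)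
    (hC : ∀ x y, |f x - f y| ≤ C * ‖x - y‖ ^ γ) (hC0 : 0 ≤ C)
    (hγ : 0 < γ) (hγ1 : γ ≤ 1) (hs : 0 < s) (x : E) :
    |heatOp f s x - f x| ≤ C * s ^ (γ / 2) * heatConst E := by
  have e : heatOp f s x - f x = ∫ z, (f (x - z) - f x) * heatKernel s z := by
    have h2 := integral_sub (integrable_smul_heatKernel hf hM hs x)
      ((integrable_heatKernel (E := E) hs).const_mul (f x))
    simp_rw [sub_mul]
    refine Eq.trans ?_ h2.symm
    rw [integral_const_mul, integral_heatKernel hs, mul_one]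
    rfl
  rw [e, ← Real.norm_eq_abs]
  refine norm_integral_le_heatConst hs fun z => ?_
  have hK := heatKernel_pos hs z
  have h0 : 0 ≤ ‖z‖ ^ 2 / s := by positivity
  have h1 : |f (x - z) - f x| ≤ C * ‖z‖ ^ γ := by simpa using hC (x - z) x
  rw [norm_mul, Real.norm_of_nonneg hK.le, Real.norm_eq_abs]
  calc _ ≤ (C * ‖z‖ ^ γ) * (heatKernel s z * (1 + ‖z‖ ^ 2 / s)) := by
        gcongr
        exact le_mul_of_one_le_right hK.le (by linarith)
    _ = C * (‖z‖ ^ γ * (heatKernel s z * (1 + ‖z‖ ^ 2 / s))) := by ring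
    _ ≤ C * (s ^ (γ / 2) * ((256 * heatFactor E s) * Real.exp (-(8 * s)⁻¹ * ‖z‖ ^ 2))) :=
        mul_le_mul_of_nonneg_left (rpow_mul_heat_le hs hγ hγ1 z) hC0
    _ = _ := by ring

lemma norm_heatOpDeriv₂_le (hf : Continuous f) (hM : ∀ x, |f x| ≤ M)
    (hC : ∀ x y, |f x - f y| ≤ C * ‖x - y‖ ^ γ) (hC0 : 0 ≤ C)
    (hγ : 0 < γ) (hγ1 : γ ≤ 1) (hs : 0 < s) (x : E) :
    ‖heatOpDeriv₂ f s x‖ ≤ C * s ^ (γ / 2 - 1) * heatConst E := by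
  have hi : Integrable fun z : E => f x • heatKernelDeriv₂ s z :=
    integrable_smul_heatKernelDeriv₂ (f := fun _ => f x) continuous_const (M := |f x|) (by simp) hs x
  have e : heatOpDeriv₂ f s x = ∫ z, (f (x - z) - f x) • heatKernelDeriv₂ s z := by
    simp_rw [sub_smul]
    rw [integral_sub (integrable_smul_heatKernelDeriv₂ hf hM hs x) hi, integral_smul,
      integral_heatKernelDeriv₂ hs, smul_zero, sub_zero]
    rfl
  rw [e]
  refine norm_integral_le_heatConst hs fun z => ?_
  have hK := heatKernel_pos hs z
  have h0 : 0 ≤ ‖z‖ ^ 2 / s := by positivity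
  have h1 : |f (x - z) - f x| ≤ C * ‖z‖ ^ γ := by simpa using hC (x - z) x
  have e2 : s ^ (γ / 2 - 1) = s⁻¹ * s ^ (γ / 2) := by
    rw [Real.rpow_sub_one hs.ne']; field_simp
  refine (ContinuousLinearMap.opNorm_smul_le _ _).trans ?_
  calc _ ≤ (C * ‖z‖ ^ γ) * (s⁻¹ * (heatKernel s z * (1 + ‖z‖ ^ 2 / s))) :=
        mul_le_mul h1 (norm_heatKernelDeriv₂_le hs z) (norm_nonneg _) (by positivity)
    _ = (C * s⁻¹) * (‖z‖ ^ γ * (heatKernel s z * (1 + ‖z‖ ^ 2 / s))) := by ring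
    _ ≤ (C * s⁻¹) * (s ^ (γ / 2) * ((256 * heatFactor E s) * Real.exp (-(8 * s)⁻¹ * ‖z‖ ^ 2))) :=
        mul_le_mul_of_nonneg_left (rpow_mul_heat_le hs hγ hγ1 z) (by positivity)
    _ = _ := by rw [e2]; ring

lemma sum_heatOpDeriv₂ {ι : Type*} [Fintype ι] (b : OrthonormalBasis ι ℝ E)
    (hf : Continuous f) (hM : ∀ x, |f x| ≤ M) (hs : 0 < s) (x : E) :
    ∑ i, heatOpDeriv₂ f s x (b i) (b i) = heatOpTimeDeriv f s x := by
  have hi := integrable_smul_heatKernelDeriv₂ hf hM hs x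
  have h1 : ∀ i, heatOpDeriv₂ f s x (b i) (b i) =
      ∫ z, f (x - z) * heatKernelDeriv₂ s z (b i) (b i) := by
    intro i
    rw [heatOpDeriv₂, ContinuousLinearMap.integral_apply hi,
      ContinuousLinearMap.integral_apply (hi.apply_continuousLinearMap _)]
    rfl
  have h2 : ∀ i, Integrable fun z => f (x - z) * heatKernelDeriv₂ s z (b i) (b i) := fun i =>
    (hi.apply_continuousLinearMap (b i)).apply_continuousLinearMap (b i)
  simp_rw [h1]
  rw [← integral_finsetSum _ fun i _ => h2 i]
  simp_rw [← Finset.mul_sum, sum_heatKernelDeriv₂ b hs]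
  rfl

lemma abs_heatOpTimeDeriv_le (hf : Continuous f) (hM : ∀ x, |f x| ≤ M)
    (hC : ∀ x y, |f x - f y| ≤ C * ‖x - y‖ ^ γ) (hC0 : 0 ≤ C)
    (hγ : 0 < γ) (hγ1 : γ ≤ 1) (hs : 0 < s) (x : E) :
    |heatOpTimeDeriv f s x| ≤ Module.finrank ℝ E * (C * heatConst E) * s ^ (γ / 2 - 1) := by
  set b := stdOrthonormalBasis ℝ E
  rw [← sum_heatOpDeriv₂ b hf hM hs x]
  have h1 : ∀ i, |heatOpDeriv₂ f s x (b i) (b i)| ≤ C * s ^ (γ / 2 - 1) * heatConst E := by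
    intro i
    have h2 := (heatOpDeriv₂ f s x).le_opNorm₂ (b i) (b i)
    rw [b.norm_eq_one, mul_one, mul_one] at h2
    exact h2.trans (norm_heatOpDeriv₂_le hf hM hC hC0 hγ hγ1 hs x)
  calc _ ≤ ∑ i, |heatOpDeriv₂ f s x (b i) (b i)| := Finset.abs_sum_le_sum_abs _ _
    _ ≤ ∑ _i : Fin (Module.finrank ℝ E), C * s ^ (γ / 2 - 1) * heatConst E :=
        Finset.sum_le_sum fun i _ => h1 i
    _ = _ := by simp; ring

end HeatSemigroup

section HeatResolvent

set_option maxSynthPendingDepth 3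

variable {E : Type*} [NormedAddCommGroup E] [InnerProductSpace ℝ E] [FiniteDimensional ℝ E]
  [MeasurableSpace E] [BorelSpace E] {f : E → ℝ} {M C γ s l : ℝ}

omit [FiniteDimensional ℝ E] [MeasurableSpace E] [BorelSpace E] in
lemma continuous_heatKernelTimeDeriv (s : ℝ) : Continuous (heatKernelTimeDeriv s : E → ℝ) := by
  have := continuous_heatKernel (E := E) s
  unfold heatKernelTimeDeriv
  fun_prop

omit [FiniteDimensional ℝ E] [MeasurableSpace E] [BorelSpace E] in
lemma abs_heatKernelTimeDeriv_le (hs : 0 < s) (z : E) :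
    |heatKernelTimeDeriv s z| ≤ s⁻¹ * ((1 + Module.finrank ℝ E) *
      (256 * heatFactor E s * Real.exp (-(8 * s)⁻¹ * ‖z‖ ^ 2))) := by
  have hK := heatKernel_pos hs z
  set u := ‖z‖ ^ 2 / s with hu
  have hu0 : 0 ≤ u := by positivity
  set d : ℝ := (Module.finrank ℝ E : ℝ)
  have hd : 0 ≤ d := Nat.cast_nonneg _
  have e : heatKernelTimeDeriv s z = heatKernel s z * (s⁻¹ * (u / 4 - d / 2)) := by
    rw [heatKernelTimeDeriv, hu]; field_simp; ring
  rw [e, abs_mul, abs_of_pos hK, abs_mul, abs_of_pos (inv_pos.mpr hs), mul_left_comm]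
  refine mul_le_mul_of_nonneg_left ?_ (inv_nonneg.mpr hs.le)
  refine le_trans ?_ (mul_le_mul_of_nonneg_left (heatKernel_mul_le hs z) (by positivity))
  rw [mul_left_comm]
  refine mul_le_mul_of_nonneg_left ?_ hK.le
  rw [abs_le]
  constructor <;> nlinarith [mul_nonneg hd hu0, mul_nonneg hd (sq_nonneg u), sq_nonneg u]

lemma hasDerivAt_heatOp (hf : Continuous f) (hM : ∀ x, |f x| ≤ M) (hs : 0 < s) (x : E) :
    HasDerivAt (fun s => heatOp f s x) (heatOpTimeDeriv f s x) s := by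
  have hM0 : 0 ≤ M := (abs_nonneg _).trans (hM 0)
  have hfac := heatFactor_pos (E := E) (half_pos hs)
  refine (hasDerivAt_integral_of_dominated_loc_of_deriv_le (μ := volume)
    (F' := fun s z => f (x - z) • heatKernelTimeDeriv s z) (s := Ioo (s / 2) (2 * s))
    (bound := fun z => M * ((s / 2)⁻¹ * ((1 + Module.finrank ℝ E) *
      (256 * heatFactor E (s / 2) * Real.exp (-(16 * s)⁻¹ * ‖z‖ ^ 2)))))
    (Ioo_mem_nhds (by linarith) (by linarith)) ?_ ?_ ?_ ?_ ?_ ?_).2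
  · refine Eventually.of_forall fun t => ?_
    have := continuous_heatKernel (E := E) t
    exact (by fun_prop : Continuous fun z => f (x - z) • heatKernel t z).aestronglyMeasurable
  · exact integrable_smul_heatKernel hf hM hs x
  · have := continuous_heatKernelTimeDeriv (E := E) s
    exact (by fun_prop : Continuous fun z => f (x - z) • heatKernelTimeDeriv s z).aestronglyMeasurable
  · refine ae_of_all _ fun z t ht => ?_
    have ht0 : 0 < t := by linarith [ht.1]
    have hft := (heatFactor_pos (E := E) ht0).le
    rw [norm_smul]
    refine mul_le_mul (hM _) ((abs_heatKernelTimeDeriv_le ht0 z).trans ?_) (norm_nonneg _) hM0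
    have h1 : t⁻¹ ≤ (s / 2)⁻¹ := inv_anti₀ (half_pos hs) ht.1.le
    have h2 : heatFactor E t ≤ heatFactor E (s / 2) :=
      heatFactor_antitoneOn (half_pos hs) ht0 ht.1.le
    have h3 : Real.exp (-(8 * t)⁻¹ * ‖z‖ ^ 2) ≤ Real.exp (-(16 * s)⁻¹ * ‖z‖ ^ 2) := by
      refine Real.exp_le_exp.mpr (mul_le_mul_of_nonneg_right (neg_le_neg ?_) (sq_nonneg _))
      exact inv_anti₀ (by positivity) (by linarith [ht.2])
    gcongr
  · exact ((((integrable_exp_neg_mul_sq_norm (by positivity)).const_mul _).const_mul _).const_mul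
      _).const_mul _
  · exact ae_of_all _ fun z t ht =>
      (hasDerivAt_heatKernel (by linarith [ht.1]) z).const_mul (f (x - z))

lemma stronglyMeasurable_integral_smul {F : Type*} [NormedAddCommGroup F] [NormedSpace ℝ F]
    {k : ℝ → E → F} (hk : StronglyMeasurable (Function.uncurry k)) (hf : Continuous f) (x : E) :
    StronglyMeasurable fun s => ∫ z, f (x - z) • k s z :=
  StronglyMeasurable.integral_prod_right (f := fun s z => f (x - z) • k s z)
    ((by fun_prop : Continuous fun w : ℝ × E => f (x - w.2)).stronglyMeasurable.smul hk)

omit [InnerProductSpace ℝ E] [FiniteDimensional ℝ E] [MeasurableSpace E] [BorelSpace E] in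
lemma measurable_heatFactor [InnerProductSpace ℝ E] : Measurable (heatFactor E) := by
  unfold heatFactor
  fun_prop

omit [FiniteDimensional ℝ E] in
lemma measurable_heatKernel : Measurable fun w : ℝ × E => heatKernel w.1 w.2 := by
  have := measurable_heatFactor (E := E)
  unfold heatKernel
  fun_prop

lemma stronglyMeasurable_heatKernelDeriv :
    StronglyMeasurable fun w : ℝ × E => heatKernelDeriv w.1 w.2 := by
  have := measurable_heatKernel (E := E)
  exact (by fun_prop : Measurable fun w : ℝ × E =>
    -(2 * w.1)⁻¹ * heatKernel w.1 w.2).stronglyMeasurable.smul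
    (by fun_prop : Continuous fun w : ℝ × E => innerCLM E w.2).stronglyMeasurable

lemma stronglyMeasurable_heatKernelDeriv₂ :
    StronglyMeasurable fun w : ℝ × E => heatKernelDeriv₂ w.1 w.2 := by
  have := measurable_heatKernel (E := E)
  have hm : Measurable fun w : ℝ × E => -(2 * w.1)⁻¹ * heatKernel w.1 w.2 := by fun_prop
  have hm2 : Measurable fun w : ℝ × E => -(2 * w.1)⁻¹ * (-(2 * w.1)⁻¹ * heatKernel w.1 w.2) := by
    fun_prop
  have hc : Continuous fun w : ℝ × E =>
      ContinuousLinearMap.smulRightL ℝ E (E →L[ℝ] ℝ) (innerCLM E w.2) (innerCLM E w.2) := by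
    fun_prop
  have h := (hm.stronglyMeasurable.smul_const (innerCLM E)).add
    (hm2.stronglyMeasurable.smul hc.stronglyMeasurable)
  convert h using 1
  funext w
  ext v u
  simp [heatKernelDeriv₂, heatKernelDeriv]
  ring

omit [FiniteDimensional ℝ E] in
lemma measurable_heatKernelTimeDeriv :
    Measurable fun w : ℝ × E => heatKernelTimeDeriv w.1 w.2 := by
  have := measurable_heatKernel (E := E)
  unfold heatKernelTimeDeriv
  fun_prop

lemma tendsto_heatOp_zero (hf : Continuous f) (hM : ∀ x, |f x| ≤ M)
    (hC : ∀ x y, |f x - f y| ≤ C * ‖x - y‖ ^ γ) (hC0 : 0 ≤ C)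
    (hγ : 0 < γ) (hγ1 : γ ≤ 1) (x : E) :
    Tendsto (fun s => heatOp f s x) (𝓝[>] 0) (𝓝 (f x)) := by
  rw [tendsto_iff_norm_sub_tendsto_zero]
  have h0 : Tendsto (fun s : ℝ => C * s ^ (γ / 2) * heatConst E) (𝓝[>] 0) (𝓝 0) := by
    have h1 : Tendsto (fun s : ℝ => C * s ^ (γ / 2) * heatConst E) (𝓝 0)
        (𝓝 (C * 0 ^ (γ / 2) * heatConst E)) :=
      ((Real.continuousAt_rpow_const 0 (γ / 2) (Or.inr (by positivity))).tendsto.const_mul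
        C).mul_const _
    rw [Real.zero_rpow (by positivity), mul_zero, zero_mul] at h1
    exact h1.mono_left nhdsWithin_le_nhds
  refine tendsto_of_tendsto_of_tendsto_of_le_of_le' tendsto_const_nhds h0
    (Eventually.of_forall fun _ => norm_nonneg _) ?_
  filter_upwards [self_mem_nhdsWithin] with s hs
  exact abs_heatOp_sub_le hf hM hC hC0 hγ hγ1 hs x

lemma integrableOn_rpow_mul_exp (hγ : 0 < γ) (hl : 0 < l) :
    IntegrableOn (fun s : ℝ => s ^ (γ / 2 - 1) * Real.exp (-l * s)) (Ioi 0) := by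
  simpa using integrableOn_rpow_mul_exp_neg_mul_rpow (p := 1) (s := γ / 2 - 1) (b := l)
    (by linarith) one_pos hl

lemma integrableOn_Ioc_heatOpTimeDeriv (hf : Continuous f) (hM : ∀ x, |f x| ≤ M)
    (hC : ∀ x y, |f x - f y| ≤ C * ‖x - y‖ ^ γ) (hC0 : 0 ≤ C)
    (hγ : 0 < γ) (hγ1 : γ ≤ 1) (s : ℝ) (x : E) :
    IntegrableOn (fun s => heatOpTimeDeriv f s x) (Ioc 0 s) := by
  rcases le_or_gt s 0 with hs | hs
  · simp [Ioc_eq_empty (not_lt.mpr hs)]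
  refine Integrable.mono' (g := fun s => Module.finrank ℝ E * (C * heatConst E) * s ^ (γ / 2 - 1))
    ?_ (stronglyMeasurable_integral_smul measurable_heatKernelTimeDeriv.stronglyMeasurable hf
      x).aestronglyMeasurable ?_
  · refine Integrable.const_mul ?_ _
    exact (intervalIntegrable_iff_integrableOn_Ioc_of_le hs.le).mp
      (intervalIntegral.intervalIntegrable_rpow' (by linarith))
  · filter_upwards [ae_restrict_mem measurableSet_Ioc] with r hr
    exact abs_heatOpTimeDeriv_le hf hM hC hC0 hγ hγ1 hr.1 x

lemma heatOp_eq_add_integral (hf : Continuous f) (hM : ∀ x, |f x| ≤ M)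
    (hC : ∀ x y, |f x - f y| ≤ C * ‖x - y‖ ^ γ) (hC0 : 0 ≤ C)
    (hγ : 0 < γ) (hγ1 : γ ≤ 1) (hs : 0 < s) (x : E) :
    heatOp f s x = f x + ∫ r in Ioc 0 s, heatOpTimeDeriv f r x := by
  rw [← intervalIntegral.integral_of_le hs.le,
    intervalIntegral.integral_eq_sub_of_hasDerivAt_of_tendsto hs
      (fun r hr => hasDerivAt_heatOp hf hM hr.1 x)
      ((intervalIntegrable_iff_integrableOn_Ioc_of_le hs.le).mpr
        (integrableOn_Ioc_heatOpTimeDeriv hf hM hC hC0 hγ hγ1 s x))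
      (tendsto_heatOp_zero hf hM hC hC0 hγ hγ1 x)
      ((hasDerivAt_heatOp hf hM hs x).continuousAt.tendsto.mono_left nhdsWithin_le_nhds)]
  ring

/-- The resolvent of the heat semigroup. -/
noncomputable def heatResolvent (f : E → ℝ) (l : ℝ) (x : E) : ℝ :=
  ∫ s in Ioi 0, Real.exp (-l * s) • heatOp f s x

/-- The spatial derivative of `heatResolvent`. -/
noncomputable def heatResolventDeriv (f : E → ℝ) (l : ℝ) (x : E) : E →L[ℝ] ℝ :=
  ∫ s in Ioi 0, Real.exp (-l * s) • heatOpDeriv f s x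

/-- The second spatial derivative of `heatResolvent`. -/
noncomputable def heatResolventDeriv₂ (f : E → ℝ) (l : ℝ) (x : E) : E →L[ℝ] E →L[ℝ] ℝ :=
  ∫ s in Ioi 0, Real.exp (-l * s) • heatOpDeriv₂ f s x

lemma integrableOn_heatOp (hf : Continuous f) (hM : ∀ x, |f x| ≤ M) (hl : 0 < l) (x : E) :
    IntegrableOn (fun s => Real.exp (-l * s) • heatOp f s x) (Ioi 0) := by
  refine Integrable.mono' ((integrableOn_exp_mul_Ioi (neg_neg_of_pos hl) 0).mul_const M)
    ((by fun_prop : Continuous fun s => Real.exp (-l * s)).stronglyMeasurable.smul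
      (stronglyMeasurable_integral_smul measurable_heatKernel.stronglyMeasurable hf
      x)).aestronglyMeasurable ?_
  filter_upwards [ae_restrict_mem measurableSet_Ioi] with s hs
  rw [norm_smul, Real.norm_of_nonneg (Real.exp_nonneg _)]
  exact mul_le_mul_of_nonneg_left (abs_heatOp_le hM hs x) (Real.exp_nonneg _)

lemma hasFDerivAt_heatResolvent (hf : Continuous f) (hM : ∀ x, |f x| ≤ M) (hl : 0 < l) (x : E) :
    HasFDerivAt (heatResolvent f l) (heatResolventDeriv f l x) x := by
  refine hasFDerivAt_integral_of_dominated_of_fderiv_le (s := univ)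
    (F' := fun y s => Real.exp (-l * s) • heatOpDeriv f s y)
    (bound := fun s => M * heatConst E * (s ^ ((1 : ℝ) / 2 - 1) * Real.exp (-l * s)))
    univ_mem ?_ (integrableOn_heatOp hf hM hl x) ?_ ?_
    ((integrableOn_rpow_mul_exp one_pos hl).const_mul _) ?_
  · exact Eventually.of_forall fun y => (integrableOn_heatOp hf hM hl y).aestronglyMeasurable
  · exact ((by fun_prop : Continuous fun s => Real.exp (-l * s)).stronglyMeasurable.smul
      (stronglyMeasurable_integral_smul stronglyMeasurable_heatKernelDeriv hf
      x)).aestronglyMeasurable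
  · filter_upwards [ae_restrict_mem measurableSet_Ioi] with s hs y _
    have hs : 0 < s := hs
    rw [norm_smul, Real.norm_of_nonneg (Real.exp_nonneg _)]
    have e : s ^ ((1 : ℝ) / 2 - 1) = (Real.sqrt s)⁻¹ := by
      rw [Real.sqrt_eq_rpow, ← Real.rpow_neg hs.le]; norm_num
    rw [e]
    refine (mul_le_mul_of_nonneg_left (norm_heatOpDeriv_le hM hs y) (Real.exp_nonneg _)).trans
      (le_of_eq ?_)
    ring
  · filter_upwards [ae_restrict_mem measurableSet_Ioi] with s hs y _
    exact (hasFDerivAt_heatOp hf hM hs y).const_smul (Real.exp (-l * s))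

lemma norm_exp_smul_heatOpDeriv₂_le (hf : Continuous f) (hM : ∀ x, |f x| ≤ M)
    (hC : ∀ x y, |f x - f y| ≤ C * ‖x - y‖ ^ γ) (hC0 : 0 ≤ C)
    (hγ : 0 < γ) (hγ1 : γ ≤ 1) (hs : 0 < s) (x : E) :
    ‖Real.exp (-l * s) • heatOpDeriv₂ f s x‖ ≤
      C * heatConst E * (s ^ (γ / 2 - 1) * Real.exp (-l * s)) := by
  refine (norm_smul_le _ _).trans ?_
  rw [Real.norm_of_nonneg (Real.exp_nonneg _)]
  refine (mul_le_mul_of_nonneg_left (norm_heatOpDeriv₂_le hf hM hC hC0 hγ hγ1 hs x)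
    (Real.exp_nonneg _)).trans (le_of_eq ?_)
  ring

lemma aestronglyMeasurable_heatOpDeriv₂ (hf : Continuous f) (x : E) :
    AEStronglyMeasurable (fun s => Real.exp (-l * s) • heatOpDeriv₂ f s x)
      (volume.restrict (Ioi 0)) :=
  ((by fun_prop : Continuous fun s => Real.exp (-l * s)).stronglyMeasurable.smul
    (stronglyMeasurable_integral_smul stronglyMeasurable_heatKernelDeriv₂ hf
      x)).aestronglyMeasurable

lemma integrableOn_heatOpDeriv₂ (hf : Continuous f) (hM : ∀ x, |f x| ≤ M)
    (hC : ∀ x y, |f x - f y| ≤ C * ‖x - y‖ ^ γ) (hC0 : 0 ≤ C)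
    (hγ : 0 < γ) (hγ1 : γ ≤ 1) (hl : 0 < l) (x : E) :
    IntegrableOn (fun s => Real.exp (-l * s) • heatOpDeriv₂ f s x) (Ioi 0) := by
  refine Integrable.mono' ((integrableOn_rpow_mul_exp hγ hl).const_mul (C * heatConst E))
    (aestronglyMeasurable_heatOpDeriv₂ hf x) ?_
  filter_upwards [ae_restrict_mem measurableSet_Ioi] with s hs
  exact norm_exp_smul_heatOpDeriv₂_le hf hM hC hC0 hγ hγ1 hs x

lemma integrableOn_heatOpDeriv (hf : Continuous f) (hM : ∀ x, |f x| ≤ M) (hl : 0 < l) (x : E) :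
    IntegrableOn (fun s => Real.exp (-l * s) • heatOpDeriv f s x) (Ioi 0) := by
  refine Integrable.mono' ((integrableOn_rpow_mul_exp one_pos hl).const_mul (M * heatConst E))
    ((by fun_prop : Continuous fun s => Real.exp (-l * s)).stronglyMeasurable.smul
      (stronglyMeasurable_integral_smul stronglyMeasurable_heatKernelDeriv hf
      x)).aestronglyMeasurable ?_
  filter_upwards [ae_restrict_mem measurableSet_Ioi] with s hs
  have hs : 0 < s := hs
  rw [norm_smul, Real.norm_of_nonneg (Real.exp_nonneg _)]
  have e : s ^ ((1 : ℝ) / 2 - 1) = (Real.sqrt s)⁻¹ := by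
    rw [Real.sqrt_eq_rpow, ← Real.rpow_neg hs.le]; norm_num
  rw [e]
  refine (mul_le_mul_of_nonneg_left (norm_heatOpDeriv_le hM hs x) (Real.exp_nonneg _)).trans
    (le_of_eq ?_)
  ring

lemma hasFDerivAt_heatResolventDeriv (hf : Continuous f) (hM : ∀ x, |f x| ≤ M)
    (hC : ∀ x y, |f x - f y| ≤ C * ‖x - y‖ ^ γ) (hC0 : 0 ≤ C)
    (hγ : 0 < γ) (hγ1 : γ ≤ 1) (hl : 0 < l) (x : E) :
    HasFDerivAt (heatResolventDeriv f l) (heatResolventDeriv₂ f l x) x := by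
  refine hasFDerivAt_integral_of_dominated_of_fderiv_le (s := univ)
    (F' := fun y s => Real.exp (-l * s) • heatOpDeriv₂ f s y)
    (bound := fun s => C * heatConst E * (s ^ (γ / 2 - 1) * Real.exp (-l * s)))
    univ_mem ?_ (integrableOn_heatOpDeriv hf hM hl x) (aestronglyMeasurable_heatOpDeriv₂ hf x) ?_
    ((integrableOn_rpow_mul_exp hγ hl).const_mul _) ?_
  · exact Eventually.of_forall fun y => (integrableOn_heatOpDeriv hf hM hl y).aestronglyMeasurable
  · filter_upwards [ae_restrict_mem measurableSet_Ioi] with s hs y _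
    exact norm_exp_smul_heatOpDeriv₂_le hf hM hC hC0 hγ hγ1 hs y
  · filter_upwards [ae_restrict_mem measurableSet_Ioi] with s hs y _
    exact (hasFDerivAt_heatOpDeriv hf hM hs y).const_smul (Real.exp (-l * s))

lemma continuous_heatOpDeriv₂ (hf : Continuous f) (hM : ∀ x, |f x| ≤ M) (hs : 0 < s) :
    Continuous (heatOpDeriv₂ f s) := by
  refine continuous_of_dominated
    (bound := fun z => M * (s⁻¹ * (256 * heatFactor E s) * Real.exp (-(8 * s)⁻¹ * ‖z‖ ^ 2)))
    (fun x => (integrable_smul_heatKernelDeriv₂ hf hM hs x).aestronglyMeasurable) ?_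
    (((integrable_exp_neg_mul_sq_norm (by positivity)).const_mul _).const_mul _) ?_
  · refine fun x => ae_of_all _ fun z => ?_
    refine (norm_smul_le _ _).trans ?_
    exact mul_le_mul (hM _) (norm_heatKernelDeriv₂_le_exp hs z) (norm_nonneg _)
      ((abs_nonneg _).trans (hM 0))
  · refine ae_of_all _ fun z => ?_
    exact (by fun_prop : Continuous fun x => f (x - z)).smul continuous_const

lemma continuous_heatResolventDeriv₂ (hf : Continuous f) (hM : ∀ x, |f x| ≤ M)
    (hC : ∀ x y, |f x - f y| ≤ C * ‖x - y‖ ^ γ) (hC0 : 0 ≤ C)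
    (hγ : 0 < γ) (hγ1 : γ ≤ 1) (hl : 0 < l) : Continuous (heatResolventDeriv₂ f l) := by
  refine continuous_of_dominated
    (bound := fun s => C * heatConst E * (s ^ (γ / 2 - 1) * Real.exp (-l * s)))
    (fun x => aestronglyMeasurable_heatOpDeriv₂ hf x) ?_
    ((integrableOn_rpow_mul_exp hγ hl).const_mul _) ?_
  · intro x
    filter_upwards [ae_restrict_mem measurableSet_Ioi] with s hs
    exact norm_exp_smul_heatOpDeriv₂_le hf hM hC hC0 hγ hγ1 hs x
  · filter_upwards [ae_restrict_mem measurableSet_Ioi] with s hs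
    exact (continuous_heatOpDeriv₂ hf hM hs).const_smul (Real.exp (-l * s))

lemma integrableOn_exp_mul_heatOpTimeDeriv (hf : Continuous f) (hM : ∀ x, |f x| ≤ M)
    (hC : ∀ x y, |f x - f y| ≤ C * ‖x - y‖ ^ γ) (hC0 : 0 ≤ C)
    (hγ : 0 < γ) (hγ1 : γ ≤ 1) (hl : 0 < l) (x : E) :
    IntegrableOn (fun s => Real.exp (-l * s) * heatOpTimeDeriv f s x) (Ioi 0) := by
  refine Integrable.mono' ((integrableOn_rpow_mul_exp hγ hl).const_mul
    (Module.finrank ℝ E * (C * heatConst E)))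
    ((by fun_prop : Continuous fun s => Real.exp (-l * s)).stronglyMeasurable.mul
      (stronglyMeasurable_integral_smul measurable_heatKernelTimeDeriv.stronglyMeasurable hf
      x)).aestronglyMeasurable ?_
  filter_upwards [ae_restrict_mem measurableSet_Ioi] with s hs
  rw [norm_mul, Real.norm_of_nonneg (Real.exp_nonneg _)]
  refine (mul_le_mul_of_nonneg_left (abs_heatOpTimeDeriv_le hf hM hC hC0 hγ hγ1 hs x)
    (Real.exp_nonneg _)).trans (le_of_eq ?_)
  ring

lemma integral_exp_mul_heatOpTimeDeriv (hf : Continuous f) (hM : ∀ x, |f x| ≤ M)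
    (hC : ∀ x y, |f x - f y| ≤ C * ‖x - y‖ ^ γ) (hC0 : 0 ≤ C)
    (hγ : 0 < γ) (hγ1 : γ ≤ 1) (hl : 0 < l) (x : E) :
    ∫ s in Ioi 0, Real.exp (-l * s) * heatOpTimeDeriv f s x = l * heatResolvent f l x - f x := by
  have hi1 := integrableOn_exp_mul_heatOpTimeDeriv hf hM hC hC0 hγ hγ1 hl x
  have hi2 := integrableOn_heatOp hf hM hl x
  have hi3 : IntegrableOn (fun s => (Real.exp (-l * s) * -l) * heatOp f s x) (Ioi 0) := by
    refine (hi2.const_mul (-l)).congr (ae_of_all _ fun s => ?_)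
    simp only [smul_eq_mul]; ring
  have hu : ∀ s ∈ Ioi (0 : ℝ), HasDerivAt (fun s => Real.exp (-l * s)) (Real.exp (-l * s) * -l) s := by
    intro s _
    simpa using ((hasDerivAt_id s).const_mul (-l)).exp
  have hz : Tendsto (fun s => Real.exp (-l * s)) (𝓝[>] 0) (𝓝 1) := by
    have := (by fun_prop : Continuous fun s => Real.exp (-l * s)).tendsto 0
    rw [mul_zero, Real.exp_zero] at this
    exact this.mono_left nhdsWithin_le_nhds
  have hinf : Tendsto (fun s => Real.exp (-l * s)) atTop (𝓝 0) :=
    Real.tendsto_exp_atBot.comp (tendsto_id.const_mul_atTop_of_neg (neg_neg_of_pos hl))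
  have hinf2 : Tendsto (fun s => Real.exp (-l * s) * heatOp f s x) atTop (𝓝 0) := by
    have hb : IsBoundedUnder (· ≤ ·) atTop (norm ∘ fun s => heatOp f s x) := by
      refine ⟨M, ?_⟩
      rw [eventually_map]
      filter_upwards [eventually_gt_atTop 0] with s hs
      exact abs_heatOp_le hM hs x
    exact hinf.zero_mul_isBoundedUnder_le hb
  have h := integral_Ioi_deriv_mul_eq_sub (u := fun s => Real.exp (-l * s))
    (v := fun s => heatOp f s x) (a' := 1 * f x) (b' := 0) hu
    (fun s hs => hasDerivAt_heatOp hf hM hs x) (hi3.add hi1)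
    (hz.mul (tendsto_heatOp_zero hf hM hC hC0 hγ hγ1 x)) hinf2
  rw [integral_add hi3 hi1] at h
  have e : ∫ s in Ioi 0, (Real.exp (-l * s) * -l) * heatOp f s x = -l * heatResolvent f l x := by
    rw [heatResolvent, ← integral_const_mul]
    refine integral_congr_ae (ae_of_all _ fun s => ?_)
    simp only [smul_eq_mul]; ring
  rw [e] at h
  linarith

lemma contDiff_heatResolvent (hf : Continuous f) (hM : ∀ x, |f x| ≤ M)
    (hC : ∀ x y, |f x - f y| ≤ C * ‖x - y‖ ^ γ) (hC0 : 0 ≤ C)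
    (hγ : 0 < γ) (hγ1 : γ ≤ 1) (hl : 0 < l) : ContDiff ℝ 2 (heatResolvent f l) := by
  have h1 : ContDiff ℝ 1 (heatResolventDeriv f l) :=
    contDiff_one_iff_hasFDerivAt.mpr ⟨heatResolventDeriv₂ f l,
      continuous_heatResolventDeriv₂ hf hM hC hC0 hγ hγ1 hl,
      hasFDerivAt_heatResolventDeriv hf hM hC hC0 hγ hγ1 hl⟩
  exact (contDiff_succ_iff_hasFDerivAt (n := 1)).mpr
    ⟨heatResolventDeriv f l, h1, hasFDerivAt_heatResolvent hf hM hl⟩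

lemma sum_iteratedFDeriv_two_heatResolvent {ι : Type*} [Fintype ι] (b : OrthonormalBasis ι ℝ E)
    (hf : Continuous f) (hM : ∀ x, |f x| ≤ M)
    (hC : ∀ x y, |f x - f y| ≤ C * ‖x - y‖ ^ γ) (hC0 : 0 ≤ C)
    (hγ : 0 < γ) (hγ1 : γ ≤ 1) (hl : 0 < l) (x : E) :
    ∑ i, iteratedFDeriv ℝ 2 (heatResolvent f l) x ![b i, b i] = l * heatResolvent f l x - f x := by
  have h1 : fderiv ℝ (heatResolvent f l) = heatResolventDeriv f l :=
    funext fun y => (hasFDerivAt_heatResolvent hf hM hl y).fderiv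
  have h2 : ∀ i, iteratedFDeriv ℝ 2 (heatResolvent f l) x ![b i, b i] =
      ∫ s in Ioi 0, Real.exp (-l * s) * heatOpDeriv₂ f s x (b i) (b i) := by
    intro i
    have hi := integrableOn_heatOpDeriv₂ hf hM hC hC0 hγ hγ1 hl x
    rw [iteratedFDeriv_two_apply, h1,
      (hasFDerivAt_heatResolventDeriv hf hM hC hC0 hγ hγ1 hl x).fderiv]
    simp only [Matrix.cons_val_zero, Matrix.cons_val_one]
    rw [heatResolventDeriv₂, ContinuousLinearMap.integral_apply hi,
      ContinuousLinearMap.integral_apply (hi.apply_continuousLinearMap _)]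
    rfl
  have hi : ∀ i, IntegrableOn
      (fun s => Real.exp (-l * s) * heatOpDeriv₂ f s x (b i) (b i)) (Ioi 0) := fun i =>
    ((integrableOn_heatOpDeriv₂ hf hM hC hC0 hγ hγ1 hl x).apply_continuousLinearMap
      (b i)).apply_continuousLinearMap (b i)
  simp_rw [h2]
  rw [← integral_finsetSum _ fun i _ => hi i,
    ← integral_exp_mul_heatOpTimeDeriv hf hM hC hC0 hγ hγ1 hl x]
  refine setIntegral_congr_fun measurableSet_Ioi fun s hs => ?_
  simp only [← Finset.mul_sum]
  rw [sum_heatOpDeriv₂ b hf hM hs]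

end HeatResolvent

section SubordinatedKernel

variable {E : Type*} [NormedAddCommGroup E] [InnerProductSpace ℝ E]
  [MeasurableSpace E] [BorelSpace E] {ν : Measure ℝ} {f : E → ℝ} {M : ℝ}

/-- The mixture of heat kernels with mixing law `ν`. -/
noncomputable def subordinatedKernel (ν : Measure ℝ) (x : E) : ℝ :=
  ∫ s, heatKernel s x ∂ν

lemma ae_pos_of_measure_Iic_zero (hν : ν (Iic 0) = 0) : ∀ᵐ s ∂ν, 0 < s := by
  rw [ae_iff]
  simp only [not_lt]
  exact hν

omit [MeasurableSpace E] [BorelSpace E] in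
lemma subordinatedKernel_nonneg (hν : ν (Iic 0) = 0) (x : E) : 0 ≤ subordinatedKernel ν x :=
  integral_nonneg_of_ae <| (ae_pos_of_measure_Iic_zero hν).mono fun _ hs => (heatKernel_pos hs x).le

omit [MeasurableSpace E] [BorelSpace E] in
lemma exists_heatFactor_mul_exp_le {r : ℝ} (hr : 0 < r) :
    ∃ C, ∀ s, 0 < s → heatFactor E s * Real.exp (-r * (4 * s)⁻¹) ≤ C := by
  set d := Module.finrank ℝ E
  refine ⟨(Real.pi * r) ^ (-(d / 2 : ℝ)) * (1 + d.factorial), fun s hs => ?_⟩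
  set y := r * (4 * s)⁻¹ with hy
  have hy0 : 0 < y := by positivity
  have e1 : 4 * Real.pi * s = (Real.pi * r) * y⁻¹ := by rw [hy]; field_simp
  have e2 : heatFactor E s = (Real.pi * r) ^ (-(d / 2 : ℝ)) * y ^ (d / 2 : ℝ) := by
    rw [heatFactor, e1, Real.mul_rpow (by positivity) (by positivity), Real.inv_rpow hy0.le,
      Real.rpow_neg hy0.le, inv_inv]
  have h1 : y ^ (d / 2 : ℝ) ≤ 1 + y ^ d := by
    rcases le_total y 1 with h | h
    · exact (Real.rpow_le_one hy0.le h (by positivity)).trans (by simp; positivity)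
    · rw [← Real.rpow_natCast y d]
      refine (Real.rpow_le_rpow_of_exponent_le h (half_le_self (Nat.cast_nonneg _))).trans ?_
      linarith
  have h2 : y ^ d ≤ d.factorial * Real.exp y := by
    have := Real.pow_div_factorial_le_exp y hy0.le d
    rwa [div_le_iff₀ (by positivity), mul_comm] at this
  have h3 : (1 : ℝ) ≤ Real.exp y := Real.one_le_exp hy0.le
  rw [e2, neg_mul, ← hy, mul_assoc, Real.exp_neg]
  refine mul_le_mul_of_nonneg_left ?_ (by positivity)
  rw [← div_eq_mul_inv, div_le_iff₀ (Real.exp_pos _)]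
  nlinarith

omit [MeasurableSpace E] [BorelSpace E] in
lemma exists_heatKernel_le {x : E} (hx : x ≠ 0) :
    ∃ C, ∀ s, 0 < s → heatKernel s x ≤ C := by
  obtain ⟨C, hC⟩ := exists_heatFactor_mul_exp_le (E := E)
    (show 0 < ‖x‖ ^ 2 by have := norm_pos_iff.mpr hx; positivity)
  refine ⟨C, fun s hs => le_trans (le_of_eq ?_) (hC s hs)⟩
  rw [heatKernel]
  ring_nf

lemma integrableOn_subordinatedKernel {ν : ℝ → Measure ℝ} (hm : Measurable ν)
    [∀ t, IsProbabilityMeasure (ν t)] (hν : ∀ t, 0 < t → ν t (Iic 0) = 0) {x : E} (hx : x ≠ 0)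
    (T : ℝ) : IntegrableOn (fun t => subordinatedKernel (ν t) x) (Ioc 0 T) := by
  obtain ⟨C, hC⟩ := exists_heatKernel_le hx
  have hs : StronglyMeasurable fun t => subordinatedKernel (ν t) x :=
    StronglyMeasurable.integral_kernel (κ := ⟨ν, hm⟩) (f := fun s => heatKernel s x)
      (measurable_heatKernel.comp (measurable_id.prodMk measurable_const)).stronglyMeasurable
  refine Integrable.mono' (g := fun _ => C) (integrable_const _) hs.aestronglyMeasurable ?_
  filter_upwards [ae_restrict_mem measurableSet_Ioc] with t ht
  refine (norm_integral_le_of_norm_le (integrable_const C) ?_).trans (by simp)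
  filter_upwards [ae_pos_of_measure_Iic_zero (hν t ht.1)] with s hs
  rw [Real.norm_of_nonneg (heatKernel_pos hs x).le]
  exact hC s hs

omit [MeasurableSpace E] [BorelSpace E] in
lemma contDiffOn_subordinatedKernel [IsProbabilityMeasure ν] (hν : ν (Iic 0) = 0) :
    ContDiffOn ℝ (⊤ : ℕ∞) (subordinatedKernel ν : E → ℝ) {x | x ≠ 0} := by
  have hmf : Measurable (heatFactor E) := measurable_heatFactor
  set ρ := ν.withDensity fun s => ENNReal.ofReal (heatFactor E s) with hρ
  have hlt : ∀ᵐ s ∂ν, ENNReal.ofReal (heatFactor E s) < ∞ := ae_of_all _ fun _ => ENNReal.ofReal_lt_top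
  have hset : Iio 0 ⊆ ProbabilityTheory.integrableExpSet (fun s : ℝ => (4 * s)⁻¹) ρ := by
    intro r hr
    obtain ⟨C, hC⟩ := exists_heatFactor_mul_exp_le (E := E) (neg_pos.mpr hr)
    rw [ProbabilityTheory.integrableExpSet, mem_ofPred_eq, hρ,
      integrable_withDensity_iff_integrable_smul' hmf.ennreal_ofReal hlt]
    refine Integrable.mono' (g := fun _ => C) (integrable_const _)
      (by fun_prop : Measurable _).aestronglyMeasurable ?_
    filter_upwards [ae_pos_of_measure_Iic_zero hν] with s hs
    have := heatFactor_pos (E := E) hs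
    rw [ENNReal.toReal_ofReal this.le, norm_smul, Real.norm_of_nonneg this.le,
      Real.norm_of_nonneg (Real.exp_nonneg _)]
    simpa using hC s hs
  have e : (subordinatedKernel ν : E → ℝ) =
      fun x => ProbabilityTheory.mgf (fun s : ℝ => (4 * s)⁻¹) ρ (-‖x‖ ^ 2) := by
    funext x
    rw [subordinatedKernel, ProbabilityTheory.mgf, hρ,
      integral_withDensity_eq_integral_toReal_smul hmf.ennreal_ofReal hlt]
    refine integral_congr_ae ((ae_pos_of_measure_Iic_zero hν).mono fun s hs => ?_)
    simp only [ENNReal.toReal_ofReal (heatFactor_pos (E := E) hs).le, heatKernel, smul_eq_mul]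
    ring_nf
  rw [e]
  intro x hx
  have hx' : -‖x‖ ^ 2 < 0 := by
    have := norm_pos_iff.mpr hx
    have : 0 < ‖x‖ ^ 2 := by positivity
    linarith
  have h1 := (ProbabilityTheory.analyticAt_mgf (interior_mono hset
    (by rwa [interior_Iio] : -‖x‖ ^ 2 ∈ interior (Iio (0 : ℝ))))).contDiffAt (n := (⊤ : ℕ∞))
  exact (h1.comp x (contDiff_norm_sq ℝ).neg.contDiffAt).contDiffWithinAt

variable [FiniteDimensional ℝ E]

lemma integrable_prod_heatKernel_mul [IsProbabilityMeasure ν] (hν : ν (Iic 0) = 0)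
    (hf : Continuous f) (hM : ∀ x, |f x| ≤ M) (x : E) :
    Integrable (fun w : ℝ × E => heatKernel w.1 (x - w.2) * f w.2) (ν.prod volume) := by
  have hmk := measurable_heatKernel (E := E)
  have hmeas : Measurable fun w : ℝ × E => heatKernel w.1 (x - w.2) :=
    hmk.comp (by fun_prop : Measurable fun w : ℝ × E => (w.1, x - w.2))
  have hi : Integrable (fun w : ℝ × E => heatKernel w.1 (x - w.2)) (ν.prod volume) := by
    rw [integrable_prod_iff hmeas.aestronglyMeasurable]
    refine ⟨(ae_pos_of_measure_Iic_zero hν).mono fun s hs =>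
      (integrable_heatKernel hs).comp_sub_left x, ?_⟩
    refine (integrable_const (1 : ℝ)).congr ((ae_pos_of_measure_Iic_zero hν).mono fun s hs => ?_)
    simp only [Real.norm_of_nonneg (heatKernel_pos hs _).le]
    rw [integral_sub_left_eq_self (heatKernel s) volume x, integral_heatKernel hs]
  refine hi.mul_bdd (c := M) ?_ (ae_of_all _ fun w => hM w.2)
  exact (by fun_prop : Continuous fun w : ℝ × E => f w.2).aestronglyMeasurable

lemma integrable_subordinatedKernel_mul [IsProbabilityMeasure ν] (hν : ν (Iic 0) = 0)
    (hf : Continuous f) (hM : ∀ x, |f x| ≤ M) (x : E) :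
    Integrable fun ξ => subordinatedKernel ν (x - ξ) * f ξ := by
  refine (integrable_prod_heatKernel_mul hν hf hM x).integral_prod_right.congr
    (ae_of_all _ fun ξ => ?_)
  exact integral_mul_const (μ := ν) (f ξ) fun s => heatKernel s (x - ξ)

lemma integral_subordinatedKernel_mul [IsProbabilityMeasure ν] (hν : ν (Iic 0) = 0)
    (hf : Continuous f) (hM : ∀ x, |f x| ≤ M) (x : E) :
    ∫ ξ, subordinatedKernel ν (x - ξ) * f ξ = ∫ s, heatOp f s x ∂ν := by
  have h := integral_integral_swap (f := fun s ξ => heatKernel s (x - ξ) * f ξ)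
    (integrable_prod_heatKernel_mul hν hf hM x)
  simp only [integral_mul_const] at h
  refine Eq.trans h.symm (integral_congr_ae (ae_of_all _ fun s => ?_))
  simp only [mul_comm _ (f _)]
  exact (integral_sub_smul f (heatKernel s) x).symm

lemma integrable_subordinatedKernel [IsProbabilityMeasure ν] (hν : ν (Iic 0) = 0) :
    Integrable (subordinatedKernel ν : E → ℝ) := by
  have h := (integrable_subordinatedKernel_mul (E := E) (f := fun _ => 1) (M := 1) hν
    continuous_const (by simp) 0).comp_neg
  simpa using h

lemma integral_subordinatedKernel [IsProbabilityMeasure ν] (hν : ν (Iic 0) = 0) :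
    ∫ x : E, subordinatedKernel ν x = 1 := by
  have h := integral_subordinatedKernel_mul (E := E) (f := fun _ => 1) (M := 1) hν
    continuous_const (by simp) 0
  simp only [zero_sub, mul_one, integral_neg_eq_self (subordinatedKernel ν : E → ℝ)] at h
  rw [h, integral_congr_ae (g := fun _ => (1 : ℝ))]
  · simp
  · filter_upwards [ae_pos_of_measure_Iic_zero hν] with s hs
    simp [heatOp, integral_heatKernel hs]

end SubordinatedKernel

section SubordinatedHeat

variable {E : Type*} [NormedAddCommGroup E] [InnerProductSpace ℝ E] [FiniteDimensional ℝ E]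
  [MeasurableSpace E] [BorelSpace E] {f : E → ℝ} {M C γ : ℝ} {H : ℝ → ℝ → ℝ} {φ : ℝ → ℝ}

/-- The time-changed heat semigroup applied to `f`, written in terms of the distribution functions
of the random time. -/
noncomputable def subordinatedHeat (H : ℝ → ℝ → ℝ) (f : E → ℝ) (t : ℝ) (x : E) : ℝ :=
  f x + ∫ s in Ioi 0, heatOpTimeDeriv f s x * H s t

lemma stronglyMeasurable_heatOpTimeDeriv (hf : Continuous f) (x : E) :
    StronglyMeasurable fun s => heatOpTimeDeriv f s x :=
  stronglyMeasurable_integral_smul measurable_heatKernelTimeDeriv.stronglyMeasurable hf x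

lemma integrableOn_heatOpTimeDeriv_mul (h : IsSubordinatorCdf H φ) (hf : Continuous f)
    (hM : ∀ x, |f x| ≤ M) (hC : ∀ x y, |f x - f y| ≤ C * ‖x - y‖ ^ γ) (hC0 : 0 ≤ C)
    (hγ : 0 < γ) (hγ1 : γ ≤ 1) (t : ℝ) (x : E) :
    IntegrableOn (fun s => heatOpTimeDeriv f s x * H s t) (Ioi 0) := by
  refine Integrable.mono' ((integrableOn_exp_mul_heatOpTimeDeriv hf hM hC hC0 hγ hγ1
    (h.exponent_pos 1 one_pos) x).norm.const_mul (Real.exp (1 * t)))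
    ((stronglyMeasurable_heatOpTimeDeriv hf x).mul
      (h.antitone t).measurable.stronglyMeasurable).aestronglyMeasurable ?_
  filter_upwards [ae_restrict_mem measurableSet_Ioi] with s hs
  rw [norm_mul, norm_mul, Real.norm_of_nonneg (h.nonneg s t), Real.norm_of_nonneg (Real.exp_nonneg _)]
  refine (mul_le_mul_of_nonneg_left (h.le_exp hs one_pos t) (norm_nonneg _)).trans (le_of_eq ?_)
  rw [show -φ 1 * s = -s * φ 1 by ring]
  ring

lemma integral_heatOp_eq_subordinatedHeat (h : IsSubordinatorCdf H φ) {ν : Measure ℝ}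
    [IsProbabilityMeasure ν] (hν : ν (Iic 0) = 0) {t : ℝ}
    (hH : ∀ᵐ s ∂volume.restrict (Ioi 0), ν.real (Ioi s) = H s t) (hf : Continuous f)
    (hM : ∀ x, |f x| ≤ M) (hC : ∀ x y, |f x - f y| ≤ C * ‖x - y‖ ^ γ) (hC0 : 0 ≤ C)
    (hγ : 0 < γ) (hγ1 : γ ≤ 1) (x : E) :
    ∫ s, heatOp f s x ∂ν = subordinatedHeat H f t x :=
  integral_eq_add_integral_mul_measureReal_Ioi hν
    (stronglyMeasurable_heatOpTimeDeriv hf x).measurable hH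
    (integrableOn_heatOpTimeDeriv_mul h hf hM hC hC0 hγ hγ1 t x)
    fun _ hs => heatOp_eq_add_integral hf hM hC hC0 hγ hγ1 hs x

lemma abs_integral_heatOp_le {ν : Measure ℝ} [IsProbabilityMeasure ν] (hν : ν (Iic 0) = 0)
    (hM : ∀ x, |f x| ≤ M) (x : E) : |∫ s, heatOp f s x ∂ν| ≤ M := by
  rw [← Real.norm_eq_abs]
  refine (norm_integral_le_of_norm_le (μ := ν) (integrable_const M) ?_).trans (by simp)
  exact (ae_pos_of_measure_Iic_zero hν).mono fun s hs => abs_heatOp_le hM hs x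

lemma subordinatedHeat_zero (h : IsSubordinatorCdf H φ) (x : E) :
    subordinatedHeat H f 0 x = f x := by
  rw [subordinatedHeat, setIntegral_congr_fun (g := fun _ => (0 : ℝ)) measurableSet_Ioi]
  · simp
  · intro s hs
    simp [h.eq_zero s hs 0 le_rfl]

lemma tendsto_integral_rpow_mul_abs_sub (h : IsSubordinatorCdf H φ) (hγ : 0 < γ) (t₀ : ℝ) :
    Tendsto (fun t => ∫ s in Ioi 0, s ^ (γ / 2 - 1) * |H s t - H s t₀|) (𝓝 t₀) (𝓝 0) := by
  have hc : ContinuousAt (fun t => ∫ s in Ioi 0, s ^ (γ / 2 - 1) * |H s t - H s t₀|) t₀ := by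
    refine continuousAt_of_dominated
      (bound := fun s => Real.exp (t₀ + 1) * (s ^ (γ / 2 - 1) * Real.exp (-φ 1 * s)))
      ?_ ?_ ((integrableOn_rpow_mul_exp hγ (h.exponent_pos 1 one_pos)).const_mul _) ?_
    · refine Eventually.of_forall fun t => Measurable.aestronglyMeasurable ?_
      have h1 := (h.antitone t).measurable
      have h2 := (h.antitone t₀).measurable
      exact (by fun_prop : Measurable fun s : ℝ => s ^ (γ / 2 - 1)).mul
        (continuous_abs.measurable.comp (h1.sub h2))
    · filter_upwards [Iio_mem_nhds (lt_add_one t₀)] with t ht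
      filter_upwards [ae_restrict_mem measurableSet_Ioi] with s hs
      have hs : 0 < s := hs
      have key : ∀ u ≤ t₀ + 1, H s u ≤ Real.exp (t₀ + 1) * Real.exp (-φ 1 * s) := fun u hu => by
        refine (h.le_exp hs one_pos u).trans ?_
        rw [show -φ 1 * s = -s * φ 1 by ring, one_mul]
        gcongr
      have k1 := key t (le_of_lt ht)
      have k2 := key t₀ (by linarith)
      have n1 := h.nonneg s t
      have n2 := h.nonneg s t₀
      rw [norm_mul, Real.norm_of_nonneg (by positivity), Real.norm_of_nonneg (abs_nonneg _),
        mul_left_comm]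
      exact mul_le_mul_of_nonneg_left (abs_le.mpr ⟨by linarith, by linarith⟩) (by positivity)
    · refine ae_of_all _ fun s => ?_
      have := h.continuous s
      exact (by fun_prop : Continuous fun t => s ^ (γ / 2 - 1) * |H s t - H s t₀|).continuousAt
  simpa [ContinuousAt] using hc

lemma integrableOn_rpow_mul_abs_sub (h : IsSubordinatorCdf H φ) (hγ : 0 < γ) (t t₀ : ℝ) :
    IntegrableOn (fun s => s ^ (γ / 2 - 1) * |H s t - H s t₀|) (Ioi 0) := by
  refine Integrable.mono' ((integrableOn_rpow_mul_exp hγ (h.exponent_pos 1 one_pos)).const_mul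
    (Real.exp t + Real.exp t₀)) ?_ ?_
  · have h1 := (h.antitone t).measurable
    have h2 := (h.antitone t₀).measurable
    exact ((by fun_prop : Measurable fun s : ℝ => s ^ (γ / 2 - 1)).mul
      (continuous_abs.measurable.comp (h1.sub h2))).aestronglyMeasurable
  · filter_upwards [ae_restrict_mem measurableSet_Ioi] with s hs
    have hs : 0 < s := hs
    have k1 := h.le_exp hs one_pos t
    have k2 := h.le_exp hs one_pos t₀
    have n1 := h.nonneg s t
    have n2 := h.nonneg s t₀
    rw [one_mul, show -s * φ 1 = -φ 1 * s by ring] at k1 k2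
    rw [norm_mul, Real.norm_of_nonneg (by positivity), Real.norm_of_nonneg (abs_nonneg _),
      mul_left_comm, add_mul]
    exact mul_le_mul_of_nonneg_left (abs_le.mpr ⟨by linarith, by linarith⟩) (by positivity)

lemma abs_subordinatedHeat_sub_le (h : IsSubordinatorCdf H φ) (hf : Continuous f)
    (hM : ∀ x, |f x| ≤ M) (hC : ∀ x y, |f x - f y| ≤ C * ‖x - y‖ ^ γ) (hC0 : 0 ≤ C)
    (hγ : 0 < γ) (hγ1 : γ ≤ 1) (t t₀ : ℝ) (x : E) :
    |subordinatedHeat H f t x - subordinatedHeat H f t₀ x| ≤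
      Module.finrank ℝ E * (C * heatConst E) *
        ∫ s in Ioi 0, s ^ (γ / 2 - 1) * |H s t - H s t₀| := by
  rw [subordinatedHeat, subordinatedHeat, add_sub_add_left_eq_sub,
    ← integral_sub (integrableOn_heatOpTimeDeriv_mul h hf hM hC hC0 hγ hγ1 t x)
      (integrableOn_heatOpTimeDeriv_mul h hf hM hC hC0 hγ hγ1 t₀ x), ← integral_const_mul,
    ← Real.norm_eq_abs]
  refine norm_integral_le_of_norm_le ((integrableOn_rpow_mul_abs_sub h hγ t t₀).const_mul _) ?_
  filter_upwards [ae_restrict_mem measurableSet_Ioi] with s hs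
  rw [← mul_sub, norm_mul, ← mul_assoc]
  exact mul_le_mul_of_nonneg_right (abs_heatOpTimeDeriv_le hf hM hC hC0 hγ hγ1 hs x)
    (abs_nonneg _)

lemma subordinatedHeat_uniformly_continuous_in_time (h : IsSubordinatorCdf H φ) (hf : Continuous f)
    (hM : ∀ x, |f x| ≤ M) (hC : ∀ x y, |f x - f y| ≤ C * ‖x - y‖ ^ γ) (hC0 : 0 ≤ C)
    (hγ : 0 < γ) (hγ1 : γ ≤ 1) (t₀ : ℝ) {ε : ℝ} (hε : 0 < ε) :
    ∃ δ > 0, ∀ t, |t - t₀| < δ →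
      ∀ x, |subordinatedHeat H f t x - subordinatedHeat H f t₀ x| ≤ ε := by
  have h1 := (tendsto_integral_rpow_mul_abs_sub h hγ t₀).const_mul
    (Module.finrank ℝ E * (C * heatConst E))
  rw [mul_zero] at h1
  obtain ⟨δ, hδ, hb⟩ := Metric.eventually_nhds_iff.mp (h1.eventually_le_const hε)
  exact ⟨δ, hδ, fun t ht x =>
    (abs_subordinatedHeat_sub_le h hf hM hC hC0 hγ hγ1 t t₀ x).trans (hb ht)⟩

lemma integrable_prod_exp_mul_heatOpTimeDeriv_mul (h : IsSubordinatorCdf H φ) (hf : Continuous f)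
    (hM : ∀ x, |f x| ≤ M) (hC : ∀ x y, |f x - f y| ≤ C * ‖x - y‖ ^ γ) (hC0 : 0 ≤ C)
    (hγ : 0 < γ) (hγ1 : γ ≤ 1) {p : ℝ} (hp : 0 < p) (x : E) :
    Integrable (fun w : ℝ × ℝ => heatOpTimeDeriv f w.1 x * (Real.exp (-p * w.2) * H w.1 w.2))
      ((volume.restrict (Ioi 0)).prod (volume.restrict (Ioi 0))) := by
  have hm : Measurable fun w : ℝ × ℝ =>
      heatOpTimeDeriv f w.1 x * (Real.exp (-p * w.2) * H w.1 w.2) := by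
    have h1 := (stronglyMeasurable_heatOpTimeDeriv hf x).measurable.comp
      (measurable_fst : Measurable (Prod.fst : ℝ × ℝ → ℝ))
    have h2 := h.measurable_uncurry
    exact h1.mul ((by fun_prop : Measurable fun w : ℝ × ℝ => Real.exp (-p * w.2)).mul h2)
  rw [integrable_prod_iff hm.aestronglyMeasurable]
  refine ⟨ae_of_all _ fun s => (h.integrableOn_exp_mul s hp).const_mul
    (heatOpTimeDeriv f s x), ?_⟩
  refine ((integrableOn_exp_mul_heatOpTimeDeriv hf hM hC hC0 hγ hγ1
    (h.exponent_pos p hp) x).norm.mul_const p⁻¹).congr ?_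
  filter_upwards [ae_restrict_mem measurableSet_Ioi] with s hs
  have e : ∀ t, ‖heatOpTimeDeriv f s x * (Real.exp (-p * t) * H s t)‖ =
      ‖heatOpTimeDeriv f s x‖ * (Real.exp (-p * t) * H s t) := fun t => by
    rw [norm_mul, Real.norm_of_nonneg (mul_nonneg (Real.exp_nonneg _) (h.nonneg s t))]
  simp only [e]
  rw [integral_const_mul, h.laplace s hs p hp, norm_mul, Real.norm_of_nonneg (Real.exp_nonneg _),
    show -φ p * s = -s * φ p by ring]
  ring

lemma exp_mul_subordinatedHeat (H : ℝ → ℝ → ℝ) (f : E → ℝ) (p t : ℝ) (x : E) :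
    Real.exp (-p * t) * subordinatedHeat H f t x = Real.exp (-p * t) * f x +
      ∫ s in Ioi 0, heatOpTimeDeriv f s x * (Real.exp (-p * t) * H s t) := by
  rw [subordinatedHeat, mul_add, ← integral_const_mul]
  simp only [mul_left_comm]

lemma integrableOn_exp_mul_subordinatedHeat (h : IsSubordinatorCdf H φ) (hf : Continuous f)
    (hM : ∀ x, |f x| ≤ M) (hC : ∀ x y, |f x - f y| ≤ C * ‖x - y‖ ^ γ) (hC0 : 0 ≤ C)
    (hγ : 0 < γ) (hγ1 : γ ≤ 1) {p : ℝ} (hp : 0 < p) (x : E) :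
    IntegrableOn (fun t => Real.exp (-p * t) * subordinatedHeat H f t x) (Ioi 0) := by
  simp only [exp_mul_subordinatedHeat]
  exact ((integrableOn_exp_mul_Ioi (neg_neg_of_pos hp) 0).mul_const (f x)).add
    (integrable_prod_exp_mul_heatOpTimeDeriv_mul h hf hM hC hC0 hγ hγ1 hp x).integral_prod_right

lemma integral_exp_mul_subordinatedHeat (h : IsSubordinatorCdf H φ) (hf : Continuous f)
    (hM : ∀ x, |f x| ≤ M) (hC : ∀ x y, |f x - f y| ≤ C * ‖x - y‖ ^ γ) (hC0 : 0 ≤ C)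
    (hγ : 0 < γ) (hγ1 : γ ≤ 1) {p : ℝ} (hp : 0 < p) (x : E) :
    ∫ t in Ioi 0, Real.exp (-p * t) * subordinatedHeat H f t x =
      φ p / p * heatResolvent f (φ p) x := by
  have hi := integrable_prod_exp_mul_heatOpTimeDeriv_mul h hf hM hC hC0 hγ hγ1 hp x
  simp only [exp_mul_subordinatedHeat]
  have e := integral_add ((integrableOn_exp_mul_Ioi (neg_neg_of_pos hp) 0).mul_const (f x))
    hi.integral_prod_right
  refine e.trans ?_
  have hswap := integral_integral_swap
    (f := fun s t => heatOpTimeDeriv f s x * (Real.exp (-p * t) * H s t)) hi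
  have e2 : ∫ s in Ioi 0, (∫ t in Ioi 0, heatOpTimeDeriv f s x * (Real.exp (-p * t) * H s t)) =
      p⁻¹ * (φ p * heatResolvent f (φ p) x - f x) := by
    rw [← integral_exp_mul_heatOpTimeDeriv hf hM hC hC0 hγ hγ1 (h.exponent_pos p hp) x,
      ← integral_const_mul]
    refine setIntegral_congr_fun measurableSet_Ioi fun s hs => ?_
    rw [integral_const_mul, h.laplace s hs p hp, show -φ p * s = -s * φ p by ring]
    ring
  rw [hswap.symm.trans e2, integral_mul_const, integral_exp_mul_Ioi (neg_neg_of_pos hp)]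
  simp
  field_simp
  ring

end SubordinatedHeat

section StieltjesFunction

variable {σ : Measure ℝ} {K : ℝ → ℝ}

lemma integrableOn_add_inv (hσ : IntegrableOn (fun t => (1 + t)⁻¹) (Ici 0) σ) {p : ℝ} (hp : 0 < p) :
    IntegrableOn (fun t => (p + t)⁻¹) (Ici 0) σ := by
  refine Integrable.mono' (hσ.const_mul (max 1 p⁻¹))
    (by fun_prop : Measurable fun t : ℝ => (p + t)⁻¹).aestronglyMeasurable ?_
  filter_upwards [ae_restrict_mem measurableSet_Ici] with t ht
  have ht : 0 ≤ t := ht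
  rw [Real.norm_of_nonneg (by positivity), ← div_eq_mul_inv, le_div_iff₀ (by positivity),
    inv_mul_le_iff₀ (by positivity)]
  have h1 : 1 ≤ max 1 p⁻¹ := le_max_left _ _
  have h2 : 1 ≤ p * max 1 p⁻¹ := by
    rw [← mul_inv_cancel₀ hp.ne']
    exact mul_le_mul_of_nonneg_left (le_max_right _ _) hp.le
  nlinarith [mul_le_mul_of_nonneg_right h1 ht]

lemma measure_singleton_zero_lt_top (hσ : IntegrableOn (fun t => (1 + t)⁻¹) (Ici 0) σ) :
    σ {0} < ⊤ := by
  have h := hσ.mono_set (singleton_subset_iff.mpr (mem_Ici.mpr le_rfl) : ({0} : Set ℝ) ⊆ Ici 0)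
  have h2 := h.measure_norm_ge_lt_top one_pos
  refine lt_of_le_of_lt ?_ h2
  rw [Measure.restrict_apply₀']
  · exact measure_mono fun t ht => by simp_all
  · exact (measurableSet_singleton _).nullMeasurableSet

lemma measure_singleton_zero_eq_zero (hσ : IntegrableOn (fun t => (1 + t)⁻¹) (Ici 0) σ)
    (hK : ∀ p, 0 < p → K p = ∫ t in Ici 0, (p + t)⁻¹ ∂σ)
    (h0 : Tendsto (fun p => p * K p) (𝓝[>] 0) (𝓝 0)) : σ {0} = 0 := by
  have hle : ∀ p, 0 < p → σ.real {0} ≤ p * K p := by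
    intro p hp
    have h1 : ∫ t in {0}, (p + t)⁻¹ ∂σ ≤ ∫ t in Ici 0, (p + t)⁻¹ ∂σ := by
      refine setIntegral_mono_set (integrableOn_add_inv hσ hp) ?_
        (singleton_subset_iff.mpr (mem_Ici.mpr le_rfl)).eventuallyLE
      filter_upwards [ae_restrict_mem measurableSet_Ici] with t ht
      have ht : 0 ≤ t := ht
      simp only [Pi.zero_apply]
      positivity
    rw [integral_singleton, ← hK p hp, add_zero, smul_eq_mul] at h1
    have := mul_le_mul_of_nonneg_left h1 hp.le
    rwa [mul_left_comm, mul_inv_cancel₀ hp.ne', mul_one] at this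
  have h2 : σ.real {0} ≤ 0 := ge_of_tendsto h0 (by
    filter_upwards [self_mem_nhdsWithin] with p hp using hle p hp)
  have h3 : σ.real {0} = 0 := le_antisymm h2 measureReal_nonneg
  rwa [measureReal_eq_zero_iff (measure_singleton_zero_lt_top hσ).ne] at h3

lemma setIntegral_Ici_eq_Ioi_of_null (h : σ {0} = 0) (g : ℝ → ℝ) :
    ∫ t in Ici 0, g t ∂σ = ∫ t in Ioi 0, g t ∂σ := by
  refine setIntegral_congr_set ?_
  have : Ici (0 : ℝ) = Ioi 0 ∪ {0} := by simp
  rw [this]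
  exact union_ae_eq_left_of_ae_eq_empty (ae_eq_empty.mpr h)

lemma measure_Ioi_eq_top (hK : ∀ p, 0 < p → K p = ∫ t in Ioi 0, (p + t)⁻¹ ∂σ)
    (hinf : Tendsto (fun p => p * K p) atTop atTop) : σ (Ioi 0) = ⊤ := by
  by_contra hne
  have hle : ∀ p, 0 < p → p * K p ≤ σ.real (Ioi 0) := by
    intro p hp
    rw [hK p hp, ← integral_const_mul]
    have : IsFiniteMeasure (σ.restrict (Ioi 0)) := ⟨by simpa using lt_top_iff_ne_top.mpr hne⟩
    have h1 : ∫ t in Ioi 0, p * (p + t)⁻¹ ∂σ ≤ ∫ t in Ioi 0, (1 : ℝ) ∂σ := by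
      refine integral_mono_of_nonneg ?_ (integrable_const _) ?_
      · filter_upwards [ae_restrict_mem measurableSet_Ioi] with t ht
        have ht : 0 < t := ht
        simp only [Pi.zero_apply]
        positivity
      · filter_upwards [ae_restrict_mem measurableSet_Ioi] with t ht
        have ht : 0 < t := ht
        rw [← div_eq_mul_inv, div_le_one (by positivity)]
        linarith
    simpa using h1
  obtain ⟨p, hp, hp0⟩ := ((hinf.eventually_gt_atTop (σ.real (Ioi 0))).and
    (eventually_gt_atTop 0)).exists
  exact absurd (hle p hp0) (not_le.mpr hp)

/-- A Stieltjes function `K` with `p K(p) → 0` at zero and `p K(p) → ∞` at infinity gives rise to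
a subordinator with Laplace exponent `p K(p)`. -/
theorem exists_isSubordinatorCdf (hσ : IntegrableOn (fun t => (1 + t)⁻¹) (Ici 0) σ)
    (hK : ∀ p, 0 < p → K p = ∫ t in Ici 0, (p + t)⁻¹ ∂σ)
    (h0 : Tendsto (fun p => p * K p) (𝓝[>] 0) (𝓝 0))
    (hinf : Tendsto (fun p => p * K p) atTop atTop) :
    ∃ H, IsSubordinatorCdf H fun p => p * K p := by
  have hz := measure_singleton_zero_eq_zero hσ hK h0
  have hσ' := hσ.mono_set (Ioi_subset_Ici_self (a := (0 : ℝ)))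
  have hK' : ∀ p, 0 < p → K p = ∫ t in Ioi 0, (p + t)⁻¹ ∂σ := fun p hp => by
    rw [hK p hp, setIntegral_Ici_eq_Ioi_of_null hz]
  have htop := measure_Ioi_eq_top hK' hinf
  obtain ⟨H, h1, h2, h3, h4, h5, h6, h7, h8⟩ := exists_subordinator_cdf hσ' htop
  refine ⟨H, h1, h2, h3, h4, h5, h6, h7, fun p hp => mul_pos hp ?_, fun s hs p hp => ?_⟩
  · rw [hK' p hp, setIntegral_pos_iff_support_of_nonneg_ae]
    · have : Function.support (fun t : ℝ => (p + t)⁻¹) ∩ Ioi 0 = Ioi 0 := by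
        refine inter_eq_right.mpr fun t ht => ?_
        have ht : 0 < t := ht
        simp only [Function.mem_support]
        positivity
      rw [this, htop]
      simp
    · filter_upwards [ae_restrict_mem measurableSet_Ioi] with t ht
      have ht : 0 < t := ht
      simp only [Pi.zero_apply]
      positivity
    · exact (integrableOn_add_inv hσ hp).mono_set Ioi_subset_Ici_self
  · rw [h8 s hs p hp, hK' p hp, integral_const_mul]

end StieltjesFunction

lemma continuous_of_abs_sub_le_rpow {E : Type*} [NormedAddCommGroup E] {f : E → ℝ} {C γ : ℝ}
    (hγ : 0 < γ) (hC : ∀ x y, |f x - f y| ≤ C * ‖x - y‖ ^ γ) : Continuous f := by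
  refine continuous_iff_continuousAt.mpr fun x => ?_
  rw [ContinuousAt, tendsto_iff_norm_sub_tendsto_zero]
  have h1 : Continuous fun y => C * ‖y - x‖ ^ γ := by
    refine continuous_const.mul (Continuous.rpow_const (by fun_prop) fun _ => Or.inr hγ.le)
  have h2 := h1.tendsto x
  rw [sub_self, norm_zero, Real.zero_rpow hγ.ne', mul_zero] at h2
  exact squeeze_zero (fun _ => norm_nonneg _) (fun y => hC y x) h2

end SubordinatedHeatEquation

/-- Under assumption (*), there is a nonnegative kernel `Z(t,x)`
(`t > 0`, `x ≠ 0`), locally integrable in `t`, smooth in `x ≠ 0`, with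
`∫_{ℝⁿ} Z(t,x) dx = 1`, such that for every bounded globally Hölder continuous
`w₀` the function `w(t,x) = ∫ Z(t, x-ξ) w₀(ξ) dξ` is an LT-solution of
`(D_(k) w) = Δw`, `w(0,·) = w₀`: it is bounded, continuous in `t` on `[0,∞)`
uniformly in `x`, takes the initial value `w₀`, and for each `p > 0` its Laplace
transform `w̃(p,·)` is twice continuously differentiable and satisfies
`pK(p) w̃(p,x) - K(p) w₀(x) = Δ_x w̃(p,x)`. -/
theorem statement7
    (n : ℕ) (hn : 1 ≤ n)
    (k K : ℝ → ℝ) (σ : MeasureTheory.Measure ℝ)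
    (hk_nonneg : ∀ t, 0 < t → 0 ≤ k t)
    (hk_loc : ∀ T, 0 < T → MeasureTheory.IntegrableOn k (Set.Ioc 0 T))
    (hK_int : ∀ p, 0 < p →
      MeasureTheory.IntegrableOn (fun t => Real.exp (-p * t) * k t) (Set.Ioi 0))
    (hK_def : ∀ p, 0 < p → K p = ∫ t in Set.Ioi 0, Real.exp (-p * t) * k t)
    (hσ_int : MeasureTheory.IntegrableOn (fun t => (1 + t)⁻¹) (Set.Ici 0) σ)
    (hK_st : ∀ p, 0 < p → K p = ∫ t in Set.Ici 0, (p + t)⁻¹ ∂σ)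
    (hK_zero : Filter.Tendsto K (nhdsWithin 0 (Set.Ioi 0)) Filter.atTop)
    (hK_inf : Filter.Tendsto K Filter.atTop (nhds 0))
    (hpK_zero : Filter.Tendsto (fun p => p * K p) (nhdsWithin 0 (Set.Ioi 0)) (nhds 0))
    (hpK_inf : Filter.Tendsto (fun p => p * K p) Filter.atTop Filter.atTop) :
    ∃ Z : ℝ → EuclideanSpace ℝ (Fin n) → ℝ,
      -- nonnegativity
      (∀ t, 0 < t → ∀ x : EuclideanSpace ℝ (Fin n), x ≠ 0 → 0 ≤ Z t x) ∧
      -- local integrability in t for fixed x ≠ 0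
      (∀ x : EuclideanSpace ℝ (Fin n), x ≠ 0 →
        ∀ T, 0 < T → IntegrableOn (fun t => Z t x) (Set.Ioc 0 T)) ∧
      -- smoothness in x ≠ 0
      (∀ t, 0 < t → ContDiffOn ℝ (⊤ : ℕ∞) (Z t) {x : EuclideanSpace ℝ (Fin n) | x ≠ 0}) ∧
      -- total mass one
      (∀ t, 0 < t → Integrable (Z t) ∧ (∫ x, Z t x) = 1) ∧
      -- LT-solution property for every bounded globally Hölder continuous w₀
      (∀ (w₀ : EuclideanSpace ℝ (Fin n) → ℝ) (γ C₀ M₀ : ℝ),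
        0 < γ → γ ≤ 1 →
        (∀ x, |w₀ x| ≤ M₀) →
        (∀ ξ ζ : EuclideanSpace ℝ (Fin n), |w₀ ξ - w₀ ζ| ≤ C₀ * ‖ξ - ζ‖ ^ γ) →
        ∃ w : ℝ → EuclideanSpace ℝ (Fin n) → ℝ,
          -- w is given by the convolution with Z for t > 0
          (∀ t, 0 < t → ∀ x,
            Integrable (fun ξ => Z t (x - ξ) * w₀ ξ) ∧
            w t x = ∫ ξ, Z t (x - ξ) * w₀ ξ) ∧
          -- initial value
          (∀ x, w 0 x = w₀ x) ∧
          -- boundedness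
          (∃ M, ∀ t, 0 ≤ t → ∀ x, |w t x| ≤ M) ∧
          -- continuity in t on [0,∞), uniformly in x
          (∀ t₀, 0 ≤ t₀ → ∀ ε, 0 < ε → ∃ δ > 0,
            ∀ t, 0 ≤ t → |t - t₀| < δ → ∀ x, |w t x - w t₀ x| ≤ ε) ∧
          -- the Laplace transform exists, is C² in x, and satisfies the equation
          (∀ p, 0 < p →
            (∀ x, IntegrableOn (fun t => Real.exp (-p * t) * w t x) (Set.Ioi 0)) ∧
            ContDiff ℝ 2 (fun x => ∫ t in Set.Ioi 0, Real.exp (-p * t) * w t x) ∧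
            ∀ x, p * K p * (∫ t in Set.Ioi 0, Real.exp (-p * t) * w t x)
                - K p * w₀ x
              = lap (fun y => ∫ t in Set.Ioi 0, Real.exp (-p * t) * w t y) x)) := by
  obtain ⟨H, h⟩ := exists_isSubordinatorCdf hσ_int hK_st hpK_zero hpK_inf
  obtain ⟨ν, hνm, hνp, hν0, hνH⟩ := h.exists_law
  refine ⟨fun t => subordinatedKernel (ν t), fun t ht x _ => subordinatedKernel_nonneg (hν0 t ht) x,
    fun x hx T _ => integrableOn_subordinatedKernel hνm hν0 hx T,
    fun t ht => contDiffOn_subordinatedKernel (hν0 t ht),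
    fun t ht => ⟨integrable_subordinatedKernel (hν0 t ht), integral_subordinatedKernel (hν0 t ht)⟩,
    fun w₀ γ C₀ M₀ hγ hγ1 hM hC₀ => ?_⟩
  have hC : ∀ x y, |w₀ x - w₀ y| ≤ |C₀| * ‖x - y‖ ^ γ := fun x y =>
    (hC₀ x y).trans (mul_le_mul_of_nonneg_right (le_abs_self _) (by positivity))
  have hC0 : 0 ≤ |C₀| := abs_nonneg _
  have hf : Continuous w₀ := continuous_of_abs_sub_le_rpow hγ hC
  have hw : ∀ t, 0 < t → ∀ x, subordinatedHeat H w₀ t x = ∫ s, heatOp w₀ s x ∂ν t :=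
    fun t ht x => (integral_heatOp_eq_subordinatedHeat h (hν0 t ht) (hνH t ht) hf hM hC hC0 hγ hγ1
      x).symm
  have hL : ∀ p, 0 < p → (fun x => ∫ t in Ioi 0, Real.exp (-p * t) * subordinatedHeat H w₀ t x) =
      K p • heatResolvent w₀ (p * K p) := fun p hp => funext fun x => by
    rw [integral_exp_mul_subordinatedHeat h hf hM hC hC0 hγ hγ1 hp x, mul_div_cancel_left₀ _ hp.ne',
      Pi.smul_apply, smul_eq_mul]
  refine ⟨subordinatedHeat H w₀, fun t ht x => ?_, subordinatedHeat_zero h, ⟨M₀, fun t ht x => ?_⟩,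
    fun t₀ _ ε hε => ?_, fun p hp => ?_⟩
  · rw [hw t ht, integral_subordinatedKernel_mul (hν0 t ht) hf hM]
    exact ⟨integrable_subordinatedKernel_mul (hν0 t ht) hf hM x, rfl⟩
  · rcases ht.eq_or_lt with rfl | ht
    · rw [subordinatedHeat_zero h]
      exact hM x
    · rw [hw t ht]
      exact abs_integral_heatOp_le (hν0 t ht) hM x
  · obtain ⟨δ, hδ, hb⟩ :=
      subordinatedHeat_uniformly_continuous_in_time h hf hM hC hC0 hγ hγ1 t₀ hε
    exact ⟨δ, hδ, fun t _ => hb t⟩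
  · have hl := h.exponent_pos p hp
    have hc := contDiff_heatResolvent hf hM hC hC0 hγ hγ1 hl
    refine ⟨integrableOn_exp_mul_subordinatedHeat h hf hM hC hC0 hγ hγ1 hp, ?_, fun x => ?_⟩
    · rw [hL p hp]
      exact hc.const_smul (K p)
    · have hs := sum_iteratedFDeriv_two_heatResolvent (EuclideanSpace.basisFun (Fin n) ℝ)
        hf hM hC hC0 hγ hγ1 hl x
      have hx := congrFun (hL p hp) x
      rw [hL p hp, hx, lap, iteratedFDeriv_const_smul_apply hc.contDiffAt]
      simp only [EuclideanSpace.basisFun_apply] at hs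
      simp only [ContinuousMultilinearMap.smul_apply, Pi.smul_apply, smul_eq_mul]
      rw [← Finset.mul_sum, hs]
      ring
end

section
/- Suppose k satisfies assumption (*). Then for each s > 0 there exists a probability Borel measure μ_s on [0,∞) such that ∫_{[0,∞)} e^{−pτ} μ_s(dτ) = exp(−s·p·K(p)) for all p > 0. Moreover, setting G(s,t) = ∫_{[0,t]} k(t−τ) μ_s(dτ), one has ∫₀^∞ e^{−pt} G(s,t) dt = K(p)·exp(−s·p·K(p)) for all p > 0 and s > 0, and ∫₀^∞ G(s,t) ds = 1 for almost every t > 0. -/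
open MeasureTheory Filter Set

section UnitIntervalTransform

open scoped unitInterval Topology ENNReal

/-- A class of continuous functions on `[0, 1]` containing the monomials and closed under sums and
uniform limits contains every continuous function. -/
theorem continuousMap_unitInterval_induction {P : C(I, ℝ) → Prop}
    (hmon : ∀ (n : ℕ) (c : ℝ), P ⟨fun x => c * (x : ℝ) ^ n, by fun_prop⟩)
    (hadd : ∀ f g, P f → P g → P (f + g))
    (hlim : ∀ (u : ℕ → C(I, ℝ)) (f : C(I, ℝ)), (∀ n, P (u n)) → Tendsto u atTop (𝓝 f) → P f)
    (f : C(I, ℝ)) : P f := by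
  have hpoly : ∀ q : Polynomial ℝ, P (q.toContinuousMapOn I) := by
    intro q
    induction q using Polynomial.induction_on' with
    | add p q hp hq =>
      have := hadd _ _ hp hq
      convert this using 1
      ext x; simp
    | monomial n c =>
      convert hmon n c using 1
      ext x; simp
  have hf : f ∈ (polynomialFunctions I).topologicalClosure := by
    rw [polynomialFunctions_closure_eq_top']; trivial
  have hf' : f ∈ closure (polynomialFunctions I : Set C(I, ℝ)) := hf
  obtain ⟨u, hu, hl⟩ := mem_closure_iff_seq_limit.1 hf'
  refine hlim u f (fun n => ?_) hl
  obtain ⟨q, -, hq⟩ := hu n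
  rw [← hq]
  exact hpoly q

theorem tendsto_integral_continuousMap_unitInterval (μ : Measure I) [IsFiniteMeasure μ]
    {u : ℕ → C(I, ℝ)} {f : C(I, ℝ)} (h : Tendsto u atTop (𝓝 f)) :
    Tendsto (fun n => ∫ x, u n x ∂μ) atTop (𝓝 (∫ x, f x ∂μ)) := by
  have hint : ∀ g : C(I, ℝ), Integrable g μ := fun g =>
    g.continuous.integrable_of_hasCompactSupport (HasCompactSupport.of_compactSpace g)
  rw [tendsto_iff_norm_sub_tendsto_zero] at h ⊢
  refine squeeze_zero (fun n => norm_nonneg _) (fun n => ?_)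
    (by simpa using h.mul_const (μ.real univ))
  rw [← integral_sub (hint _) (hint _)]
  exact norm_integral_le_of_norm_le_const (ae_of_all _ fun x => (u n - f).norm_coe_le_norm x)

/-- A family of probability measures on `[0, 1]` with measurable moments is measurable. -/
theorem measurable_measure_unitInterval_of_moments {α : Type*} [MeasurableSpace α]
    (ν : α → Measure I) [∀ a, IsProbabilityMeasure (ν a)]
    (h : ∀ n : ℕ, Measurable fun a => ∫ x, (x : ℝ) ^ n ∂(ν a)) : Measurable ν := by
  have key : ∀ f : C(I, ℝ), Measurable fun a => ∫ x, f x ∂(ν a) := by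
    intro f
    have hint : ∀ (a : α) (g : C(I, ℝ)), Integrable g (ν a) := fun a g =>
      g.continuous.integrable_of_hasCompactSupport (HasCompactSupport.of_compactSpace g)
    induction f using continuousMap_unitInterval_induction with
    | hmon n c =>
      simp only [ContinuousMap.coe_mk, integral_const_mul]
      exact (h n).const_mul c
    | hadd f g hf hg =>
      have : (fun a => ∫ x, (f + g) x ∂(ν a))
          = fun a => ∫ x, f x ∂(ν a) + ∫ x, g x ∂(ν a) := by
        funext a
        exact integral_add (hint a f) (hint a g)
      rw [this]
      exact hf.add hg
    | hlim u f hu hl =>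
      exact measurable_of_tendsto_metrizable hu
        (tendsto_pi_nhds.2 fun a => tendsto_integral_continuousMap_unitInterval (ν a) hl)
  refine Measurable.measure_of_isPiSystem_of_isProbabilityMeasure
    (S := {s : Set I | IsClosed s}) ?_ isPiSystem_isClosed fun F hF => ?_
  · rw [← borel_eq_generateFrom_isClosed]; exact BorelSpace.measurable_eq
  · have hF' : IsClosed F := hF
    refine measurable_of_tendsto_metrizable (f := fun n a => ∫⁻ x, hF'.apprSeq n x ∂(ν a))
      (fun n => ?_) (tendsto_pi_nhds.2 fun a => HasOuterApproxClosed.tendsto_lintegral_apprSeq hF' (ν a))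
    let g : C(I, ℝ) := ⟨fun x => (hF'.apprSeq n x : ℝ), by fun_prop⟩
    have : (fun a => ∫⁻ x, hF'.apprSeq n x ∂(ν a))
        = fun a => ENNReal.ofReal (∫ x, g x ∂(ν a)) := by
      funext a
      exact lintegral_coe_eq_integral _
        (g.continuous.integrable_of_hasCompactSupport (HasCompactSupport.of_compactSpace g))
    rw [this]
    exact (key g).ennreal_ofReal

/-- A finite measure on `[0, 1]` is determined by its moments. -/
theorem measure_unitInterval_ext_of_moments (μ ν : Measure I) [IsFiniteMeasure μ]
    [IsFiniteMeasure ν] (h : ∀ n : ℕ, ∫ x, (x : ℝ) ^ n ∂μ = ∫ x, (x : ℝ) ^ n ∂ν) : μ = ν := by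
  have hint : ∀ (ρ : Measure I) [IsFiniteMeasure ρ] (g : C(I, ℝ)), Integrable g ρ := fun ρ _ g =>
    g.continuous.integrable_of_hasCompactSupport (HasCompactSupport.of_compactSpace g)
  have key : ∀ f : C(I, ℝ), ∫ x, f x ∂μ = ∫ x, f x ∂ν := by
    intro f
    induction f using continuousMap_unitInterval_induction with
    | hmon n c => simp only [ContinuousMap.coe_mk, integral_const_mul, h n]
    | hadd f g hf hg =>
      have e : ∀ (ρ : Measure I) [IsFiniteMeasure ρ],
          ∫ x, (f + g) x ∂ρ = ∫ x, f x ∂ρ + ∫ x, g x ∂ρ :=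
        fun ρ _ => integral_add (hint ρ f) (hint ρ g)
      rw [e, e, hf, hg]
    | hlim u f hu hl =>
      exact tendsto_nhds_unique (tendsto_integral_continuousMap_unitInterval μ hl)
        (by simpa only [hu] using tendsto_integral_continuousMap_unitInterval ν hl)
  exact ext_of_forall_integral_eq_of_IsFiniteMeasure fun f => key f.toContinuousMap

/-- `f` is, on `(0, ∞)`, the Mellin-type transform `p ↦ ∫ x ^ p` of a probability measure
on `[0, 1]`. -/
def IsUnitMomentFunction (f : ℝ → ℝ) : Prop :=
  ∃ μ : Measure I, IsProbabilityMeasure μ ∧ ∀ p, 0 < p → ∫ x, (x : ℝ) ^ p ∂μ = f p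

theorem continuous_unitInterval_rpow {p : ℝ} (hp : 0 < p) : Continuous fun x : I => (x : ℝ) ^ p :=
  continuous_subtype_val.rpow_const fun _ => Or.inr hp.le

theorem integrable_unitInterval_rpow (μ : Measure I) [IsFiniteMeasure μ] {p : ℝ} (hp : 0 < p) :
    Integrable (fun x : I => (x : ℝ) ^ p) μ :=
  (continuous_unitInterval_rpow hp).integrable_of_hasCompactSupport
    (HasCompactSupport.of_compactSpace _)

namespace IsUnitMomentFunction

theorem one : IsUnitMomentFunction fun _ => 1 :=
  ⟨Measure.dirac 1, inferInstance, fun p _ => by simp⟩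

theorem mul {f g : ℝ → ℝ} (hf : IsUnitMomentFunction f) (hg : IsUnitMomentFunction g) :
    IsUnitMomentFunction fun p => f p * g p := by
  obtain ⟨μ, hμ, hf⟩ := hf
  obtain ⟨ν, hν, hg⟩ := hg
  refine ⟨μ.mconv ν, inferInstance, fun p hp => ?_⟩
  rw [integral_mconv (integrable_unitInterval_rpow _ hp)]
  have : ∀ x y : I, ((x * y : I) : ℝ) ^ p = (x : ℝ) ^ p * (y : ℝ) ^ p := fun x y => by
    rw [Set.Icc.coe_mul, Real.mul_rpow x.2.1 y.2.1]
  simp_rw [this, integral_const_mul, integral_mul_const, hf p hp, hg p hp]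

theorem pow {f : ℝ → ℝ} (hf : IsUnitMomentFunction f) (n : ℕ) :
    IsUnitMomentFunction fun p => f p ^ n := by
  induction n with
  | zero => simpa using one
  | succ n ih => simpa only [pow_succ] using ih.mul hf

theorem of_tendsto {f : ℕ → ℝ → ℝ} {g : ℝ → ℝ} (hf : ∀ n, IsUnitMomentFunction (f n))
    (h : ∀ p, 0 < p → Tendsto (fun n => f n p) atTop (𝓝 (g p))) : IsUnitMomentFunction g := by
  choose μ hμ hf using hf
  let ν : ℕ → ProbabilityMeasure I := fun n => ⟨μ n, hμ n⟩
  let F : Ultrafilter ℕ := Filter.hyperfilter ℕ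
  have hF : (F : Filter ℕ) ≤ atTop := Nat.hyperfilter_le_atTop
  obtain ⟨ρ, -, hρ⟩ := isCompact_univ.ultrafilter_le_nhds (F.map ν) (by simp)
  have hρ' : Tendsto ν F (𝓝 ρ) := hρ
  rw [ProbabilityMeasure.tendsto_iff_forall_integral_tendsto] at hρ'
  refine ⟨ρ, inferInstance, fun p hp => ?_⟩
  have h1 := hρ' (BoundedContinuousFunction.mkOfCompact ⟨_, continuous_unitInterval_rpow hp⟩)
  have h2 := (h p hp).mono_left hF
  refine tendsto_nhds_unique h1 (h2.congr fun n => ?_)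
  exact (hf n p hp).symm

theorem congr {f g : ℝ → ℝ} (hf : IsUnitMomentFunction f) (h : ∀ p, 0 < p → f p = g p) :
    IsUnitMomentFunction g := by
  obtain ⟨μ, hμ, hf⟩ := hf
  exact ⟨μ, hμ, fun p hp => (hf p hp).trans (h p hp)⟩

end IsUnitMomentFunction

theorem integral_unitInterval_rpow {r : ℝ} (hr : 0 ≤ r) : ∫ u : I, (u : ℝ) ^ r = (r + 1)⁻¹ := by
  rw [unitInterval.measurePreserving_coe.integral_comp unitInterval.measurableEmbedding_coe
    (fun u : ℝ => u ^ r), unitInterval, integral_Icc_eq_integral_Ioc,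
    ← intervalIntegral.integral_of_le zero_le_one, integral_rpow (Or.inl (by linarith))]
  rw [Real.one_rpow, Real.zero_rpow (by positivity), sub_zero, one_div]

theorem isUnitMomentFunction_one_sub (ρ : Measure ℝ) [IsFiniteMeasure ρ] (hρ : ∀ᵐ t ∂ρ, 0 ≤ t)
    {c : ℝ} (hc : 0 ≤ c) (hcm : c * ρ.real univ ≤ 1) :
    IsUnitMomentFunction fun p => 1 - c * ∫ t, p / (p + t) ∂ρ := by
  classical
  let g : ℝ × I → I := fun z => if h : 0 < z.1 then
    ⟨(z.2 : ℝ) ^ z.1⁻¹, Real.rpow_nonneg z.2.2.1 _,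
      Real.rpow_le_one z.2.2.1 z.2.2.2 (inv_nonneg.2 h.le)⟩ else 0
  have hgv : ∀ z, (g z : ℝ) = if 0 < z.1 then (z.2 : ℝ) ^ z.1⁻¹ else 0 := by
    intro z
    by_cases h : 0 < z.1 <;> simp [g, h]
  have hg : Measurable g := by
    rw [← unitInterval.measurableEmbedding_coe.measurable_comp_iff]
    have : (fun z => (g z : ℝ)) = fun z => if 0 < z.1 then (z.2 : ℝ) ^ z.1⁻¹ else 0 := funext hgv
    change Measurable fun z => (g z : ℝ)
    rw [this]
    exact Measurable.ite (measurableSet_lt measurable_const measurable_fst) (by fun_prop)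
      measurable_const
  have hinner : ∀ p, 0 < p → ∀ t, 0 ≤ t → ∫ u : I, (g (t, u) : ℝ) ^ p = 1 - p / (p + t) := by
    intro p hp t ht
    rcases ht.eq_or_lt with rfl | ht
    · simp [hgv, Real.zero_rpow hp.ne', div_self hp.ne']
    · have : ∀ u : I, (g (t, u) : ℝ) ^ p = (u : ℝ) ^ (t⁻¹ * p) := fun u => by
        rw [hgv, if_pos ht, ← Real.rpow_mul u.2.1]
      simp_rw [this]
      rw [integral_unitInterval_rpow (by positivity)]
      field_simp
      ring
  have hm : 0 ≤ 1 - c * ρ.real univ := by linarith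
  refine ⟨ENNReal.ofReal (1 - c * ρ.real univ) • Measure.dirac 1
    + ENNReal.ofReal c • (ρ.prod volume).map g, ⟨?_⟩, fun p hp => ?_⟩
  · rw [Measure.add_apply, Measure.smul_apply, Measure.smul_apply, Measure.map_apply hg .univ,
      preimage_univ, ← univ_prod_univ, Measure.prod_prod]
    simp only [measure_univ, smul_eq_mul, mul_one]
    rw [← ofReal_measureReal (μ := ρ), ← ENNReal.ofReal_mul hc, ← ENNReal.ofReal_add hm (by positivity)]
    simp
  · have hcont := continuous_unitInterval_rpow hp
    rw [integral_add_measure ((integrable_unitInterval_rpow _ hp).smul_measure (by simp))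
      ((integrable_unitInterval_rpow _ hp).smul_measure (by simp)),
      integral_smul_measure, integral_smul_measure,
      integral_map hg.aemeasurable hcont.aestronglyMeasurable,
      integral_prod]
    · have h1 : ∫ t, (∫ u : I, (g (t, u) : ℝ) ^ p) ∂ρ = ∫ t, (1 - p / (p + t)) ∂ρ :=
        integral_congr_ae (hρ.mono fun t ht => hinner p hp t ht)
      have hi : Integrable (fun t => p / (p + t)) ρ := by
        refine Integrable.of_bound (measurable_const.div (by fun_prop)).aestronglyMeasurable 1 (hρ.mono fun t ht => ?_)
        rw [Real.norm_of_nonneg (by positivity)]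
        exact div_le_one_of_le₀ (by linarith) (by positivity)
      rw [h1, integral_sub (integrable_const _) hi]
      simp [ENNReal.toReal_ofReal, hm, hc]
      ring
    · exact (integrable_map_measure hcont.aestronglyMeasurable hg.aemeasurable).1
        (integrable_unitInterval_rpow _ hp)

theorem isUnitMomentFunction_exp_of_finite (ρ : Measure ℝ) [IsFiniteMeasure ρ]
    (hρ : ∀ᵐ t ∂ρ, 0 ≤ t) {s : ℝ} (hs : 0 ≤ s) :
    IsUnitMomentFunction fun p => Real.exp (-(s * ∫ t, p / (p + t) ∂ρ)) := by
  obtain ⟨N, hN⟩ := exists_nat_gt (s * ρ.real univ)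
  have hN0 : 0 < (N : ℝ) := lt_of_le_of_lt (by positivity) hN
  refine IsUnitMomentFunction.of_tendsto
    (f := fun n p => (1 - s / (n + N : ℕ) * ∫ t, p / (p + t) ∂ρ) ^ (n + N)) (fun n => ?_)
    fun p hp => ?_
  · refine (isUnitMomentFunction_one_sub ρ hρ (by positivity) ?_).pow _
    rw [div_mul_eq_mul_div]
    refine div_le_one_of_le₀ ?_ (by positivity)
    push_cast
    have : (0 : ℝ) ≤ n := by positivity
    linarith
  · have := (tendsto_add_atTop_iff_nat N).2
      (Real.tendsto_one_add_div_pow_exp (-(s * ∫ t, p / (p + t) ∂ρ)))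
    refine this.congr fun n => ?_
    congr 1
    ring

theorem isUnitMomentFunction_exp_stieltjes (ρ : Measure ℝ)
    (hρ : IntegrableOn (fun t => (1 + t)⁻¹) (Ici 0) ρ) {s : ℝ} (hs : 0 ≤ s) :
    IsUnitMomentFunction fun p => Real.exp (-(s * (p * ∫ t in Ici 0, (p + t)⁻¹ ∂ρ))) := by
  have hfin : ∀ n : ℕ, IsFiniteMeasure (ρ.restrict (Icc 0 (n : ℝ))) := by
    intro n
    have h1 : IntegrableOn (fun _ : ℝ => (1 : ℝ)) (Icc 0 (n : ℝ)) ρ := by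
      refine Integrable.mono' ((hρ.mono_set Icc_subset_Ici_self).const_mul (1 + n : ℝ))
        (by fun_prop) ((ae_restrict_iff' measurableSet_Icc).2 (ae_of_all _ fun t ht => ?_))
      have : (0 : ℝ) < 1 + t := by linarith [ht.1]
      rw [norm_one, ← div_eq_mul_inv, one_le_div this]
      linarith [ht.2]
    rw [integrableOn_const_iff (by simp)] at h1
    exact ⟨by simpa using h1⟩
  have hint : ∀ p, 0 < p → IntegrableOn (fun t => (p + t)⁻¹) (Ici 0) ρ := by
    intro p hp
    refine Integrable.mono' (hρ.const_mul (max 1 p⁻¹))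
        (by fun_prop) ((ae_restrict_iff' measurableSet_Ici).2 (ae_of_all _ fun t ht => ?_))
    have ht : (0 : ℝ) ≤ t := ht
    rw [Real.norm_of_nonneg (by positivity), ← div_eq_mul_inv, inv_eq_one_div,
      div_le_div_iff₀ (by positivity) (by positivity)]
    have h1 := le_max_left 1 p⁻¹
    have h2 : 1 ≤ max 1 p⁻¹ * p := by
      calc 1 = p⁻¹ * p := by field_simp
        _ ≤ _ := by gcongr; exact le_max_right _ _
    nlinarith
  refine IsUnitMomentFunction.of_tendsto
    (fun n => isUnitMomentFunction_exp_of_finite (ρ.restrict (Icc 0 (n : ℝ)))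
      ((ae_restrict_iff' measurableSet_Icc).2 (ae_of_all _ fun t ht => ht.1)) hs) fun p hp => ?_
  refine (Real.continuous_exp.tendsto _).comp ((Tendsto.const_mul s ?_).neg)
  simp_rw [div_eq_mul_inv, integral_const_mul]
  refine Tendsto.const_mul p ?_
  have hU : (⋃ n : ℕ, Icc (0 : ℝ) n) = Ici 0 := by
    ext t
    simp only [mem_iUnion, mem_Icc, mem_Ici, exists_and_left]
    exact ⟨fun h => h.1, fun h => ⟨h, exists_nat_ge t⟩⟩
  rw [← hU]
  refine tendsto_setIntegral_of_monotone (fun n => measurableSet_Icc)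
    (fun m n h => Icc_subset_Icc_right (by exact_mod_cast h)) ?_
  rw [hU]
  exact hint p hp

theorem measure_singleton_zero_of_tendsto_rpow (ν : Measure I) [IsProbabilityMeasure ν]
    (h : Tendsto (fun p : ℝ => ∫ x, (x : ℝ) ^ p ∂ν) (𝓝[>] 0) (𝓝 1)) : ν {0} = 0 := by
  have hseq : Tendsto (fun n : ℕ => 1 / ((n : ℝ) + 1)) atTop (𝓝[>] 0) :=
    tendsto_nhdsWithin_iff.2 ⟨tendsto_one_div_add_atTop_nhds_zero_nat,
      Eventually.of_forall fun n => mem_Ioi.2 Nat.one_div_pos_of_nat⟩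
  have h1 := h.comp hseq
  have h2 : Tendsto (fun n : ℕ => ∫ x : I, (x : ℝ) ^ (1 / ((n : ℝ) + 1)) ∂ν) atTop
      (𝓝 (∫ x, ({0}ᶜ : Set I).indicator (fun _ => (1 : ℝ)) x ∂ν)) := by
    refine tendsto_integral_of_dominated_convergence (fun _ => 1)
      (fun n => (continuous_unitInterval_rpow Nat.one_div_pos_of_nat).aestronglyMeasurable)
      (integrable_const _) (fun n => ae_of_all _ fun x => ?_) (ae_of_all _ fun x => ?_)
    · rw [Real.norm_of_nonneg (Real.rpow_nonneg x.2.1 _)]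
      exact Real.rpow_le_one x.2.1 x.2.2 Nat.one_div_pos_of_nat.le
    · by_cases hx : x = 0
      · subst hx
        have : ∀ n : ℕ, (((0 : I) : ℝ)) ^ (1 / ((n : ℝ) + 1)) = 0 := fun n =>
          Real.zero_rpow Nat.one_div_pos_of_nat.ne'
        simp only [this]
        simp
      · have hx' : (x : ℝ) ≠ 0 := fun h => hx (Subtype.ext h)
        have := ((Real.continuous_const_rpow hx').tendsto 0).comp
          (tendsto_one_div_add_atTop_nhds_zero_nat (𝕜 := ℝ))
        simpa [hx, Function.comp_def] using this
  have h3 := tendsto_nhds_unique h1 h2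
  rw [integral_indicator (measurableSet_singleton 0).compl] at h3
  rw [← prob_compl_eq_one_iff (measurableSet_singleton 0)]
  have h4 : ν.real {0}ᶜ = 1 := by simpa using h3.symm
  rw [← ofReal_measureReal, h4, ENNReal.ofReal_one]

/-- If every `p ↦ exp (-s φ p)` is a Laplace transform, then the corresponding laws form a
Markov kernel in the parameter `s`. -/
theorem exists_kernel_laplace_eq_exp (φ : ℝ → ℝ)
    (h : ∀ s, 0 ≤ s → IsUnitMomentFunction fun p => Real.exp (-(s * φ p)))
    (hφ : Tendsto φ (𝓝[>] 0) (𝓝 0)) :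
    ∃ κ : ProbabilityTheory.Kernel ℝ ℝ, ProbabilityTheory.IsMarkovKernel κ ∧
      (∀ s, ∀ᵐ τ ∂κ s, 0 ≤ τ) ∧
      ∀ s, 0 ≤ s → ∀ p, 0 < p → ∫ τ, Real.exp (-p * τ) ∂κ s = Real.exp (-(s * φ p)) := by
  choose ν hν hνp using fun s : ℝ => h (max s 0) (le_max_right _ _)
  beta_reduce at hνp
  have hmeas : Measurable ν := by
    refine measurable_measure_unitInterval_of_moments ν fun n => ?_
    rcases Nat.eq_zero_or_pos n with rfl | hn
    · simp
    · have : ∀ s, ∫ x, (x : ℝ) ^ n ∂ν s = Real.exp (-(max s 0 * φ n)) := fun s => by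
        rw [← hνp s n (by exact_mod_cast hn)]
        simp
      simp_rw [this]
      fun_prop
  have hzero : ∀ s, ν s {0} = 0 := fun s => by
    refine measure_singleton_zero_of_tendsto_rpow _ ?_
    have h1 : Tendsto (fun p => Real.exp (-(max s 0 * φ p))) (𝓝[>] 0) (𝓝 1) := by
      have := (Real.continuous_exp.tendsto _).comp ((hφ.const_mul (max s 0)).neg)
      simpa [Function.comp_def] using this
    refine h1.congr' ?_
    filter_upwards [self_mem_nhdsWithin] with p hp
    exact (hνp s p hp).symm
  let l : I → ℝ := fun x => -Real.log x
  have hl : Measurable l := by fun_prop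
  refine ⟨⟨fun s => (ν s).map l, (Measure.measurable_map l hl).comp hmeas⟩,
    ⟨fun s => Measure.isProbabilityMeasure_map hl.aemeasurable⟩, fun s => ?_, fun s hs p hp => ?_⟩
  · refine (ae_map_iff hl.aemeasurable measurableSet_Ici).2 (ae_of_all _ fun x => ?_)
    exact neg_nonneg.2 (Real.log_nonpos x.2.1 x.2.2)
  · change ∫ τ, Real.exp (-p * τ) ∂(ν s).map l = _
    rw [integral_map hl.aemeasurable (by fun_prop)]
    have h2 := hνp s p hp
    rw [max_eq_left hs] at h2
    rw [← h2]
    refine integral_congr_ae ?_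
    have : ∀ᵐ x ∂ν s, x ≠ 0 := by
      rw [ae_iff]; simpa using hzero s
    filter_upwards [this] with x hx
    have hx' : (0 : ℝ) < x := lt_of_le_of_ne x.2.1 fun h => hx (Subtype.ext h.symm)
    rw [Real.rpow_def_of_pos hx']
    congr 1
    simp only [l]
    ring

/-- Uniqueness theorem for the Laplace transform of nonnegative functions. -/
theorem ae_eq_of_laplace_lintegral_eq {f g : ℝ → ℝ≥0∞} (hf : Measurable f) (hg : Measurable g)
    (hfin : ∫⁻ t in Ioi 0, ENNReal.ofReal (Real.exp (-1 * t)) * f t ≠ ⊤)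
    (h : ∀ p : ℝ, 0 < p → ∫⁻ t in Ioi 0, ENNReal.ofReal (Real.exp (-p * t)) * f t
      = ∫⁻ t in Ioi 0, ENNReal.ofReal (Real.exp (-p * t)) * g t) :
    f =ᵐ[volume.restrict (Ioi 0)] g := by
  let e : ℝ → I := fun t => ⟨Real.exp (-max t 0), (Real.exp_pos _).le,
    Real.exp_le_one_iff.2 (neg_nonpos.2 (le_max_right _ _))⟩
  have he : Measurable e := Measurable.subtype_mk (by fun_prop)
  let d : (ℝ → ℝ≥0∞) → ℝ → ℝ≥0∞ := fun u t => ENNReal.ofReal (Real.exp (-1 * t)) * u t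
  have hd : ∀ u, Measurable u → Measurable (d u) := fun u hu => by fun_prop
  let α : (ℝ → ℝ≥0∞) → Measure ℝ := fun u => (volume.restrict (Ioi 0)).withDensity (d u)
  have hmom : ∀ u, Measurable u → ∀ n : ℕ, ∫ x, (x : ℝ) ^ n ∂(α u).map e
      = (∫⁻ t in Ioi 0, ENNReal.ofReal (Real.exp (-(n + 1 : ℝ) * t)) * u t).toReal := by
    intro u hu n
    rw [integral_map he.aemeasurable (by fun_prop), integral_eq_lintegral_of_nonneg_ae
      (ae_of_all _ fun t => by positivity) (by fun_prop),
      lintegral_withDensity_eq_lintegral_mul _ (hd u hu) (by fun_prop)]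
    congr 1
    refine setLIntegral_congr_fun measurableSet_Ioi fun t ht => ?_
    have ht' : max t 0 = t := max_eq_left (le_of_lt ht)
    simp only [Pi.mul_apply, d, e, ht']
    rw [mul_right_comm, ← ENNReal.ofReal_mul (Real.exp_pos _).le, ← Real.exp_nat_mul,
      ← Real.exp_add]
    congr 3
    ring
  have hfinf : IsFiniteMeasure (α f) := isFiniteMeasure_withDensity hfin
  have hfing : IsFiniteMeasure (α g) := isFiniteMeasure_withDensity (h 1 one_pos ▸ hfin)
  have hmap : (α f).map e = (α g).map e := by
    refine measure_unitInterval_ext_of_moments _ _ fun n => ?_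
    rw [hmom f hf, hmom g hg, h _ (by positivity)]
  have hback : ∀ u, ((α u).map e).map (fun x : I => -Real.log x) = α u := by
    intro u
    rw [Measure.map_map (by fun_prop) he]
    conv_rhs => rw [← Measure.map_id (μ := α u)]
    refine Measure.map_congr ?_
    have : ∀ᵐ t ∂volume.restrict (Ioi (0 : ℝ)),
        ((fun x : I => -Real.log x) ∘ e) t = id t := by
      refine (ae_restrict_iff' measurableSet_Ioi).2 (ae_of_all _ fun t ht => ?_)
      have ht' : max t 0 = t := max_eq_left (le_of_lt ht)
      simp [e, ht']
    exact (withDensity_absolutelyContinuous _ _).ae_le this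
  have hα : α f = α g := by rw [← hback f, ← hback g, hmap]
  have := (withDensity_eq_iff (hd f hf).aemeasurable (hd g hg).aemeasurable hfin).1 hα
  filter_upwards [this] with t ht
  exact (ENNReal.mul_right_inj (by simp [Real.exp_pos]) (by simp)).1 ht

theorem lintegral_exp_mul_lintegral_sub (ρ : Measure ℝ) [SFinite ρ] {h : ℝ → ℝ≥0∞}
    (hh : Measurable h) (p : ℝ) :
    ∫⁻ t, ENNReal.ofReal (Real.exp (-p * t)) * ∫⁻ τ, h (t - τ) ∂ρ
      = (∫⁻ τ, ENNReal.ofReal (Real.exp (-p * τ)) ∂ρ)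
        * ∫⁻ t, ENNReal.ofReal (Real.exp (-p * t)) * h t := by
  have h1 : ∀ t, ENNReal.ofReal (Real.exp (-p * t)) * ∫⁻ τ, h (t - τ) ∂ρ
      = ∫⁻ τ, ENNReal.ofReal (Real.exp (-p * t)) * h (t - τ) ∂ρ := fun t =>
    (lintegral_const_mul _ (by fun_prop)).symm
  simp_rw [h1]
  rw [lintegral_lintegral_swap (by fun_prop), ← lintegral_mul_const _ (by fun_prop)]
  refine lintegral_congr fun τ => ?_
  rw [← lintegral_const_mul _ (by fun_prop),
    ← lintegral_sub_right_eq_self (fun t => ENNReal.ofReal (Real.exp (-p * τ)) *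
      (ENNReal.ofReal (Real.exp (-p * t)) * h t)) τ]
  refine lintegral_congr fun t => ?_
  rw [← mul_assoc, ← ENNReal.ofReal_mul (Real.exp_pos _).le, ← Real.exp_add]
  congr 3
  ring

theorem setLIntegral_Ioi_eq_lintegral {f : ℝ → ℝ≥0∞} (hf : ∀ t, t ≤ 0 → f t = 0) :
    ∫⁻ t in Ioi 0, f t = ∫⁻ t, f t := by
  rw [← lintegral_indicator measurableSet_Ioi]
  refine lintegral_congr fun t => ?_
  by_cases ht : 0 < t
  · simp [ht]
  · simp [ht, hf t (not_lt.1 ht)]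

theorem measurable_lintegral_sub_kernel (κ : ProbabilityTheory.Kernel ℝ ℝ)
    [ProbabilityTheory.IsMarkovKernel κ] {h : ℝ → ℝ≥0∞} (hh : Measurable h) :
    Measurable fun q : ℝ × ℝ => ∫⁻ τ, h (q.2 - τ) ∂κ q.1 := by
  have : Measurable fun q : ℝ × ℝ => ∫⁻ τ, h (q.2 - τ) ∂(κ.comap Prod.fst measurable_fst) q :=
    Measurable.lintegral_kernel_prod_right' (f := fun w : (ℝ × ℝ) × ℝ => h (w.1.2 - w.2))
      (by fun_prop)
  simpa only [ProbabilityTheory.Kernel.comap_apply] using this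

theorem lintegral_exp_neg_mul_Ioi {a : ℝ} (ha : 0 < a) :
    ∫⁻ t in Ioi 0, ENNReal.ofReal (Real.exp (-a * t)) = ENNReal.ofReal (1 / a) := by
  rw [← ofReal_integral_eq_lintegral_ofReal (integrableOn_exp_mul_Ioi (neg_lt_zero.2 ha) 0)
    (ae_of_all _ fun t => (Real.exp_pos _).le), integral_exp_mul_Ioi (neg_lt_zero.2 ha)]
  simp

/-- A function on `(0, ∞)` agrees almost everywhere with the real part of a measurable
extended-nonnegative function vanishing on `(-∞, 0]`. -/
theorem exists_measurable_ennreal_representative {k : ℝ → ℝ} (hk : ∀ t, 0 < t → 0 ≤ k t)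
    (hkm : AEMeasurable k (volume.restrict (Ioi 0))) :
    ∃ h : ℝ → ℝ≥0∞, Measurable h ∧ (∀ t, t ≤ 0 → h t = 0) ∧ (∀ t, h t ≠ ⊤) ∧
      (∀ᵐ t ∂(volume.restrict (Ioi 0)), h t = ENNReal.ofReal (k t)) ∧
      ∀ᵐ t, 0 ≤ t → k t = (h t).toReal := by
  have hae : ∀ᵐ t ∂(volume.restrict (Ioi 0)),
      (Ioi 0).indicator (fun t => ENNReal.ofReal (hkm.mk k t)) t = ENNReal.ofReal (k t) := by
    filter_upwards [hkm.ae_eq_mk, ae_restrict_mem measurableSet_Ioi] with t ht ht0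
    rw [indicator_of_mem ht0, ← ht]
  refine ⟨(Ioi 0).indicator fun t => ENNReal.ofReal (hkm.mk k t),
    (hkm.measurable_mk.ennreal_ofReal).indicator measurableSet_Ioi, fun t ht => ?_, fun t => ?_,
    hae, ?_⟩
  · exact indicator_of_notMem (not_lt.2 ht) _
  · by_cases ht : t ∈ Ioi (0 : ℝ)
    · rw [indicator_of_mem ht]; exact ENNReal.ofReal_ne_top
    · rw [indicator_of_notMem ht]; exact ENNReal.zero_ne_top
  · have h0 : ∀ᵐ t : ℝ, t ≠ 0 := by rw [ae_iff]; simp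
    filter_upwards [(ae_restrict_iff' measurableSet_Ioi).1 hae, h0] with t ht ht0 ht1
    have hpos : 0 < t := lt_of_le_of_ne ht1 (Ne.symm ht0)
    rw [ht hpos, ENNReal.toReal_ofReal (hk t hpos)]

/-- Convolving with a finite measure `ρ` on `[0, ∞)` does not see a Lebesgue-null modification of
the function, outside the zeros of an auxiliary convolution. -/
theorem setIntegral_Icc_sub_eq_toReal_lintegral {ρ : Measure ℝ} (hρ : ∀ᵐ τ ∂ρ, 0 ≤ τ)
    {k : ℝ → ℝ} {h : ℝ → ℝ≥0∞} (hm : Measurable h) (h0 : ∀ t, t ≤ 0 → h t = 0)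
    (htop : ∀ t, h t ≠ ⊤) {N : Set ℝ} (hN : MeasurableSet N)
    (hkN : ∀ t, t ∉ N → 0 ≤ t → k t = (h t).toReal) {t : ℝ}
    (ht : ∫⁻ τ, N.indicator (fun _ => 1) (t - τ) ∂ρ = 0) :
    ∫ τ in Icc 0 t, k (t - τ) ∂ρ = (∫⁻ τ, h (t - τ) ∂ρ).toReal := by
  have hind : Measurable (N.indicator fun _ => (1 : ℝ≥0∞)) := measurable_const.indicator hN
  rw [lintegral_eq_zero_iff (by fun_prop)] at ht
  have h1 : ∫ τ in Icc 0 t, k (t - τ) ∂ρ = ∫ τ in Icc 0 t, (h (t - τ)).toReal ∂ρ := by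
    refine integral_congr_ae ?_
    filter_upwards [ae_restrict_of_ae ht, ae_restrict_mem measurableSet_Icc] with τ hτ hτ'
    refine hkN _ (fun hmem => ?_) (sub_nonneg.2 hτ'.2)
    simp [hmem] at hτ
  rw [h1, integral_toReal (by fun_prop) (ae_of_all _ fun τ => (htop _).lt_top)]
  congr 1
  rw [← lintegral_indicator measurableSet_Icc]
  refine lintegral_congr_ae ?_
  filter_upwards [hρ] with τ hτ
  by_cases hτt : τ ≤ t
  · rw [indicator_of_mem (show τ ∈ Icc 0 t from ⟨hτ, hτt⟩)]
  · rw [indicator_of_notMem (fun h => hτt h.2), h0 _ (by linarith)]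

theorem kernel_transform_pos {k K : ℝ → ℝ} (hk_nonneg : ∀ t, 0 < t → 0 ≤ k t)
    (hK_int : ∀ p, 0 < p → IntegrableOn (fun t => Real.exp (-p * t) * k t) (Ioi 0))
    (hK_def : ∀ p, 0 < p → K p = ∫ t in Ioi 0, Real.exp (-p * t) * k t)
    (hpK_inf : Tendsto (fun p => p * K p) atTop atTop) {p : ℝ} (hp : 0 < p) : 0 < K p := by
  have hnn : ∀ q, 0 ≤ᵐ[volume.restrict (Ioi 0)] fun t => Real.exp (-q * t) * k t := fun q =>
    (ae_restrict_iff' measurableSet_Ioi).2 (ae_of_all _ fun t ht =>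
      mul_nonneg (Real.exp_pos _).le (hk_nonneg t ht))
  refine lt_of_le_of_ne (hK_def p hp ▸ integral_nonneg_of_ae (hnn p)) fun h => ?_
  rw [hK_def p hp, eq_comm, integral_eq_zero_iff_of_nonneg_ae (hnn p) (hK_int p hp)] at h
  obtain ⟨q, hq, hq0⟩ := ((hpK_inf.eventually_gt_atTop 0).and (eventually_gt_atTop 0)).exists
  have : K q = 0 := by
    rw [hK_def q hq0]
    refine integral_eq_zero_of_ae ?_
    filter_upwards [h] with t ht
    have : k t = 0 := by simpa [(Real.exp_pos _).ne'] using ht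
    simp [this]
  simp [this] at hq

end UnitIntervalTransform

/-- Under assumption (*), for each `s > 0` there is a probability
Borel measure `μ_s` on `[0,∞)` with `∫ e^{-pτ} μ_s(dτ) = exp(-s p K(p))`; moreover,
with `G(s,t) = ∫_{[0,t]} k(t-τ) μ_s(dτ)`, one has
`∫₀^∞ e^{-pt} G(s,t) dt = K(p) exp(-s p K(p))` for all `p, s > 0`, and
`∫₀^∞ G(s,t) ds = 1` for almost every `t > 0`. -/
theorem statement8
    (k K : ℝ → ℝ) (σ : MeasureTheory.Measure ℝ)
    (hk_nonneg : ∀ t, 0 < t → 0 ≤ k t)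
    (hk_loc : ∀ T, 0 < T → MeasureTheory.IntegrableOn k (Set.Ioc 0 T))
    (hK_int : ∀ p, 0 < p →
      MeasureTheory.IntegrableOn (fun t => Real.exp (-p * t) * k t) (Set.Ioi 0))
    (hK_def : ∀ p, 0 < p → K p = ∫ t in Set.Ioi 0, Real.exp (-p * t) * k t)
    (hσ_int : MeasureTheory.IntegrableOn (fun t => (1 + t)⁻¹) (Set.Ici 0) σ)
    (hK_st : ∀ p, 0 < p → K p = ∫ t in Set.Ici 0, (p + t)⁻¹ ∂σ)
    (hK_zero : Filter.Tendsto K (nhdsWithin 0 (Set.Ioi 0)) Filter.atTop)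
    (hK_inf : Filter.Tendsto K Filter.atTop (nhds 0))
    (hpK_zero : Filter.Tendsto (fun p => p * K p) (nhdsWithin 0 (Set.Ioi 0)) (nhds 0))
    (hpK_inf : Filter.Tendsto (fun p => p * K p) Filter.atTop Filter.atTop) :
    ∃ μ : ℝ → Measure ℝ,
      (∀ s, 0 < s → IsProbabilityMeasure (μ s)) ∧
      (∀ s, 0 < s → μ s (Set.Iio 0) = 0) ∧
      (∀ s, 0 < s → ∀ p, 0 < p →
        ∫ τ in Set.Ici 0, Real.exp (-p * τ) ∂(μ s)
          = Real.exp (-(s * (p * K p)))) ∧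
      (∀ s, 0 < s → ∀ p, 0 < p →
        ∫ t in Set.Ioi 0,
            Real.exp (-p * t) * ∫ τ in Set.Icc 0 t, k (t - τ) ∂(μ s)
          = K p * Real.exp (-(s * (p * K p)))) ∧
      (∀ᵐ t ∂(volume.restrict (Set.Ioi 0)),
        ∫ s in Set.Ioi 0, (∫ τ in Set.Icc 0 t, k (t - τ) ∂(μ s)) = 1) := by
  have hK_pos : ∀ p, 0 < p → 0 < K p := fun p hp =>
    kernel_transform_pos hk_nonneg hK_int hK_def hpK_inf hp
  obtain ⟨κ, hκ, hκ0, hκL⟩ := exists_kernel_laplace_eq_exp (fun p => p * K p)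
    (fun s hs => (isUnitMomentFunction_exp_stieltjes σ hσ_int hs).congr fun p hp => by
      rw [hK_st p hp]) hpK_zero
  have hkm : AEMeasurable k (volume.restrict (Ioi 0)) := by
    have h1 := (hK_int 1 one_pos).aemeasurable
    have h2 : k = fun t => Real.exp t * (Real.exp (-1 * t) * k t) := by
      funext t
      rw [← mul_assoc, ← Real.exp_add]
      simp
    rw [h2]
    exact Real.measurable_exp.aemeasurable.mul h1
  obtain ⟨h, hm, h0, htop, hhk, hkh⟩ := exists_measurable_ennreal_representative hk_nonneg hkm
  let N := toMeasurable volume {t | ¬(0 ≤ t → k t = (h t).toReal)}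
  have hN : MeasurableSet N := measurableSet_toMeasurable _ _
  have hN0 : volume N = 0 := (measure_toMeasurable _).trans (ae_iff.1 hkh)
  have hkN : ∀ t, t ∉ N → 0 ≤ t → k t = (h t).toReal := fun t ht =>
    by_contra fun hc => ht (subset_toMeasurable _ _ hc)
  let L : ℝ → ℝ → ENNReal := fun s t => ∫⁻ τ, h (t - τ) ∂κ s
  have hLm : Measurable fun q : ℝ × ℝ => L q.1 q.2 := measurable_lintegral_sub_kernel κ hm
  have hLm' : ∀ s, Measurable (L s) := fun s => hLm.comp measurable_prodMk_left
  have hL0 : ∀ s t, t ≤ 0 → L s t = 0 := fun s t ht => by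
    refine (lintegral_congr_ae ?_).trans lintegral_zero
    filter_upwards [hκ0 s] with τ hτ
    exact h0 _ (by linarith)
  have hhL : ∀ p, 0 < p →
      ∫⁻ t, ENNReal.ofReal (Real.exp (-p * t)) * h t = ENNReal.ofReal (K p) := fun p hp => by
    rw [← setLIntegral_Ioi_eq_lintegral (fun t ht => by rw [h0 t ht, mul_zero]), hK_def p hp,
      ofReal_integral_eq_lintegral_ofReal (hK_int p hp)
      ((ae_restrict_iff' measurableSet_Ioi).2 (ae_of_all _ fun t ht =>
        mul_nonneg (Real.exp_pos _).le (hk_nonneg t ht)))]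
    refine lintegral_congr_ae ?_
    filter_upwards [hhk] with t ht
    rw [ht, ENNReal.ofReal_mul (Real.exp_pos _).le]
  have hlap : ∀ s, 0 ≤ s → ∀ p, 0 < p →
      ∫⁻ t in Ioi 0, ENNReal.ofReal (Real.exp (-p * t)) * L s t
        = ENNReal.ofReal (K p * Real.exp (-(s * (p * K p)))) := fun s hs p hp => by
    have hexp : Integrable (fun τ => Real.exp (-p * τ)) (κ s) := by
      refine Integrable.of_bound (by fun_prop) 1 ?_
      filter_upwards [hκ0 s] with τ hτ
      rw [Real.norm_of_nonneg (Real.exp_pos _).le, Real.exp_le_one_iff]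
      nlinarith
    rw [setLIntegral_Ioi_eq_lintegral (fun t ht => by rw [hL0 s t ht, mul_zero]),
      lintegral_exp_mul_lintegral_sub _ hm, hhL p hp,
      ← ofReal_integral_eq_lintegral_ofReal hexp (ae_of_all _ fun τ => (Real.exp_pos _).le),
      hκL s hs p hp, ← ENNReal.ofReal_mul (Real.exp_pos _).le, mul_comm]
  have hind : Measurable (N.indicator fun _ => (1 : ENNReal)) := measurable_const.indicator hN
  have hnull : ∀ s, ∀ᵐ t, ∫⁻ τ, N.indicator (fun _ => 1) (t - τ) ∂κ s = 0 := fun s => by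
    have h1 := lintegral_exp_mul_lintegral_sub (κ s) hind 0
    have h2 : Measurable fun t => ∫⁻ τ, N.indicator (fun _ => 1) (t - τ) ∂κ s :=
      (measurable_lintegral_sub_kernel κ hind).comp (measurable_prodMk_left (x := s))
    simp only [neg_zero, zero_mul, Real.exp_zero, ENNReal.ofReal_one, one_mul] at h1
    rw [lintegral_indicator hN, setLIntegral_measure_zero _ _ hN0, mul_zero,
      lintegral_eq_zero_iff h2] at h1
    exact h1
  have hG : ∀ s t, ∫⁻ τ, N.indicator (fun _ => 1) (t - τ) ∂κ s = 0 →
      ∫ τ in Icc 0 t, k (t - τ) ∂κ s = (L s t).toReal := fun s t ht =>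
    setIntegral_Icc_sub_eq_toReal_lintegral (hκ0 s) hm h0 htop hN hkN ht
  refine ⟨κ, fun s _ => inferInstance, fun s _ => ?_, fun s hs p hp => ?_, fun s hs p hp => ?_, ?_⟩
  · simpa [ae_iff, Iio_def] using hκ0 s
  · rw [← hκL s hs.le p hp, Measure.restrict_eq_self_of_ae_mem]
    exact hκ0 s
  · have hmeas : Measurable fun t => ENNReal.ofReal (Real.exp (-p * t)) * L s t :=
      (by fun_prop : Measurable fun t : ℝ => ENNReal.ofReal (Real.exp (-p * t))).mul (hLm' s)
    have hfin : ∀ᵐ t ∂(volume.restrict (Ioi 0)),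
        ENNReal.ofReal (Real.exp (-p * t)) * L s t < ⊤ :=
      ae_lt_top hmeas (by rw [hlap s hs.le p hp]; exact ENNReal.ofReal_ne_top)
    calc ∫ t in Ioi 0, Real.exp (-p * t) * ∫ τ in Icc 0 t, k (t - τ) ∂κ s
        = ∫ t in Ioi 0, (ENNReal.ofReal (Real.exp (-p * t)) * L s t).toReal := by
          refine integral_congr_ae ?_
          filter_upwards [ae_restrict_of_ae (hnull s)] with t ht
          rw [hG s t ht, ENNReal.toReal_mul, ENNReal.toReal_ofReal (Real.exp_pos _).le]
      _ = K p * Real.exp (-(s * (p * K p))) := by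
          rw [integral_toReal hmeas.aemeasurable hfin,
            hlap s hs.le p hp, ENNReal.toReal_ofReal
              (mul_nonneg (hK_pos p hp).le (Real.exp_pos _).le)]
  · have hWm : Measurable fun t => ∫⁻ s in Ioi 0, L s t := by
      exact Measurable.lintegral_prod_left' (f := fun q : ℝ × ℝ => L q.1 q.2) hLm
    have hWlap : ∀ p, 0 < p → ∫⁻ t in Ioi 0, ENNReal.ofReal (Real.exp (-p * t))
        * ∫⁻ s in Ioi 0, L s t = ENNReal.ofReal (1 / p) := fun p hp => by
      have h1 : ∀ t, ENNReal.ofReal (Real.exp (-p * t)) * ∫⁻ s in Ioi 0, L s t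
          = ∫⁻ s in Ioi 0, ENNReal.ofReal (Real.exp (-p * t)) * L s t := fun t =>
        (lintegral_const_mul _ (hLm.comp measurable_prodMk_right)).symm
      simp_rw [h1]
      rw [lintegral_lintegral_swap
        (((by fun_prop : Measurable fun q : ℝ × ℝ => ENNReal.ofReal (Real.exp (-p * q.1))).mul
          (hLm.comp measurable_swap)).aemeasurable)]
      have h2 : ∫⁻ s in Ioi 0, ∫⁻ t in Ioi 0, ENNReal.ofReal (Real.exp (-p * t)) * L s t
          = ∫⁻ s in Ioi 0, ENNReal.ofReal (K p)
            * ENNReal.ofReal (Real.exp (-(p * K p) * s)) := by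
        refine setLIntegral_congr_fun measurableSet_Ioi fun s hs => ?_
        rw [hlap s (le_of_lt hs) p hp, ENNReal.ofReal_mul (hK_pos p hp).le]
        congr 3
        ring
      have hKp := hK_pos p hp
      rw [h2, lintegral_const_mul _ (by fun_prop), lintegral_exp_neg_mul_Ioi (by positivity),
        ← ENNReal.ofReal_mul hKp.le]
      congr 1
      field_simp
    have hW := ae_eq_of_laplace_lintegral_eq hWm (measurable_const (a := (1 : ENNReal)))
      (by rw [hWlap 1 one_pos]; exact ENNReal.ofReal_ne_top)
      (fun p hp => by
        rw [hWlap p hp]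
        simp only [mul_one]
        exact (lintegral_exp_neg_mul_Ioi hp).symm)
    have hnull' : ∀ᵐ t, ∀ᵐ s, ∫⁻ τ, N.indicator (fun _ => 1) (t - τ) ∂κ s = 0 := by
      refine (Measure.ae_ae_comm ?_).1 (ae_of_all _ hnull)
      exact measurable_lintegral_sub_kernel κ hind (measurableSet_singleton 0)
    filter_upwards [hW, ae_restrict_of_ae hnull'] with t ht hnt
    have hLt : Measurable fun s => L s t := hLm.comp measurable_prodMk_right
    calc ∫ s in Ioi 0, (∫ τ in Icc 0 t, k (t - τ) ∂κ s)
        = ∫ s in Ioi 0, (L s t).toReal := by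
          refine integral_congr_ae ?_
          filter_upwards [ae_restrict_of_ae hnt] with s hs
          exact hG s t hs
      _ = 1 := by
          rw [integral_toReal hLt.aemeasurable (ae_lt_top hLt (by rw [ht]; simp)), ht]
          simp
end
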